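/- Let k be a finite field and C ∈ k[x₁,…,x₅] a nonzero homogeneous cubic form defining the cubic threefold X := {C = 0} ⊆ ℙ⁴_k. Assume X_{\overline{k}} is not a cone over a cone, i.e. there is no invertible \overline{k}-linear change of coordinates after which C involves only the variables x₁, x₂, x₃. Then X is stably E-bad if and only if X is stably |E|-bad. -/

import Mathlib

open MvPolynomial

/-- Number of points of the projective subset of `ℙ^{m-1}(k)` cut out by the
(scale-invariant) condition `P`. -/
noncomputable def projCount {m : ℕ} (k : Type) [Field k]
    (P : (Fin m → k) → Prop) : ℕ :=
  Nat.card {x : Fin m → k // x ≠ 0 ∧ P x} / (Nat.card k - 1)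

/-- `#ℙ^j(𝔽_q) = 1 + q + ⋯ + q^j`. -/
def projCard (q j : ℕ) : ℕ := ∑ i ∈ Finset.range (j + 1), q ^ i

/-- `E(X_{k''})` for the cubic threefold `{C'' = 0} ⊆ ℙ⁴` over a finite field `k''`. -/
noncomputable def Ecubic (k'' : Type) [Field k'']
    (C'' : MvPolynomial (Fin 5) k'') : ℤ :=
  (projCount k'' (fun x : Fin 5 → k'' => eval x C'' = 0) : ℤ) -
    (projCard (Nat.card k'') 3 : ℤ)

set_option linter.unusedSectionVars false

theorem charP_powerSeries {K : Type*} [Field K] (p : ℕ) [CharP K p] : CharP (PowerSeries K) p :=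
  charP_of_injective_algebraMap (R := K) (A := PowerSeries K) (FaithfulSMul.algebraMap_injective _ _) p

/-- Elements of a space of power series of orders `< p ^ r` are linearly independent over
`p ^ r`-th powers of linearly independent series. -/
theorem eq_zero_of_sum_mul_pow_eq_zero {K : Type*} [Field K] (p : ℕ) [Fact p.Prime] [CharP K p]
    (r : ℕ) (U : Submodule K (PowerSeries K))
    (hU : ∀ u ∈ U, PowerSeries.X ^ p ^ r ∣ u → u = 0) (n : ℕ) :
    ∀ (s u : Fin n → PowerSeries K), LinearIndependent K s → (∀ i, u i ∈ U) →
      ∑ i, u i * s i ^ p ^ r = 0 → ∀ i, u i = 0 := by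
  have := charP_powerSeries (K := K) p
  induction n with
  | zero => intro s u _ _ _ i; exact i.elim0
  | succ n ih =>
    intro s u hs hu h
    have hne : ∀ i, s i ≠ 0 := fun i => hs.ne_zero i
    obtain ⟨i0, -, hmin⟩ := Finset.exists_min_image Finset.univ (fun i => (s i).order.toNat)
      Finset.univ_nonempty
    set e := (s i0).order.toNat with he
    have hord : ∀ i, (((s i).order.toNat : ℕ) : ℕ∞) = (s i).order := fun i =>
      ENat.natCast_toNat (by simpa [PowerSeries.order_eq_top] using hne i)
    have hlow : ∀ i, ∀ k < e, PowerSeries.coeff k (s i) = 0 := by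
      intro i k hk
      apply PowerSeries.coeff_of_lt_order
      rw [← hord i]
      exact_mod_cast lt_of_lt_of_le hk (hmin i (Finset.mem_univ i))
    have hce : PowerSeries.coeff e (s i0) ≠ 0 := PowerSeries.coeff_order (hne i0)
    set c : Fin n → K := fun j => PowerSeries.coeff e (s (i0.succAbove j)) /
      PowerSeries.coeff e (s i0) with hc
    set s' : Fin n → PowerSeries K := fun j => s (i0.succAbove j) - c j • s i0 with hs'
    have hs'dvd : ∀ j, PowerSeries.X ^ (e + 1) ∣ s' j := by
      intro j
      rw [PowerSeries.X_pow_dvd_iff]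
      intro k hk
      rcases Nat.lt_succ_iff_lt_or_eq.mp hk with hk | rfl
      · simp [hs', hlow _ k hk]
      · simp [hs', hc, div_mul_cancel₀ _ hce]
    have hs'ind : LinearIndependent K s' := by
      rw [Fintype.linearIndependent_iff] at hs ⊢
      intro g hg
      have := hs (i0.insertNth (-∑ j, g j * c j) g) (by
        rw [Fin.sum_univ_succAbove _ i0]
        simp only [Fin.insertNth_apply_same, Fin.insertNth_apply_succAbove]
        rw [← hg]
        simp only [hs', smul_sub, Finset.sum_sub_distrib, smul_smul, ← Finset.sum_smul, neg_smul]
        abel)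
      intro j
      simpa using this (i0.succAbove j)
    set u' := u i0 + ∑ j, (c j) ^ p ^ r • u (i0.succAbove j) with hu'
    have hu'U : u' ∈ U := U.add_mem (hu i0) (U.sum_mem fun j _ => U.smul_mem _ (hu _))
    have key : u' * s i0 ^ p ^ r + ∑ j, u (i0.succAbove j) * s' j ^ p ^ r = 0 := by
      rw [← h, Fin.sum_univ_succAbove _ i0, hu', add_mul, add_assoc, Finset.sum_mul,
        ← Finset.sum_add_distrib]
      congr 1
      refine Finset.sum_congr rfl fun j _ => ?_
      rw [hs', sub_pow_char_pow, smul_pow, mul_sub]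
      simp only [smul_mul_assoc, mul_smul_comm]
      ring
    have hu'0 : u' = 0 := by
      apply hU _ hu'U
      obtain ⟨w, hw⟩ : PowerSeries.X ^ e ∣ s i0 := by
        rw [PowerSeries.X_pow_dvd_iff]; exact hlow i0
      have hwc : PowerSeries.coeff 0 w ≠ 0 := by
        have := hce
        rw [hw, PowerSeries.coeff_X_pow_mul'] at this
        simpa using this
      have hwu : IsUnit w := by
        rw [PowerSeries.isUnit_iff_constantCoeff]
        simpa using hwc
      have hd : PowerSeries.X ^ ((e + 1) * p ^ r) ∣ u' * s i0 ^ p ^ r := by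
        rw [eq_neg_of_add_eq_zero_left key, dvd_neg]
        refine Finset.dvd_sum fun j _ => Dvd.dvd.mul_left ?_ _
        rw [pow_mul]
        exact pow_dvd_pow_of_dvd (hs'dvd j) _
      rw [hw, mul_pow, ← pow_mul, add_mul, one_mul, pow_add, mul_left_comm] at hd
      have hd' := (mul_dvd_mul_iff_left (pow_ne_zero _ PowerSeries.X_ne_zero)).1 hd
      exact ((hwu.pow _).dvd_mul_right).1 hd'
    have hrest := ih s' (fun j => u (i0.succAbove j)) hs'ind (fun j => hu _) (by
      rw [hu'0, zero_mul, zero_add] at key; exact key)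
    intro i
    rcases Fin.eq_self_or_eq_succAbove i0 i with rfl | ⟨j, rfl⟩
    · have : u' = u i := by simp [hu', hrest]
      rw [← this, hu'0]
    · exact hrest j

/-- A multiplicative exhaustive filtration of an algebra with linear growth `D * m`. -/
structure LinFilt (K R : Type*) [Field K] [CommRing R] [Algebra K R] (D c : ℕ) where
  L : ℕ → Submodule K R
  mono : Monotone L
  mul : ∀ {a b : ℕ} {x y : R}, x ∈ L a → y ∈ L b → x * y ∈ L (a + b)
  exh : ∀ x, ∃ n, x ∈ L n
  one : 1 ∈ L 0
  fin : ∀ n, FiniteDimensional K (L n)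
  le : ∀ n, Module.finrank K (L n) ≤ D * n + c
  ge : ∀ n, D * n ≤ Module.finrank K (L n) + c

namespace LinFilt

variable {K R : Type*} [Field K] [CommRing R] [Algebra K R] {D c : ℕ}

theorem pow_mem (F : LinFilt K R D c) {a : ℕ} {x : R} (hx : x ∈ F.L a) (n : ℕ) :
    x ^ n ∈ F.L (a * n) := by
  induction n with
  | zero => simpa using F.one
  | succ n ih => rw [pow_succ, mul_add_one]; exact F.mul ih hx

theorem finrank_le_of_surjective [IsDomain R] (F : LinFilt K R D c) {E : Type*} [AddCommGroup E]
    [Module K E] [FiniteDimensional K E] (ψ : R →ₗ[K] E) (hψ : Function.Surjective ψ) {h : R}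
    (h0 : h ≠ 0) {δ : ℕ} (hδ : h ∈ F.L δ) (hker : ∀ r, ψ (h * r) = 0) :
    Module.finrank K E ≤ D * δ + 2 * c := by
  have := F.fin
  obtain ⟨N, hN⟩ : ∃ N, ∀ e, ∃ x ∈ F.L N, ψ x = e := by
    let b := Module.finBasis K E
    choose x hx using fun i => hψ (b i)
    choose n hn using fun i => F.exh (x i)
    refine ⟨Finset.univ.sup n, fun e => ⟨∑ i, b.repr e i • x i, ?_, ?_⟩⟩
    · exact Submodule.sum_mem _ fun i _ => Submodule.smul_mem _ _
        (F.mono (Finset.le_sup (Finset.mem_univ i)) (hn i))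
    · simp [hx, b.sum_repr]
  let φ : F.L (δ + N) →ₗ[K] E := ψ.comp (F.L (δ + N)).subtype
  have hφ : LinearMap.range φ = ⊤ := by
    rw [LinearMap.range_eq_top]
    intro e
    obtain ⟨x, hx, rfl⟩ := hN e
    exact ⟨⟨x, F.mono (Nat.le_add_left _ _) hx⟩, rfl⟩
  let μ : F.L N →ₗ[K] LinearMap.ker φ :=
    LinearMap.codRestrict _ (LinearMap.codRestrict (F.L (δ + N))
      ((LinearMap.mulLeft K h).comp (F.L N).subtype) fun x => F.mul hδ x.2)
      fun x => hker x
  have hμ : Function.Injective μ := by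
    intro x y hxy
    have : h * (x : R) = h * y := congrArg (fun z : LinearMap.ker φ => ((z : F.L (δ + N)) : R)) hxy
    exact Subtype.ext (mul_left_cancel₀ h0 this)
  have h1 := LinearMap.finrank_le_finrank_of_injective hμ
  have h2 := LinearMap.finrank_range_add_finrank_ker φ
  rw [hφ, finrank_top] at h2
  have h3 := F.le (δ + N)
  have h4 := F.ge N
  rw [mul_add] at h3
  omega

theorem card_le_of_eval_eq_zero [IsDomain R] (F : LinFilt K R D c) (T : Finset (R →ₐ[K] K)) {h : R}
    (h0 : h ≠ 0) {δ : ℕ} (hδ : h ∈ F.L δ) (hT : ∀ P ∈ T, P h = 0) :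
    T.card ≤ D * δ + 2 * c := by
  classical
  let ψ : R →ₗ[K] (T → K) := LinearMap.pi fun P => P.1.toLinearMap
  have hψ : Function.Surjective ψ := by
    rw [← LinearMap.range_eq_top]
    by_contra hne
    obtain ⟨f, hf0, hf⟩ := Submodule.exists_le_ker_of_lt_top _ (lt_top_iff_ne_top.2 hne)
    apply hf0
    have hli := (linearIndependent_monoidHom R K).comp
      (fun P : T => ((P.1 : R →ₐ[K] K) : R →* K)) (by
        intro P P' hPP'
        apply Subtype.ext
        ext r
        exact DFunLike.congr_fun hPP' r)
    rw [Fintype.linearIndependent_iff] at hli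
    have h0 := hli (fun P => f (Pi.single P 1)) (by
      funext r
      have hr : f (ψ r) = 0 := hf ⟨r, rfl⟩
      rw [← Finset.univ_sum_single (ψ r), map_sum] at hr
      rw [Pi.zero_apply, ← hr, Finset.sum_apply]
      refine Finset.sum_congr rfl fun P _ => ?_
      have : (Pi.single P (ψ r P) : T → K) = (P.1 r) • Pi.single P 1 := by
        rw [← Pi.single_smul, smul_eq_mul, mul_one]; rfl
      rw [this, map_smul, smul_eq_mul, mul_comm]; rfl)
    refine LinearMap.pi_ext' fun P => LinearMap.ext_ring ?_
    simpa using h0 P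
  have := F.finrank_le_of_surjective ψ hψ h0 hδ (by
    intro r; funext P
    have : P.1 (h * r) = 0 := by rw [map_mul, hT _ P.2, zero_mul]
    exact this)
  simpa using this

theorem le_of_X_pow_dvd [IsDomain R] (F : LinFilt K R D c) (lam : R →ₐ[K] PowerSeries K)
    {r : R} (hr : lam r = PowerSeries.X) {g : R} (g0 : g ≠ 0) {l : ℕ} (hl : g ∈ F.L l) {M : ℕ}
    (hM : PowerSeries.X ^ M ∣ lam g) : M ≤ D * l + 2 * c := by
  let ψ : R →ₗ[K] (Fin M → K) :=
    LinearMap.pi fun i => (PowerSeries.coeff (i : ℕ)).comp lam.toLinearMap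
  have := F.finrank_le_of_surjective ψ (by
    intro e
    refine ⟨∑ i, e i • r ^ (i : ℕ), ?_⟩
    funext k
    have : PowerSeries.coeff (k : ℕ) (lam (∑ i, e i • r ^ (i : ℕ))) = e k := by
      simp only [map_sum, map_smul, map_pow, hr, PowerSeries.coeff_X_pow, smul_eq_mul, mul_ite,
        mul_one, mul_zero, Fin.val_inj]
      simp
    exact this) g0 hl (by
    intro s; funext k
    have : PowerSeries.coeff (k : ℕ) (lam (g * s)) = 0 := by
      rw [map_mul]
      exact PowerSeries.X_pow_dvd_iff.1 (hM.mul_right _) _ k.2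
    exact this)
  simpa using this

end LinFilt

theorem exists_stepanov_parameters (D c c' e : ℕ) (hD : 0 < D) :
    ∃ Q0 B : ℕ, ∀ Q ≥ Q0, ∃ l m : ℕ, D * l + 2 * c < Q ∧
      (∀ a b : ℕ, D * m ≤ a + c → D * l ≤ b + c → D * e * (l * Q + m) + c' < a * b) ∧
      D * (l + m * Q) + 2 * c ≤ e * Q ^ 2 + B * Q := by
  set c1 := 3 * c + D
  set r := c + c1 * e + e ^ 2 + 1 with hr
  refine ⟨c1 * r + e * r + e * D + c' + c1 + 1, r + D + 1, fun Q hQ =>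
    ⟨(Q - 2 * c - 1) / D, (e * Q + r) / D + 1, ?_, ?_, ?_⟩⟩ 
  all_goals
    have hQc : c1 + 1 ≤ Q := by omega
    have hl1 : D * ((Q - 2 * c - 1) / D) ≤ Q - 2 * c - 1 := Nat.mul_div_le _ _
    have hl2 : Q - 2 * c - 1 < D * ((Q - 2 * c - 1) / D + 1) := Nat.lt_mul_div_succ _ hD
    have hm1 : D * ((e * Q + r) / D) ≤ e * Q + r := Nat.mul_div_le _ _
    have hm2 : e * Q + r < D * ((e * Q + r) / D + 1) := Nat.lt_mul_div_succ _ hD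
    generalize (Q - 2 * c - 1) / D = l at *
    generalize (e * Q + r) / D = m at *
    rw [mul_add, mul_one] at hl2 hm2
  · omega
  · intro a b ha hb
    have ha' : e * Q + r ≤ a + c := by rw [mul_add] at ha; omega
    have hb' : Q ≤ b + c1 := by omega
    have h1 : D * l ≤ Q - 1 := by omega
    have h2 : D * e * (l * Q + (m + 1)) ≤ e * (Q - 1 - 2 * c) * Q + e * (e * Q + r + D) := by
      have h3 : D * l ≤ Q - 1 - 2 * c := by omega
      calc D * e * (l * Q + (m + 1)) = e * (D * l) * Q + e * (D * m + D) := by ring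
        _ ≤ _ := by gcongr
    zify [show 1 ≤ Q by omega, show 2 * c ≤ Q - 1 by omega] at *
    have h5 : ((e : ℤ) * Q + r - c) * (Q - c1) ≤ a * b := by
      apply mul_le_mul <;> nlinarith
    have h6 : (e : ℤ) * (Q - 1 - 2 * c) * Q ≤ e * Q * Q := by
      have : (0 : ℤ) ≤ e * (1 + 2 * c) * Q := by positivity
      nlinarith
    have h7 : ((e : ℤ) * Q + r - c) * (Q - c1) = e * Q * Q + e ^ 2 * Q + Q - c1 * (r - c) := by
      rw [hr]; ring
    have h8 : (0 : ℤ) ≤ c1 * c := by positivity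
    nlinarith
  · have : D * (l + (m + 1) * Q) + 2 * c = (D * l + 2 * c) + (D * m + D) * Q := by ring
    rw [this]
    have h1 : D * l + 2 * c ≤ Q := by omega
    calc _ ≤ Q + (e * Q + r + D) * Q := by gcongr
      _ = _ := by ring

theorem exists_fin_basis_of_le_span {K V : Type*} [Field K] [AddCommGroup V] [Module K V]
    (L : Submodule K V) [FiniteDimensional K L] (S : Set V) (h : L ≤ Submodule.span K (S ∩ L)) :
    ∃ s : Fin (Module.finrank K L) → V, LinearIndependent K s ∧ ∀ i, s i ∈ S ∧ s i ∈ L := by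
  obtain ⟨b, hbs, hbspan, hbli⟩ := exists_linearIndependent K (S ∩ (L : Set V))
  have hb : Submodule.span K b = L :=
    le_antisymm (Submodule.span_le.2 fun x hx => (hbs hx).2) (hbspan ▸ h)
  have B := Module.Basis.span hbli
  rw [Subtype.range_coe, hb] at B
  have : Finite b := Module.Finite.finite_basis B
  have := Fintype.ofFinite b
  have hc : Module.finrank K L = Fintype.card b := Module.finrank_eq_card_basis B
  let eqv : Fin (Module.finrank K L) ≃ b := (finCongr hc).trans (Fintype.equivFin b).symm
  exact ⟨fun i => eqv i, hbli.comp eqv eqv.injective, fun i => hbs (eqv i).2⟩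

/-- Abstract form of Stepanov's method. -/
theorem LinFilt.stepanov_core {K R W : Type*} [Field K] [CommRing R] [IsDomain R] [Algebra K R]
    [CommRing W] [Algebra K W] (p : ℕ) [Fact p.Prime] [CharP K p] [IsAlgClosed K] {D c : ℕ}
    (F : LinFilt K R D c) (lam : R →ₐ[K] PowerSeries K) (hlam : Function.Injective lam)
    {x0 : R} (hlx : lam x0 = PowerSeries.X)
    (V : ℕ → Submodule K W) (hV : ∀ n, FiniteDimensional K (V n))
    (Vmul : ∀ {a b : ℕ} {x y : W}, x ∈ V a → y ∈ V b → x * y ∈ V (a + b))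
    (α β : R →ₐ[K] W) (hα : ∀ n, ∀ x ∈ F.L n, α x ∈ V n) (hβ : ∀ n, ∀ x ∈ F.L n, β x ∈ V n)
    (S : Set R) (hS : ∀ n, F.L n ≤ Submodule.span K (S ∩ F.L n)) (j : ℕ) (T : Finset (R →ₐ[K] K))
    (hT : ∀ P ∈ T, ∃ P' : W →ₐ[K] K, (∀ x, P' (α x) = P x) ∧
      ∀ s ∈ S, P' (β s) = P s ^ (p ^ j) ^ 2)
    (l m : ℕ) (hl : D * l + 2 * c < p ^ j)
    (hdim : Module.finrank K (V (l * p ^ j + m)) <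
      Module.finrank K (F.L m) * Module.finrank K (F.L l)) :
    T.card ≤ D * (l + m * p ^ j) + 2 * c := by
  rcases T.eq_empty_or_nonempty with rfl | ⟨P0, hP0⟩
  · simp
  have hfin := F.fin
  have hWnt : Nontrivial W := by
    obtain ⟨P', -⟩ := hT P0 hP0
    exact P'.toRingHom.domain_nontrivial
  have : CharP W p := charP_of_injective_algebraMap (algebraMap K W).injective p
  have : CharP R p := charP_of_injective_algebraMap (algebraMap K R).injective p
  obtain ⟨s, hsli, hs⟩ := exists_fin_basis_of_le_span (F.L m) S (hS m)
  let b := Module.finBasis K (F.L l)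
  let w : Fin (Module.finrank K (F.L m)) × Fin (Module.finrank K (F.L l)) → V (l * p ^ j + m) := fun ik =>
    ⟨α (b ik.2) ^ p ^ j * β (s ik.1), Vmul (by
      rw [← map_pow]; exact hα _ _ (F.pow_mem (b ik.2).2 _)) (hβ _ _ (hs _).2)⟩
  have hwdep : ¬ LinearIndependent K w := by
    intro hli
    have := hV (l * p ^ j + m)
    have := hli.fintype_card_le_finrank
    simp only [Fintype.card_prod, Fintype.card_fin] at this
    omega
  rw [Fintype.not_linearIndependent_iff] at hwdep
  obtain ⟨y, hy, ⟨i1, k1⟩, hy1⟩ := hwdep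
  have hp0 : p ^ j ≠ 0 := (pow_pos (Fact.out : p.Prime).pos j).ne'
  choose z hz using fun ik => IsAlgClosed.exists_pow_nat_eq (y ik) (Nat.pos_of_ne_zero hp0)
  let ν : Fin (Module.finrank K (F.L m)) → F.L l := fun i => ∑ k, z (i, k) • b k
  have hνα : ∀ i, α (ν i) ^ p ^ j = ∑ k, y (i, k) • α (b k) ^ p ^ j := by
    intro i
    simp only [ν, Submodule.coe_sum, Submodule.coe_smul, map_sum, map_smul]
    rw [sum_pow_char_pow]
    exact Finset.sum_congr rfl fun k _ => by rw [smul_pow, hz]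
  have hW0 : ∑ i, α (ν i) ^ p ^ j * β (s i) = 0 := by
    have := congrArg Subtype.val hy
    simp only [Submodule.coe_sum, Submodule.coe_smul, w, Fintype.sum_prod_type] at this
    simp only [hνα, Finset.sum_mul, smul_mul_assoc]
    exact this
  set h : R := ∑ i, (ν i : R) * s i ^ p ^ j with hh
  have hmem : h ∈ F.L (l + m * p ^ j) :=
    Submodule.sum_mem _ fun i _ => F.mul (ν i).2 (F.pow_mem (hs i).2 _)
  have hne : h ≠ 0 := by
    intro h0
    have hA := eq_zero_of_sum_mul_pow_eq_zero p j ((F.L l).map lam.toLinearMap) (by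
      rintro _ ⟨x, hx, rfl⟩ hdvd
      by_contra hne
      have hx0 : x ≠ 0 := by rintro rfl; simp at hne
      have := F.le_of_X_pow_dvd lam hlx hx0 hx hdvd
      omega) _ (fun i => lam (s i)) (fun i => lam (ν i))
      (hsli.map' lam.toLinearMap (LinearMap.ker_eq_bot.2 hlam))
      (fun i => ⟨_, (ν i).2, rfl⟩) (by
        rw [hh] at h0
        simpa using congrArg lam h0) i1
    have hν0 : ν i1 = 0 := by
      apply Subtype.ext
      exact hlam (by rw [hA]; simp)
    have hz0 := Fintype.linearIndependent_iff.1 b.linearIndependent _ hν0 k1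
    rw [← hz, hz0, zero_pow hp0] at hy1
    exact hy1 rfl
  apply F.card_le_of_eval_eq_zero T hne hmem
  intro P hP
  obtain ⟨P', hP1, hP2⟩ := hT P hP
  have : CharP K p := inferInstance
  have h1 : P h ^ p ^ j = P' (∑ i, α (ν i) ^ p ^ j * β (s i)) := by
    rw [hh, map_sum, sum_pow_char_pow, map_sum]
    refine Finset.sum_congr rfl fun i _ => ?_
    rw [map_mul, map_mul, map_pow, map_pow, mul_pow, hP1, hP2 _ (hs i).1, ← pow_mul, sq]
  rw [hW0, map_zero] at h1
  exact pow_eq_zero_iff hp0 |>.1 h1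

theorem LinFilt.stepanov {K : Type*} [Field K] [IsAlgClosed K] (p : ℕ) [Fact p.Prime] [CharP K p]
    (D c c' e : ℕ) (hD : 0 < D) :
    ∃ B : ℕ, ∀ {R W : Type*} [CommRing R] [IsDomain R] [Algebra K R] [CommRing W] [Algebra K W]
    (F : LinFilt K R D c) (lam : R →ₐ[K] PowerSeries K) (_ : Function.Injective lam)
    {x0 : R} (_ : lam x0 = PowerSeries.X)
    (V : ℕ → Submodule K W) (_ : ∀ n, FiniteDimensional K (V n))
    (_ : ∀ n, Module.finrank K (V n) ≤ D * e * n + c')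
    (_ : ∀ {a b : ℕ} {x y : W}, x ∈ V a → y ∈ V b → x * y ∈ V (a + b)) 
    (α β : R →ₐ[K] W) (_ : ∀ n, ∀ x ∈ F.L n, α x ∈ V n) (_ : ∀ n, ∀ x ∈ F.L n, β x ∈ V n)
    (S : Set R) (_ : ∀ n, F.L n ≤ Submodule.span K (S ∩ F.L n)),
    ∀ j : ℕ, B ≤ p ^ j → ∀ (T : Finset (R →ₐ[K] K)),
    (∀ P ∈ T, ∃ P' : W →ₐ[K] K, (∀ x, P' (α x) = P x) ∧
      ∀ s ∈ S, P' (β s) = P s ^ (p ^ j) ^ 2) → T.card ≤ e * (p ^ j) ^ 2 + B * p ^ j := by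
  obtain ⟨Q0, B, h⟩ := exists_stepanov_parameters D c c' e hD
  refine ⟨Q0 + B, ?_⟩
  intro R W _ _ _ _ _ F lam hlam x0 hx0 V hV hdim Vmul α β hα hβ S hS j hj T hT
  obtain ⟨l, m, h1, h2, h3⟩ := h (p ^ j) (by omega)
  refine (F.stepanov_core p lam hlam hx0 V hV Vmul α β hα hβ S hS j T hT l m h1
    ((hdim _).trans_lt (h2 _ _ (F.ge m) (F.ge l)))).trans (h3.trans ?_)
  gcongr
  omega

namespace LinFilt

/-- The filtration of `K[x]` by degree. -/
noncomputable def polynomial (K : Type*) [Field K] : LinFilt K (Polynomial K) 1 1 where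
  L n := Polynomial.degreeLT K (n + 1)
  mono a b h := Polynomial.degreeLT_mono (by omega)
  mul {a b x y} hx hy := by
    rw [Polynomial.mem_degreeLT] at *
    rcases eq_or_ne (x * y) 0 with h | h
    · rw [h, Polynomial.degree_zero]; exact WithBot.bot_lt_coe _
    have hx0 : x ≠ 0 := left_ne_zero_of_mul h
    have hy0 : y ≠ 0 := right_ne_zero_of_mul h
    rw [Polynomial.degree_eq_natDegree hx0] at hx
    rw [Polynomial.degree_eq_natDegree hy0] at hy
    rw [Polynomial.degree_mul, Polynomial.degree_eq_natDegree hx0, Polynomial.degree_eq_natDegree hy0]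
    norm_cast at *
    omega
  exh x := ⟨x.natDegree, by
    rw [Polynomial.mem_degreeLT]
    exact lt_of_le_of_lt Polynomial.degree_le_natDegree (by norm_cast; omega)⟩
  one := by
    rw [Polynomial.mem_degreeLT, Polynomial.degree_one]
    norm_num
  fin n := inferInstance
  le n := by
    rw [LinearEquiv.finrank_eq (Polynomial.degreeLTEquiv K (n + 1))]
    simp
  ge n := by
    rw [LinearEquiv.finrank_eq (Polynomial.degreeLTEquiv K (n + 1))]
    simp; omega

variable {K R : Type*} [Field K] [CommRing R] [Algebra K R] {D c : ℕ}

/-- The elements of filtration degree `≤ n` when the root gets weight `κ`. -/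
noncomputable def extL (F : LinFilt K R D c) (g : Polynomial R) (κ n : ℕ) : Submodule K (AdjoinRoot g) :=
  Submodule.span K {z | ∃ (a k : ℕ) (s : R), s ∈ F.L a ∧ a + κ * k ≤ n ∧
    z = algebraMap R _ s * AdjoinRoot.root g ^ k}

theorem mem_extL (F : LinFilt K R D c) (g : Polynomial R) {κ n a k : ℕ} {s : R} (hs : s ∈ F.L a)
    (h : a + κ * k ≤ n) : algebraMap R _ s * AdjoinRoot.root g ^ k ∈ F.extL g κ n :=
  Submodule.subset_span ⟨a, k, s, hs, h, rfl⟩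

theorem extL_mono (F : LinFilt K R D c) (g : Polynomial R) (κ : ℕ) : Monotone (F.extL g κ) := by
  intro m n h
  apply Submodule.span_mono
  rintro _ ⟨a, k, s, hs, h', rfl⟩
  exact ⟨a, k, s, hs, h'.trans h, rfl⟩

theorem extL_mul (F : LinFilt K R D c) (g : Polynomial R) (κ : ℕ) {a b : ℕ} {x y : AdjoinRoot g}
    (hx : x ∈ F.extL g κ a) (hy : y ∈ F.extL g κ b) : x * y ∈ F.extL g κ (a + b) := by
  have := Submodule.mul_mem_mul hx hy
  rw [extL, extL, Submodule.span_mul_span] at this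
  refine Submodule.span_le.2 ?_ this
  rintro _ ⟨_, ⟨a1, k1, s1, hs1, h1, rfl⟩, _, ⟨a2, k2, s2, hs2, h2, rfl⟩, rfl⟩
  have := F.mem_extL g (κ := κ) (F.mul hs1 hs2) (k := k1 + k2) (n := a + b)
    (by rw [mul_add]; omega)
  rw [map_mul, pow_add] at this
  rw [show algebraMap R (AdjoinRoot g) s1 * algebraMap R _ s2 * (AdjoinRoot.root g ^ k1 *
    AdjoinRoot.root g ^ k2) = algebraMap R _ s1 * AdjoinRoot.root g ^ k1 *
      (algebraMap R _ s2 * AdjoinRoot.root g ^ k2) by ring] at this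
  exact this

open Classical in
/-- The coefficient spaces of `extL`. -/
noncomputable def coeffL (F : LinFilt K R D c) (κ n k : ℕ) : Submodule K R :=
  if κ * k ≤ n then F.L (n - κ * k) else ⊥

theorem coeffL_of_le (F : LinFilt K R D c) {κ n k : ℕ} (h : κ * k ≤ n) :
    F.coeffL κ n k = F.L (n - κ * k) := if_pos h

theorem coeffL_of_lt (F : LinFilt K R D c) {κ n k : ℕ} (h : ¬ κ * k ≤ n) :
    F.coeffL κ n k = ⊥ := if_neg h

/-- The coordinate description of `extL`. -/
noncomputable def extMap (F : LinFilt K R D c) (g : Polynomial R) (κ n : ℕ) :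
    (∀ k : Fin g.natDegree, F.coeffL κ n k) →ₗ[K] AdjoinRoot g :=
  ∑ k : Fin g.natDegree, ((LinearMap.mulRight K (AdjoinRoot.root g ^ (k : ℕ))).comp
    ((Algebra.linearMap R (AdjoinRoot g)).restrictScalars K)).comp
      ((F.coeffL κ n k).subtype.comp (LinearMap.proj k))

theorem extMap_apply (F : LinFilt K R D c) (g : Polynomial R) (κ n : ℕ)
    (x : ∀ k : Fin g.natDegree, F.coeffL κ n k) :
    F.extMap g κ n x = ∑ k, algebraMap R _ (x k : R) * AdjoinRoot.root g ^ (k : ℕ) := by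
  simp [extMap, LinearMap.sum_apply]

theorem extMap_injective (F : LinFilt K R D c) (g : Polynomial R) (hg : g.Monic) (κ n : ℕ) :
    Function.Injective (F.extMap g κ n) := by
  rw [← LinearMap.ker_eq_bot, LinearMap.ker_eq_bot']
  intro x hx
  rw [extMap_apply] at hx
  have hli := (AdjoinRoot.powerBasis' hg).basis.linearIndependent
  rw [Fintype.linearIndependent_iff] at hli
  funext k
  apply Subtype.ext
  exact hli (fun k => (x k : R)) (by
    rw [← hx]
    refine Finset.sum_congr rfl fun i _ => ?_
    simp [Algebra.smul_def]) k

theorem mul_pow_mem_range_extMap [Nontrivial R] (F : LinFilt K R D c) (g : Polynomial R)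
    (hg : g.Monic) (κ n : ℕ)
    (hκ : ∀ k < g.natDegree, g.coeff k ∈ F.L (κ * (g.natDegree - k))) (k : ℕ) :
    ∀ (a : ℕ) (s : R), s ∈ F.L a → a + κ * k ≤ n →
      algebraMap R _ s * AdjoinRoot.root g ^ k ∈ LinearMap.range (F.extMap g κ n) := by
  classical
  induction k using Nat.strong_induction_on with
  | _ k ih =>
    intro a s hs h
    by_cases hk : k < g.natDegree
    · refine ⟨Pi.single ⟨k, hk⟩ ⟨s, ?_⟩, ?_⟩
      · rw [F.coeffL_of_le (show κ * k ≤ n by omega)]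
        exact F.mono (show a ≤ n - κ * k by omega) hs
      · rw [extMap_apply, Finset.sum_eq_single ⟨k, hk⟩]
        · simp
        · intro b _ hb
          simp [Pi.single_eq_of_ne hb]
        · simp
    · push Not at hk
      obtain ⟨r, rfl⟩ := Nat.exists_eq_add_of_le hk
      have hroot : AdjoinRoot.root g ^ g.natDegree =
          -∑ i ∈ Finset.range g.natDegree, algebraMap R _ (g.coeff i) * AdjoinRoot.root g ^ i := by
        have h0 := AdjoinRoot.eval₂_root g
        rw [Polynomial.eval₂_eq_sum_range, Finset.sum_range_succ] at h0
        rw [hg.coeff_natDegree, map_one, one_mul] at h0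
        rw [eq_neg_iff_add_eq_zero, add_comm]
        exact h0
      have : algebraMap R _ s * AdjoinRoot.root g ^ (g.natDegree + r) =
          -∑ i ∈ Finset.range g.natDegree, algebraMap R (AdjoinRoot g) (s * g.coeff i) *
            AdjoinRoot.root g ^ (i + r) := by
        rw [pow_add, hroot, neg_mul, mul_neg, Finset.sum_mul, Finset.mul_sum]
        congr 1
        refine Finset.sum_congr rfl fun i _ => ?_
        rw [map_mul, pow_add]; ring
      rw [this]
      refine Submodule.neg_mem _ (Submodule.sum_mem _ fun i hi => ?_)
      rw [Finset.mem_range] at hi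
      refine ih (i + r) (by omega) _ _ (F.mul hs (hκ i hi)) ?_
      calc a + κ * (g.natDegree - i) + κ * (i + r) = a + κ * ((g.natDegree - i) + (i + r)) := by ring
        _ = a + κ * (g.natDegree + r) := by congr 2; omega
        _ ≤ n := h

theorem extL_eq_range [Nontrivial R] (F : LinFilt K R D c) (g : Polynomial R) (hg : g.Monic)
    (κ n : ℕ) (hκ : ∀ k < g.natDegree, g.coeff k ∈ F.L (κ * (g.natDegree - k))) :
    F.extL g κ n = LinearMap.range (F.extMap g κ n) := by
  apply le_antisymm
  · refine Submodule.span_le.2 ?_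
    rintro _ ⟨a, k, s, hs, h, rfl⟩
    exact F.mul_pow_mem_range_extMap g hg κ n hκ k a s hs h
  · rintro _ ⟨x, rfl⟩
    rw [extMap_apply]
    refine Submodule.sum_mem _ fun k _ => ?_
    by_cases hk : κ * (k : ℕ) ≤ n
    · have : (x k : R) ∈ F.L (n - κ * k) := by
        have h := (F.coeffL_of_le hk).le
        exact h (x k).2
      exact F.mem_extL g this (by omega)
    · have : (x k : R) = 0 := by
        have h := (F.coeffL_of_lt hk).le
        exact (Submodule.mem_bot K).1 (h (x k).2)
      simp [this]

theorem finrank_extL [Nontrivial R] (F : LinFilt K R D c) (g : Polynomial R) (hg : g.Monic)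
    (κ n : ℕ) (hκ : ∀ k < g.natDegree, g.coeff k ∈ F.L (κ * (g.natDegree - k))) :
    FiniteDimensional K (F.extL g κ n) ∧ Module.finrank K (F.extL g κ n) =
      ∑ k : Fin g.natDegree, Module.finrank K (F.coeffL κ n k) := by
  have hf := F.fin
  have : ∀ k, FiniteDimensional K (F.coeffL κ n k) := by
    intro k
    by_cases h : κ * k ≤ n
    · rw [F.coeffL_of_le h]; infer_instance
    · rw [F.coeffL_of_lt h]; infer_instance
  rw [F.extL_eq_range g hg κ n hκ, LinearMap.finrank_range_of_inj (F.extMap_injective g hg κ n)]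
  exact ⟨inferInstance, Module.finrank_pi_fintype K⟩

/-- The filtration of a finite free extension `R[y]/(g)`. -/
noncomputable def ext [Nontrivial R] (F : LinFilt K R D c) (g : Polynomial R) (hg : g.Monic)
    (κ : ℕ) (hκ : ∀ k < g.natDegree, g.coeff k ∈ F.L (κ * (g.natDegree - k))) :
    LinFilt K (AdjoinRoot g) (D * g.natDegree)
      (g.natDegree * (c + D * (κ * g.natDegree))) where
  L := F.extL g κ
  mono := F.extL_mono g κ
  mul := F.extL_mul g κ
  exh x := by
    obtain ⟨P, rfl⟩ := AdjoinRoot.mk_surjective x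
    choose n hn using fun i => F.exh (P.coeff i)
    refine ⟨P.support.sup fun i => n i + κ * i, ?_⟩
    rw [P.as_sum_support_C_mul_X_pow, map_sum]
    refine Submodule.sum_mem _ fun i hi => ?_
    rw [map_mul, map_pow, AdjoinRoot.mk_X, AdjoinRoot.mk_C, ← AdjoinRoot.algebraMap_eq]
    rw [← P.as_sum_support_C_mul_X_pow]
    exact F.mem_extL g (hn i) (Finset.le_sup (f := fun i => n i + κ * i) hi)
  one := by
    have := F.mem_extL g (κ := κ) (k := 0) F.one le_rfl
    simpa using this
  fin n := (F.finrank_extL g hg κ n hκ).1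
  le n := by
    rw [(F.finrank_extL g hg κ n hκ).2]
    calc _ ≤ ∑ k : Fin g.natDegree, (D * n + c) := by
          refine Finset.sum_le_sum fun k _ => ?_
          by_cases h : κ * k ≤ n
          · rw [F.coeffL_of_le h]
            refine (F.le _).trans ?_
            gcongr
            omega
          · rw [F.coeffL_of_lt h, finrank_bot]
            exact Nat.zero_le _
      _ = g.natDegree * (D * n + c) := by simp
      _ ≤ _ := by
        rw [mul_add, mul_add]
        have : g.natDegree * (D * n) = D * g.natDegree * n := by ring
        omega
  ge n := by
    rw [(F.finrank_extL g hg κ n hκ).2]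
    have : ∑ k : Fin g.natDegree, D * n ≤ ∑ k : Fin g.natDegree,
        (Module.finrank K (F.coeffL κ n k) + (c + D * (κ * g.natDegree))) := by
      refine Finset.sum_le_sum fun k _ => ?_
      have hk : D * (κ * k) ≤ D * (κ * g.natDegree) := by gcongr; exact k.2.le
      by_cases h : κ * k ≤ n
      · rw [F.coeffL_of_le h]
        have := F.ge (n - κ * k)
        have h2 : D * n = D * (n - κ * k) + D * (κ * k) := by rw [← mul_add]; congr 1; omega
        omega
      · rw [F.coeffL_of_lt h]
        have : D * n ≤ D * (κ * k) := by gcongr; omega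
        rw [finrank_bot]
        omega
    rw [Finset.sum_add_distrib] at this
    simp only [Finset.sum_const, Finset.card_univ, Fintype.card_fin, smul_eq_mul] at this
    calc _ = g.natDegree * (D * n) := by ring
      _ ≤ _ := this

end LinFilt

section
variable {K : Type*} [Field K]

theorem exists_powerSeries_lift {R : Type*} [CommRing R] [Algebra K R] (lam : R →ₐ[K] PowerSeries K)
    (g : Polynomial R) (hg : g.Monic) (y : K)
    (h0 : g.eval₂ ((PowerSeries.constantCoeff (R := K)).comp lam.toRingHom) y = 0)
    (h1 : g.derivative.eval₂ ((PowerSeries.constantCoeff (R := K)).comp lam.toRingHom) y ≠ 0) :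
    ∃ lam' : AdjoinRoot g →ₐ[K] PowerSeries K, ∀ r, lam' (algebraMap R _ r) = lam r := by
  have hens : HenselianRing (PowerSeries K) (Ideal.span {PowerSeries.X}) := inferInstance
  have hev : ∀ P : Polynomial R, PowerSeries.constantCoeff (R := K)
      ((P.map lam.toRingHom).eval (PowerSeries.C y)) =
        P.eval₂ ((PowerSeries.constantCoeff (R := K)).comp lam.toRingHom) y := by
    intro P
    rw [Polynomial.eval_map, Polynomial.hom_eval₂, PowerSeries.constantCoeff_C]
  obtain ⟨a, ha, -⟩ := hens.is_henselian (g.map lam.toRingHom) (hg.map _) (PowerSeries.C y)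
    (by
      rw [Ideal.mem_span_singleton, PowerSeries.X_dvd_iff, hev, h0])
    (by
      apply IsUnit.map
      rw [PowerSeries.isUnit_iff_constantCoeff, Polynomial.derivative_map, hev]
      exact h1.isUnit)
  rw [Polynomial.IsRoot.def, Polynomial.eval_map] at ha
  refine ⟨AdjoinRoot.liftAlgHom g lam a ha, fun r => ?_⟩
  rw [AdjoinRoot.algebraMap_eq]
  exact AdjoinRoot.liftAlgHom_of (p := g) (i := lam) (x := a) (h := ha) r

theorem injective_of_isIntegral {A R S : Type*} [CommRing A] [Nontrivial A] [CommRing R] [IsDomain R] [Algebra A R]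
    [Algebra.IsIntegral A R] [CommRing S] (φ : R →+* S)
    (h : Function.Injective (φ.comp (algebraMap A R))) : Function.Injective φ := by
  rw [RingHom.injective_iff_ker_eq_bot] at h ⊢
  exact Ideal.eq_bot_of_comap_eq_bot (R := A) (by rw [RingHom.comap_ker]; exact h)

theorem exists_dvd_algebraMap {A R : Type*} [CommRing A] [Nontrivial A] [CommRing R] [IsDomain R] [Algebra A R]
    [Algebra.IsIntegral A R] {r : R} (hr : r ≠ 0) : ∃ a : A, a ≠ 0 ∧ r ∣ algebraMap A R a := by
  by_contra! h
  apply hr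
  have := Ideal.eq_bot_of_comap_eq_bot (R := A) (I := Ideal.span {r}) (by
    rw [eq_bot_iff]
    intro a ha
    rw [Ideal.mem_comap, Ideal.mem_span_singleton] at ha
    by_contra h'
    exact h a h' ha)
  rwa [Ideal.span_singleton_eq_bot] at this

theorem isIntegral_adjoinRoot {A : Type*} [CommRing A] {g : Polynomial A} (hg : g.Monic) :
    Algebra.IsIntegral A (AdjoinRoot g) := by
  have := hg.finite_adjoinRoot
  infer_instance

namespace LinFilt

variable {R : Type*} [CommRing R] [Algebra K R] {D c : ℕ}

theorem algebraMap_mem_extL (F : LinFilt K R D c) (g : Polynomial R) (κ : ℕ) {n : ℕ} {s : R}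
    (hs : s ∈ F.L n) : algebraMap R _ s ∈ F.extL g κ n := by
  simpa using F.mem_extL g (κ := κ) (k := 0) hs le_rfl

theorem root_mem_extL (F : LinFilt K R D c) (g : Polynomial R) (κ : ℕ) :
    AdjoinRoot.root g ∈ F.extL g κ κ := by
  simpa using F.mem_extL g (κ := κ) (n := κ) (k := 1) F.one (by omega)

theorem map_extL_mem (F : LinFilt K R D c) (g : Polynomial R) (κ : ℕ) {W : Type*} [CommRing W]
    [Algebra K W] {D' c' : ℕ} (G : LinFilt K W D' c') (φ : AdjoinRoot g →ₐ[K] W)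
    (h : ∀ n, ∀ s ∈ F.L n, φ (algebraMap R _ s) ∈ G.L n) (h' : φ (AdjoinRoot.root g) ∈ G.L κ)
    (n : ℕ) : ∀ x ∈ F.extL g κ n, φ x ∈ G.L n := by
  have : F.extL g κ n ≤ (G.L n).comap φ.toLinearMap := by
    refine Submodule.span_le.2 ?_
    rintro _ ⟨a, k, s, hs, hn, rfl⟩
    have := G.mono hn (G.mul (h _ s hs) (G.pow_mem h' k))
    rw [← map_pow, ← map_mul] at this
    exact this
  exact this

theorem extL_le_span (F : LinFilt K R D c) (g : Polynomial R) (κ : ℕ) (S : Set R)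
    (hS : ∀ n, F.L n ≤ Submodule.span K (S ∩ F.L n)) (n : ℕ) :
    F.extL g κ n ≤ Submodule.span K
      ({z | ∃ s ∈ S, ∃ k : ℕ, z = algebraMap R _ s * AdjoinRoot.root g ^ k} ∩ F.extL g κ n) := by
  refine Submodule.span_le.2 ?_
  rintro _ ⟨a, k, s, hs, hn, rfl⟩
  let ψ : R →ₗ[K] AdjoinRoot g := (LinearMap.mulRight K (AdjoinRoot.root g ^ (k : ℕ))).comp
    ((Algebra.linearMap R (AdjoinRoot g)).restrictScalars K)
  have : F.L a ≤ (Submodule.span K ({z | ∃ s ∈ S, ∃ k : ℕ, z = algebraMap R _ s *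
      AdjoinRoot.root g ^ k} ∩ F.extL g κ n)).comap ψ := by
    refine (hS a).trans (Submodule.span_le.2 ?_)
    rintro s ⟨hs, hsa⟩
    exact Submodule.subset_span ⟨⟨s, hs, k, rfl⟩, F.mem_extL g hsa hn⟩
  exact this hs

theorem polynomial_le_span (n : ℕ) : (LinFilt.polynomial K).L n ≤
    Submodule.span K (Set.range (fun i : ℕ => (Polynomial.X : Polynomial K) ^ i) ∩
      (LinFilt.polynomial K).L n) := by
  change Polynomial.degreeLT K (n + 1) ≤ _
  classical
  rw [Polynomial.degreeLT_eq_span_X_pow]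
  apply Submodule.span_mono
  intro x hx
  simp only [Finset.coe_image, Set.mem_image, Finset.coe_range, Set.mem_Iio] at hx
  obtain ⟨i, hi, rfl⟩ := hx
  refine ⟨⟨i, rfl⟩, ?_⟩
  change _ ∈ Polynomial.degreeLT K (n + 1)
  rw [Polynomial.mem_degreeLT, Polynomial.degree_X_pow]
  exact_mod_cast hi

theorem exists_mem_L_mul {ι : Type*} (F : LinFilt K R D c) (s : Finset ι) (x : ι → R) :
    ∃ κ, ∀ i ∈ s, x i ∈ F.L κ := by
  choose n hn using fun i => F.exh (x i)
  exact ⟨s.sup n, fun i hi => F.mono (Finset.le_sup hi) (hn i)⟩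

/-- Every monic polynomial satisfies the weight condition for large `κ`. -/
theorem exists_weight (F : LinFilt K R D c) (g : Polynomial R) :
    ∃ κ0, ∀ κ ≥ κ0, ∀ k < g.natDegree, g.coeff k ∈ F.L (κ * (g.natDegree - k)) := by
  obtain ⟨κ0, h⟩ := F.exists_mem_L_mul (Finset.range g.natDegree) g.coeff
  refine ⟨κ0, fun κ hκ k hk => F.mono ?_ (h k (Finset.mem_range.2 hk))⟩
  have : 1 ≤ g.natDegree - k := by omega
  nlinarith

end LinFilt

/-- Expansion of a polynomial at a point as a power series. -/
noncomputable def taylorHom (x : K) : Polynomial K →ₐ[K] PowerSeries K :=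
  Polynomial.aeval (PowerSeries.X + PowerSeries.C x)

theorem taylorHom_injective (x : K) : Function.Injective (taylorHom x) := by
  have : taylorHom x = (Polynomial.coeToPowerSeries.algHom K).comp (Polynomial.taylorAlgHom x) := by
    ext
    simp [taylorHom]
  rw [this]
  intro a b h
  simp only [AlgHom.comp_apply, Polynomial.coeToPowerSeries.algHom_apply] at h
  exact Polynomial.taylor_injective x (by simpa using h)

theorem taylorHom_X_sub (x : K) : taylorHom x (Polynomial.X - Polynomial.C x) = PowerSeries.X := by
  simp [taylorHom]

end

/-- The filter of sufficiently divisible positive integers. -/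
def divFilter : Filter ℕ where
  sets := {s | ∃ a > 0, ∀ n > 0, a ∣ n → n ∈ s}
  univ_sets := ⟨1, one_pos, fun _ _ _ => trivial⟩
  sets_of_superset := by
    rintro s t ⟨a, ha, h⟩ hst
    exact ⟨a, ha, fun n hn han => hst (h n hn han)⟩
  inter_sets := by
    rintro s t ⟨a, ha, h⟩ ⟨b, hb, h'⟩
    exact ⟨a * b, mul_pos ha hb, fun n hn hab =>
      ⟨h n hn ((dvd_mul_right _ _).trans hab), h' n hn ((dvd_mul_left _ _).trans hab)⟩⟩

theorem eventually_divFilter {P : ℕ → Prop} :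
    (∀ᶠ n in divFilter, P n) ↔ ∃ a > 0, ∀ n > 0, a ∣ n → P n := Iff.rfl

theorem eventually_pos_divFilter : ∀ᶠ n in divFilter, 0 < n :=
  ⟨1, one_pos, fun _ h _ => h⟩

theorem eventually_dvd_divFilter {a : ℕ} (ha : 0 < a) : ∀ᶠ n in divFilter, a ∣ n :=
  ⟨a, ha, fun _ _ h => h⟩

theorem eventually_ge_divFilter (N : ℕ) : ∀ᶠ n in divFilter, N ≤ n :=
  ⟨N + 1, Nat.succ_pos _, fun _ hn h => (Nat.le_succ N).trans (Nat.le_of_dvd hn h)⟩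

theorem eventually_le_pow_half {p : ℕ} (hp : p.Prime) (N : ℕ) :
    ∀ᶠ n in divFilter, N ≤ p ^ (n / 2) := by
  filter_upwards [eventually_ge_divFilter (2 * N)] with n hn
  calc N ≤ n / 2 := by omega
    _ ≤ p ^ (n / 2) := (Nat.lt_pow_self hp.one_lt).le

theorem eventually_pow_eq_sq {p : ℕ} : ∀ᶠ n in divFilter, p ^ n = (p ^ (n / 2)) ^ 2 := by
  filter_upwards [eventually_dvd_divFilter (a := 2) two_pos] with n hn
  rw [← pow_mul, Nat.div_mul_cancel hn]

/-- Every element is fixed by some power of the Frobenius. -/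
class LocFin (p : ℕ) (K : Type) [Field K] : Prop where
  exists_pow : ∀ x : K, ∃ a > 0, x ^ p ^ a = x

/-- The elements of the subfield with `p ^ n` elements. -/
noncomputable def Fs (p : ℕ) (K : Type) [Field K] (n : ℕ) : Finset K := by
  classical exact (Polynomial.X ^ p ^ n - Polynomial.X : Polynomial K).roots.toFinset

section
variable {K : Type} [Field K] {p : ℕ}

theorem pow_pow_mul_eq_self {x : K} {a : ℕ} (hx : x ^ p ^ a = x) (m : ℕ) :
    x ^ p ^ (a * m) = x := by
  induction m with
  | zero => simp
  | succ m ih => rw [mul_add_one, pow_add, pow_mul, ih, hx]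

variable [hp : Fact p.Prime]

theorem mem_Fs {n : ℕ} (hn : 0 < n) {x : K} : x ∈ Fs p K n ↔ x ^ p ^ n = x := by
  have h1 : 1 < p ^ n := Nat.one_lt_pow hn.ne' hp.out.one_lt
  have : (Polynomial.X ^ p ^ n - Polynomial.X : Polynomial K) ≠ 0 :=
    FiniteField.X_pow_card_sub_X_ne_zero K h1
  classical
  rw [Fs, Multiset.mem_toFinset, Polynomial.mem_roots this]
  simp [sub_eq_zero]

variable [CharP K p]

theorem card_Fs [IsAlgClosed K] {n : ℕ} (hn : 0 < n) : (Fs p K n).card = p ^ n := by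
  classical
  have h1 : 1 < p ^ n := Nat.one_lt_pow hn.ne' hp.out.one_lt
  have hsep : (Polynomial.X ^ p ^ n - Polynomial.X : Polynomial K).Separable :=
    galois_poly_separable p _ (dvd_pow_self p hn.ne')
  rw [Fs, Multiset.toFinset_card_of_nodup (Polynomial.nodup_roots hsep),
    ← (IsAlgClosed.splits _).natDegree_eq_card_roots, FiniteField.X_pow_card_sub_X_natDegree_eq _ h1]

theorem eventually_mem_Fs [LocFin p K] (x : K) : ∀ᶠ n in divFilter, x ∈ Fs p K n := by
  obtain ⟨a, ha, hx⟩ := LocFin.exists_pow (p := p) x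
  filter_upwards [eventually_dvd_divFilter ha, eventually_pos_divFilter] with n hn h0
  obtain ⟨m, rfl⟩ := hn
  exact (mem_Fs h0).2 (pow_pow_mul_eq_self hx m)

theorem eventually_pow_eq [LocFin p K] (x : K) : ∀ᶠ n in divFilter, x ^ p ^ n = x := by
  filter_upwards [eventually_mem_Fs (p := p) x, eventually_pos_divFilter] with n hn h0
  exact (mem_Fs h0).1 hn

theorem eventually_frobenius_eval [LocFin p K] (f : Polynomial K) :
    ∀ᶠ n in divFilter, ∀ x, f.eval (x ^ p ^ n) = (f.eval x) ^ p ^ n := by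
  induction f using Polynomial.induction_on' with
  | add f g hf hg =>
    filter_upwards [hf, hg] with n h1 h2 x
    rw [Polynomial.eval_add, Polynomial.eval_add, h1, h2, add_pow_char_pow]
  | monomial k a =>
    filter_upwards [eventually_pow_eq (p := p) a] with n h x
    rw [Polynomial.eval_monomial, Polynomial.eval_monomial, mul_pow, h, pow_right_comm]

theorem eventually_frobenius_evalEval [LocFin p K] (f : Polynomial (Polynomial K)) :
    ∀ᶠ n in divFilter, ∀ x y,
      f.evalEval (x ^ p ^ n) (y ^ p ^ n) = (f.evalEval x y) ^ p ^ n := by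
  induction f using Polynomial.induction_on' with
  | add f g hf hg =>
    filter_upwards [hf, hg] with n h1 h2 x y
    rw [Polynomial.evalEval_add, Polynomial.evalEval_add, h1, h2, add_pow_char_pow]
  | monomial k a =>
    filter_upwards [eventually_frobenius_eval (p := p) a] with n h x y
    simp only [Polynomial.evalEval, Polynomial.eval_monomial, Polynomial.eval_mul,
      Polynomial.eval_pow, Polynomial.eval_C]
    rw [h, mul_pow, pow_right_comm]

theorem eventually_evalEval_mem [LocFin p K] (f : Polynomial (Polynomial K)) :
    ∀ᶠ n in divFilter, ∀ x ∈ Fs p K n, ∀ y ∈ Fs p K n, f.evalEval x y ∈ Fs p K n := by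
  filter_upwards [eventually_frobenius_evalEval (p := p) f, eventually_pos_divFilter]
    with n h h0 x hx y hy
  rw [mem_Fs h0] at *
  rw [← h, hx, hy]

theorem Fs_add_mem {n : ℕ} (hn : 0 < n) {x y : K} (hx : x ∈ Fs p K n) (hy : y ∈ Fs p K n) :
    x + y ∈ Fs p K n := by
  rw [mem_Fs hn] at *; rw [add_pow_char_pow, hx, hy]

theorem Fs_mul_mem {n : ℕ} (hn : 0 < n) {x y : K} (hx : x ∈ Fs p K n) (hy : y ∈ Fs p K n) :
    x * y ∈ Fs p K n := by
  rw [mem_Fs hn] at *; rw [mul_pow, hx, hy]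

theorem Fs_inv_mem {n : ℕ} (hn : 0 < n) {x : K} (hx : x ∈ Fs p K n) : x⁻¹ ∈ Fs p K n := by
  rw [mem_Fs hn] at *; rw [inv_pow, hx]

theorem Fs_neg_mem {n : ℕ} (hn : 0 < n) {x : K} (hx : x ∈ Fs p K n) : -x ∈ Fs p K n := by
  rw [mem_Fs hn] at *
  have := sub_pow_char_pow (p := p) 0 x n
  rw [zero_sub, hx, zero_pow (pow_pos hp.out.pos n).ne', zero_sub] at this
  exact this

theorem Fs_zero_mem {n : ℕ} (hn : 0 < n) : (0 : K) ∈ Fs p K n := by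
  rw [mem_Fs hn, zero_pow (pow_pos hp.out.pos n).ne']

theorem Fs_one_mem {n : ℕ} (hn : 0 < n) : (1 : K) ∈ Fs p K n := by
  rw [mem_Fs hn, one_pow]

theorem Fs_pow_mem {n : ℕ} (hn : 0 < n) {x : K} (hx : x ∈ Fs p K n) (k : ℕ) : x ^ k ∈ Fs p K n := by
  rw [mem_Fs hn] at *; rw [pow_right_comm, hx]

end

section
variable {K : Type} [Field K]

theorem algHom_mk_eq_evalEval (f : Polynomial (Polynomial K)) (φ : AdjoinRoot f →ₐ[K] K)
    (P : Polynomial (Polynomial K)) :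
    φ (AdjoinRoot.mk f P) =
      P.evalEval (φ (algebraMap (Polynomial K) _ Polynomial.X)) (φ (AdjoinRoot.root f)) := by
  have h : (φ.toRingHom.comp (AdjoinRoot.mk f)) = Polynomial.evalEvalRingHom
      (φ (algebraMap (Polynomial K) _ Polynomial.X)) (φ (AdjoinRoot.root f)) := by
    ext
    · rename_i a
      trans a
      · exact φ.commutes a
      · simp
    · simp [AdjoinRoot.algebraMap_eq]
    · simp
  exact RingHom.congr_fun h P

/-- Evaluation of the coordinate ring of a plane curve at a point. -/
noncomputable def ptHom (f : Polynomial (Polynomial K)) (x y : K) (h : f.evalEval x y = 0) :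
    AdjoinRoot f →ₐ[K] K :=
  AdjoinRoot.liftAlgHom f (Polynomial.aeval x) y (by
    rw [← h, ← Polynomial.eval₂_evalRingHom, ← Polynomial.coe_aeval_eq_evalRingHom])

theorem ptHom_X (f : Polynomial (Polynomial K)) (x y : K) (h : f.evalEval x y = 0)
    (s : Polynomial K) : ptHom f x y h (algebraMap _ _ s) = s.eval x := by
  rw [AdjoinRoot.algebraMap_eq, ptHom, AdjoinRoot.liftAlgHom_of]
  simp [Polynomial.aeval_def]

theorem ptHom_root (f : Polynomial (Polynomial K)) (x y : K) (h : f.evalEval x y = 0) :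
    ptHom f x y h (AdjoinRoot.root f) = y := by
  rw [ptHom, AdjoinRoot.liftAlgHom_root]

theorem ptHom_mk (f : Polynomial (Polynomial K)) (x y : K) (h : f.evalEval x y = 0)
    (P : Polynomial (Polynomial K)) : ptHom f x y h (AdjoinRoot.mk f P) = P.evalEval x y := by
  rw [algHom_mk_eq_evalEval, ptHom_X, ptHom_root, Polynomial.eval_X]

theorem isDomain_adjoinRoot_of_irreducible {f : Polynomial (Polynomial K)} (hf : Irreducible f) :
    IsDomain (AdjoinRoot f) :=
  AdjoinRoot.isDomain_of_prime hf.prime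

theorem algHom_algebraMap {R : Type*} [CommRing R] [Algebra K R] [Algebra (Polynomial K) R]
    [IsScalarTower K (Polynomial K) R] (φ : R →ₐ[K] K) (a : Polynomial K) :
    φ (algebraMap _ R a) = a.eval (φ (algebraMap (Polynomial K) R Polynomial.X)) := by
  have : φ.comp (IsScalarTower.toAlgHom K (Polynomial K) R) =
      Polynomial.aeval (φ (algebraMap (Polynomial K) R Polynomial.X)) := by
    ext; simp
  have := DFunLike.congr_fun this a
  simpa [Polynomial.aeval_def] using this

/-- A nonzero regular function only vanishes above finitely many values of the coordinate. -/
theorem exists_ne_zero_of_eval_ne_zero {R : Type*} [CommRing R] [IsDomain R] [Algebra K R]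
    [Algebra (Polynomial K) R] [IsScalarTower K (Polynomial K) R]
    [Algebra.IsIntegral (Polynomial K) R] {r : R} (hr : r ≠ 0) :
    ∃ N : Polynomial K, N ≠ 0 ∧ ∀ φ : R →ₐ[K] K,
      N.eval (φ (algebraMap (Polynomial K) R Polynomial.X)) ≠ 0 → φ r ≠ 0 := by
  obtain ⟨N, hN, h⟩ := exists_dvd_algebraMap (A := Polynomial K) hr
  refine ⟨N, hN, fun φ hφ h0 => hφ ?_⟩
  obtain ⟨s, hs⟩ := h
  rw [← algHom_algebraMap, hs, map_mul, h0, zero_mul]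

variable [IsAlgClosed K]

theorem exists_powerSeries_embedding_ext {R : Type*} [CommRing R] [IsDomain R] [Algebra K R]
    [Algebra (Polynomial K) R] [IsScalarTower K (Polynomial K) R]
    {x0 : K} (lam : R →ₐ[K] PowerSeries K) (hlam : Function.Injective lam)
    (hx : ∀ a : Polynomial K, lam (algebraMap _ _ a) = taylorHom x0 a)
    (g : Polynomial R) (hg : g.Monic) (hd : 0 < g.natDegree) [IsDomain (AdjoinRoot g)]
    (hsep : ∀ φ : R →ₐ[K] K, φ (algebraMap (Polynomial K) R Polynomial.X) = x0 →
      ∀ y, g.eval₂ (φ : R →+* K) y = 0 → g.derivative.eval₂ (φ : R →+* K) y ≠ 0) :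
    ∃ lam' : AdjoinRoot g →ₐ[K] PowerSeries K, Function.Injective lam' ∧
      ∀ a : Polynomial K, lam' (algebraMap R _ (algebraMap _ _ a)) = taylorHom x0 a := by
  let φ : R →ₐ[K] K :=
    { (PowerSeries.constantCoeff (R := K)).comp lam.toRingHom with
      commutes' := fun r => by simp }
  have hφ : (φ : R →+* K) = (PowerSeries.constantCoeff (R := K)).comp lam.toRingHom := by
    ext; rfl
  have hφx : φ (algebraMap (Polynomial K) R Polynomial.X) = x0 := by
    change PowerSeries.constantCoeff (lam (algebraMap (Polynomial K) R Polynomial.X)) = x0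
    rw [hx]; simp [taylorHom]
  obtain ⟨y, hy⟩ := IsAlgClosed.exists_root (g.map (φ : R →+* K)) (by
    rw [Polynomial.degree_eq_natDegree (hg.map _).ne_zero, hg.natDegree_map]
    exact_mod_cast hd.ne')
  rw [Polynomial.IsRoot.def, Polynomial.eval_map] at hy
  have hy' := hsep φ hφx y hy
  rw [hφ] at hy hy'
  obtain ⟨lam', h⟩ := exists_powerSeries_lift lam g hg y hy hy'
  have := isIntegral_adjoinRoot hg
  refine ⟨lam', injective_of_isIntegral (A := R) lam'.toRingHom ?_, fun a => by rw [h, hx]⟩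
  intro a b hab
  exact hlam (by rw [← h, ← h]; exact hab)

theorem exists_eval_ne_zero {N : Polynomial K} (hN : N ≠ 0) : ∃ x, N.eval x ≠ 0 := by
  by_contra! h
  exact hN (Polynomial.funext (by simpa using h))

theorem mk_derivative_ne_zero {f : Polynomial (Polynomial K)} (hm : f.Monic)
    (hder : f.derivative ≠ 0) : AdjoinRoot.mk f f.derivative ≠ 0 := by
  rw [Ne, AdjoinRoot.mk_eq_zero]
  intro h
  have h1 := Polynomial.natDegree_le_of_dvd h hder
  have : f.natDegree ≠ 0 := by
    intro h0
    rw [hm.natDegree_eq_zero.1 h0] at hder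
    simp at hder
  have h2 := Polynomial.natDegree_derivative_lt this
  omega

theorem natDegree_pos_of_derivative {f : Polynomial (Polynomial K)} (hder : f.derivative ≠ 0) :
    0 < f.natDegree := by
  by_contra h0
  rw [Polynomial.eq_C_of_natDegree_eq_zero (by omega : f.natDegree = 0)] at hder
  simp at hder

theorem eval₂_algHom_eq (f : Polynomial (Polynomial K)) (φ : Polynomial K →ₐ[K] K) (y : K) :
    f.eval₂ (φ : Polynomial K →+* K) y = f.evalEval (φ Polynomial.X) y := by
  rw [← Polynomial.eval₂_evalRingHom]
  congr 1
  ext a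
  · simpa using φ.commutes a
  · simp

/-- Power series parametrizations of a curve. -/
theorem exists_curve_embedding {f : Polynomial (Polynomial K)} (hm : f.Monic) (hirr : Irreducible f)
    (hder : f.derivative ≠ 0) : ∃ N : Polynomial K, N ≠ 0 ∧
      (∀ x y, f.evalEval x y = 0 → N.eval x ≠ 0 → f.derivative.evalEval x y ≠ 0) ∧
      ∀ x0, N.eval x0 ≠ 0 → ∃ lam : AdjoinRoot f →ₐ[K] PowerSeries K, Function.Injective lam ∧
      ∀ a : Polynomial K, lam (algebraMap _ _ a) = taylorHom x0 a := by
  have := isDomain_adjoinRoot_of_irreducible hirr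
  have := isIntegral_adjoinRoot hm
  obtain ⟨N, hN, h⟩ := exists_ne_zero_of_eval_ne_zero (K := K) (mk_derivative_ne_zero hm hder)
  have hsep : ∀ x y, f.evalEval x y = 0 → N.eval x ≠ 0 → f.derivative.evalEval x y ≠ 0 := by
    intro x y hxy hx
    have := h (ptHom f x y hxy) (by rwa [ptHom_X, Polynomial.eval_X])
    rwa [ptHom_mk] at this
  refine ⟨N, hN, hsep, fun x0 hx0 => ?_⟩
  obtain ⟨lam, h1, h2⟩ := exists_powerSeries_embedding_ext (R := Polynomial K) (x0 := x0)
    (taylorHom x0) (taylorHom_injective x0) (fun a => by simp) f hm (natDegree_pos_of_derivative hder)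
    (by
      intro φ hφ y hy
      simp only [Algebra.algebraMap_self, RingHom.id_apply] at hφ
      rw [eval₂_algHom_eq, hφ] at *
      exact hsep x0 y hy hx0)
  exact ⟨lam, h1, fun a => by simpa using h2 a⟩

end

section
variable {K : Type} [Field K]

/-- The quotient `f(z) / (z - y)` over the ring `K[x, y] / f(y)`. -/
noncomputable def conjPoly (f : Polynomial (Polynomial K)) : Polynomial (AdjoinRoot f) :=
  f.map (algebraMap (Polynomial K) (AdjoinRoot f)) /ₘ
    (Polynomial.X - Polynomial.C (AdjoinRoot.root f))

theorem mul_conjPoly (f : Polynomial (Polynomial K)) :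
    (Polynomial.X - Polynomial.C (AdjoinRoot.root f)) * conjPoly f =
      f.map (algebraMap (Polynomial K) (AdjoinRoot f)) := by
  rw [conjPoly, Polynomial.mul_divByMonic_eq_iff_isRoot]
  exact AdjoinRoot.isRoot_root f

theorem conjPoly_monic {f : Polynomial (Polynomial K)} (hm : f.Monic) : (conjPoly f).Monic := by
  apply Polynomial.Monic.of_mul_monic_left (Polynomial.monic_X_sub_C (AdjoinRoot.root f))
  rw [mul_conjPoly]
  exact hm.map _

theorem natDegree_conjPoly {f : Polynomial (Polynomial K)} (hm : f.Monic)
    [Nontrivial (AdjoinRoot f)] : (conjPoly f).natDegree = f.natDegree - 1 := by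
  rw [conjPoly, Polynomial.natDegree_divByMonic _ (Polynomial.monic_X_sub_C _), hm.natDegree_map,
    Polynomial.natDegree_X_sub_C]

theorem coeff_conjPoly_mem {D c : ℕ} {f : Polynomial (Polynomial K)} (hm : f.Monic)
    [Nontrivial (AdjoinRoot f)] (F : LinFilt K (AdjoinRoot f) D c) (κ : ℕ)
    (h1 : AdjoinRoot.root f ∈ F.L κ)
    (h2 : ∀ k < f.natDegree, algebraMap _ _ (f.coeff k) ∈ F.L (κ * (f.natDegree - k))) (j : ℕ) :
    ∀ k, k + j + 1 = f.natDegree → (conjPoly f).coeff k ∈ F.L (κ * j) := by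
  induction j with
  | zero =>
    intro k hk
    have : (conjPoly f).coeff k = 1 := by
      have h := conjPoly_monic hm
      rw [Polynomial.Monic, Polynomial.leadingCoeff, natDegree_conjPoly hm] at h
      rw [← h]; congr 1; omega
    rw [this]
    exact F.one
  | succ j ih =>
    intro k hk
    rw [conjPoly, Polynomial.coeff_divByMonic_X_sub_C_rec, Polynomial.coeff_map]
    apply Submodule.add_mem
    · have := h2 (k + 1) (by omega)
      rwa [show f.natDegree - (k + 1) = j + 1 by omega] at this
    · have := F.mul h1 (ih (k + 1) (by omega))
      rw [mul_add_one, add_comm]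
      exact this

theorem ptHom_injective {f : Polynomial (Polynomial K)} {x y x' y' : K} (h : f.evalEval x y = 0)
    (h' : f.evalEval x' y' = 0) (e : ptHom f x y h = ptHom f x' y' h') : x = x' ∧ y = y' := by
  constructor
  · have := DFunLike.congr_fun e (algebraMap (Polynomial K) (AdjoinRoot f) Polynomial.X)
    simpa only [ptHom_X, Polynomial.eval_X] using this
  · have := DFunLike.congr_fun e (AdjoinRoot.root f)
    simpa only [ptHom_root] using this

theorem exists_finset_ptHom (f : Polynomial (Polynomial K)) (T : Finset (K × K))
    (hT : ∀ P ∈ T, f.evalEval P.1 P.2 = 0) :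
    ∃ T' : Finset (AdjoinRoot f →ₐ[K] K), T'.card = T.card ∧
      ∀ φ ∈ T', ∃ x y, ∃ h : f.evalEval x y = 0, (x, y) ∈ T ∧ φ = ptHom f x y h := by
  classical
  refine ⟨T.attach.image fun P => ptHom f P.1.1 P.1.2 (hT _ P.2), ?_, ?_⟩
  · rw [Finset.card_image_of_injective, Finset.card_attach]
    intro P P' h
    obtain ⟨h1, h2⟩ := ptHom_injective _ _ h
    exact Subtype.ext (Prod.ext h1 h2)
  · intro φ hφ
    obtain ⟨P, -, rfl⟩ := Finset.mem_image.1 hφ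
    exact ⟨_, _, hT _ P.2, P.2, rfl⟩

variable [IsAlgClosed K] {p : ℕ} [hp : Fact p.Prime] [CharP K p] [LocFin p K]

theorem card_nonrational_points_le {f : Polynomial (Polynomial K)} (hm : f.Monic)
    (hirr : Irreducible f) (hder : f.derivative ≠ 0) :
    ∃ B : ℕ, ∀ᶠ n in divFilter, ∀ T : Finset (K × K),
      (∀ P ∈ T, f.evalEval P.1 P.2 = 0 ∧ P.1 ^ p ^ n = P.1 ∧ P.2 ^ p ^ n ≠ P.2) →
      T.card ≤ (f.natDegree - 1) * p ^ n + B * p ^ (n / 2) := by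
  have := isDomain_adjoinRoot_of_irreducible hirr
  obtain ⟨κ, hκ⟩ := (LinFilt.polynomial K).exists_weight f
  replace hκ := hκ κ le_rfl
  let F := (LinFilt.polynomial K).ext f hm κ hκ
  let G := conjPoly f
  have hG : G.Monic := conjPoly_monic hm
  have hGd : G.natDegree = f.natDegree - 1 := natDegree_conjPoly hm
  have hκG : ∀ k < G.natDegree, G.coeff k ∈ F.L (κ * (G.natDegree - k)) := by
    intro k hk
    refine coeff_conjPoly_mem hm F κ (LinFilt.root_mem_extL _ f κ) (fun k hk =>
      LinFilt.algebraMap_mem_extL _ f κ (hκ k hk)) _ k (by omega)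
  let FW := F.ext G hG κ hκG
  let α : AdjoinRoot f →ₐ[K] AdjoinRoot G := IsScalarTower.toAlgHom K _ _
  have hβ : f.eval₂ ((α.comp (IsScalarTower.toAlgHom K (Polynomial K) (AdjoinRoot f)) :
      Polynomial K →ₐ[K] AdjoinRoot G) : Polynomial K →+* AdjoinRoot G) (AdjoinRoot.root G) = 0 := by
    have h := AdjoinRoot.eval₂_root G
    have h2 : (f.map (algebraMap (Polynomial K) (AdjoinRoot f))).eval₂ (AdjoinRoot.of G)
        (AdjoinRoot.root G) = 0 := by
      rw [← mul_conjPoly, Polynomial.eval₂_mul, h, mul_zero]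
    rw [Polynomial.eval₂_map] at h2
    exact h2
  let β : AdjoinRoot f →ₐ[K] AdjoinRoot G := AdjoinRoot.liftAlgHom f _ _ hβ
  have hβX : ∀ s : Polynomial K, β (algebraMap _ _ s) = α (algebraMap _ _ s) := by
    intro s
    rw [AdjoinRoot.algebraMap_eq]
    exact AdjoinRoot.liftAlgHom_of _ _ _ _ _
  have hβroot : β (AdjoinRoot.root f) = AdjoinRoot.root G := AdjoinRoot.liftAlgHom_root _ _ _ _
  have hα : ∀ n, ∀ x ∈ F.L n, α x ∈ FW.L n := fun n x hx => F.algebraMap_mem_extL G κ hx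
  have hβL : ∀ n, ∀ x ∈ F.L n, β x ∈ FW.L n := by
    intro n
    refine LinFilt.map_extL_mem _ f κ FW β (fun n s hs => ?_) ?_ n
    · rw [hβX]
      exact hα _ _ (LinFilt.algebraMap_mem_extL _ f κ hs)
    · rw [hβroot]
      exact F.root_mem_extL G κ
  obtain ⟨N, hN, -, hlam⟩ := exists_curve_embedding hm hirr hder
  obtain ⟨x0, hx0⟩ := exists_eval_ne_zero hN
  obtain ⟨lam, hinj, hlam⟩ := hlam x0 hx0
  obtain ⟨B, hB⟩ := LinFilt.stepanov (K := K) p (1 * f.natDegree) _ _ G.natDegree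
    (by rw [one_mul]; exact natDegree_pos_of_derivative hder)
  refine ⟨B, ?_⟩
  filter_upwards [eventually_frobenius_evalEval (p := p) f, eventually_le_pow_half hp.out B,
    eventually_pow_eq_sq (p := p)] with n hfrob hBn hsq T hT
  obtain ⟨T', hT', hT'P⟩ := exists_finset_ptHom f T fun P hP => (hT P hP).1
  rw [← hT', ← hGd, hsq]
  refine hB F lam hinj ((hlam _).trans (taylorHom_X_sub x0)) FW.L FW.fin FW.le FW.mul α β hα hβL
    _ (LinFilt.extL_le_span _ f κ _ LinFilt.polynomial_le_span) (n / 2) hBn T' ?_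
  intro φ hφ
  obtain ⟨x, y, hxy, hxyT, rfl⟩ := hT'P φ hφ
  obtain ⟨-, hx, hy⟩ := hT _ hxyT
  simp only at hx hy
  have hroot : G.eval₂ ((ptHom f x y hxy : AdjoinRoot f →ₐ[K] K) : AdjoinRoot f →+* K)
      (y ^ p ^ n) = 0 := by
    have h1 := congrArg (Polynomial.eval₂ ((ptHom f x y hxy : AdjoinRoot f →ₐ[K] K) :
      AdjoinRoot f →+* K) (y ^ p ^ n)) (mul_conjPoly f)
    rw [Polynomial.eval₂_mul, Polynomial.eval₂_map] at h1
    have h2 : f.eval₂ (((ptHom f x y hxy : AdjoinRoot f →ₐ[K] K) : AdjoinRoot f →+* K).comp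
        (algebraMap (Polynomial K) (AdjoinRoot f))) (y ^ p ^ n) = 0 := by
      have h3 : ((ptHom f x y hxy : AdjoinRoot f →ₐ[K] K) : AdjoinRoot f →+* K).comp
        (algebraMap (Polynomial K) (AdjoinRoot f)) = Polynomial.evalRingHom x := by
        refine RingHom.ext fun s => ?_
        exact ptHom_X f x y hxy s
      rw [h3, Polynomial.eval₂_evalRingHom]
      nth_rewrite 1 [← hx]
      rw [hfrob, hxy, zero_pow (pow_pos hp.out.pos n).ne']
    rw [h2, mul_eq_zero] at h1
    refine h1.resolve_left ?_
    simp only [Polynomial.eval₂_sub, Polynomial.eval₂_X, Polynomial.eval₂_C, RingHom.coe_coe]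
    rw [ptHom_root]
    exact sub_ne_zero.2 hy
  have hP'α : ∀ r, AdjoinRoot.liftAlgHom G (ptHom f x y hxy) _ hroot (α r) = ptHom f x y hxy r := by
    intro r
    exact AdjoinRoot.liftAlgHom_of _ _ _ _ _
  refine ⟨AdjoinRoot.liftAlgHom G (ptHom f x y hxy) _ hroot, hP'α, ?_⟩
  rintro _ ⟨_, ⟨i, rfl⟩, k, rfl⟩
  rw [map_mul, map_mul, hβX, hP'α, map_pow β, hβroot, map_pow, map_pow, map_pow, AdjoinRoot.liftAlgHom_root,
    map_mul, map_pow, map_pow, ptHom_X, ptHom_root, Polynomial.eval_X, ← hsq, mul_pow,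
    pow_right_comm x, hx, pow_right_comm y]

end

section
variable {K : Type} [Field K]

/-- Points of a plane curve over the field with `p ^ n` elements. -/
noncomputable def curvePts (p : ℕ) (f : Polynomial (Polynomial K)) (n : ℕ) : Finset (K × K) :=
  open scoped Classical in (Fs p K n ×ˢ Fs p K n).filter fun P => f.evalEval P.1 P.2 = 0

theorem mem_curvePts {p : ℕ} {f : Polynomial (Polynomial K)} {n : ℕ} {P : K × K} :
    P ∈ curvePts p f n ↔ (P.1 ∈ Fs p K n ∧ P.2 ∈ Fs p K n) ∧ f.evalEval P.1 P.2 = 0 := by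
  classical
  rw [curvePts, Finset.mem_filter, Finset.mem_product]

theorem card_le_of_fst_root {f : Polynomial (Polynomial K)}
    (hm : ∀ x, f.map (Polynomial.evalRingHom x) ≠ 0) {N : Polynomial K}
    (hN : N ≠ 0) (T : Finset (K × K)) (hT : ∀ P ∈ T, f.evalEval P.1 P.2 = 0 ∧ N.eval P.1 = 0) :
    T.card ≤ N.natDegree * f.natDegree := by
  classical
  calc T.card ≤ (N.roots.toFinset.biUnion fun x =>
        (f.map (Polynomial.evalRingHom x)).roots.toFinset.image fun y => (x, y)).card := by
        apply Finset.card_le_card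
        rintro ⟨x, y⟩ hP
        obtain ⟨h1, h2⟩ := hT _ hP
        simp only [Finset.mem_biUnion, Multiset.mem_toFinset, Finset.mem_image, Prod.mk.injEq]
        refine ⟨x, (Polynomial.mem_roots hN).2 h2, y, ?_, rfl, rfl⟩
        rw [Polynomial.mem_roots (hm _), Polynomial.IsRoot.def,
          Polynomial.map_evalRingHom_eval]
        exact h1
    _ ≤ ∑ x ∈ N.roots.toFinset, f.natDegree := by
        refine Finset.card_biUnion_le.trans (Finset.sum_le_sum fun x _ => ?_)
        refine Finset.card_image_le.trans ((Multiset.toFinset_card_le _).trans ?_)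
        exact (Polynomial.card_roots' _).trans Polynomial.natDegree_map_le
    _ ≤ N.natDegree * f.natDegree := by
        rw [Finset.sum_const, smul_eq_mul]
        exact Nat.mul_le_mul_right _ ((Multiset.toFinset_card_le _).trans (Polynomial.card_roots' _))

theorem card_common_zeros_le {f : Polynomial (Polynomial K)} (hm : f.Monic) (hirr : Irreducible f)
    {g : Polynomial (Polynomial K)} (hg : AdjoinRoot.mk f g ≠ 0) :
    ∃ B : ℕ, ∀ T : Finset (K × K),
      (∀ P ∈ T, f.evalEval P.1 P.2 = 0 ∧ g.evalEval P.1 P.2 = 0) → T.card ≤ B := by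
  have := isDomain_adjoinRoot_of_irreducible hirr
  have := isIntegral_adjoinRoot hm
  obtain ⟨N, hN, h⟩ := exists_ne_zero_of_eval_ne_zero (K := K) hg
  refine ⟨_, fun T hT => card_le_of_fst_root (fun _ => (hm.map _).ne_zero) hN T fun P hP => ⟨(hT P hP).1, ?_⟩⟩
  by_contra h0
  refine h (ptHom f P.1 P.2 (hT P hP).1) ?_ ?_
  · rwa [ptHom_X, Polynomial.eval_X]
  · rw [ptHom_mk, (hT P hP).2]

variable [IsAlgClosed K]

theorem card_roots_of_derivative_ne_zero {g : Polynomial K} (hg : g ≠ 0)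
    (h : ∀ y, g.eval y = 0 → g.derivative.eval y ≠ 0) [DecidableEq K] :
    g.roots.toFinset.card = g.natDegree := by
  rw [Multiset.toFinset_card_of_nodup, ← (IsAlgClosed.splits g).natDegree_eq_card_roots]
  rw [Multiset.nodup_iff_count_le_one]
  intro y
  by_contra! hy
  rw [Polynomial.count_roots, Polynomial.one_lt_rootMultiplicity_iff_isRoot hg] at hy
  exact h y hy.1 hy.2

variable {p : ℕ} [hp : Fact p.Prime] [CharP K p] [LocFin p K]

theorem card_curvePts_ge_of_monic {f : Polynomial (Polynomial K)} (hm : f.Monic)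
    (hirr : Irreducible f) (hder : f.derivative ≠ 0) :
    ∃ B : ℕ, ∀ᶠ n in divFilter, p ^ n ≤ (curvePts p f n).card + B * p ^ (n / 2) := by
  classical
  obtain ⟨B, hB⟩ := card_nonrational_points_le (p := p) hm hirr hder
  obtain ⟨N, hN, hsep, -⟩ := exists_curve_embedding hm hirr hder
  refine ⟨B + N.natDegree * f.natDegree, ?_⟩
  filter_upwards [hB, eventually_pos_divFilter] with n hB hn
  let G := (Fs p K n).filter fun x => N.eval x ≠ 0
  let r : K → Finset K := fun x => (f.map (Polynomial.evalRingHom x)).roots.toFinset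
  have hr : ∀ x y, y ∈ r x ↔ f.evalEval x y = 0 := by
    intro x y
    rw [Multiset.mem_toFinset, Polynomial.mem_roots (hm.map _).ne_zero, Polynomial.IsRoot.def,
      Polynomial.map_evalRingHom_eval]
  have hrc : ∀ x, N.eval x ≠ 0 → (r x).card = f.natDegree := by
    intro x hx
    rw [← hm.natDegree_map (Polynomial.evalRingHom x)]
    refine card_roots_of_derivative_ne_zero (hm.map _).ne_zero fun y hy => ?_
    rw [Polynomial.map_evalRingHom_eval] at hy
    rw [Polynomial.derivative_map, Polynomial.map_evalRingHom_eval]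
    exact hsep x y hy hx
  have hG : p ^ n ≤ G.card + N.natDegree := by
    rw [← card_Fs (K := K) hn, ← Finset.card_filter_add_card_filter_not (fun x => N.eval x ≠ 0)]
    refine Nat.add_le_add_left ?_ _
    refine (Finset.card_le_card (t := N.roots.toFinset) ?_).trans
      ((Multiset.toFinset_card_le _).trans (Polynomial.card_roots' _))
    intro x hx
    rw [Finset.mem_filter, not_not] at hx
    exact Multiset.mem_toFinset.2 ((Polynomial.mem_roots hN).2 hx.2)
  let A : Finset (K × K) := (G.sigma r).map (Equiv.sigmaEquivProd K K).toEmbedding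
  have hA : A.card = G.card * f.natDegree := by
    rw [Finset.card_map, Finset.card_sigma, Finset.sum_const_nat]
    intro x hx
    exact hrc x (Finset.mem_filter.1 hx).2
  have hmemA : ∀ P, P ∈ A ↔ (P.1 ∈ Fs p K n ∧ N.eval P.1 ≠ 0) ∧ f.evalEval P.1 P.2 = 0 := by
    rintro ⟨x, y⟩
    rw [← hr]
    simp only [A, G, Finset.mem_map_equiv, Finset.mem_sigma, Equiv.sigmaEquivProd_symm_apply,
      Finset.mem_filter]
  have h1 := hB (A.filter fun P => ¬ P.2 ∈ Fs p K n) (by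
    intro P hP
    rw [Finset.mem_filter, hmemA] at hP
    exact ⟨hP.1.2, (mem_Fs hn).1 hP.1.1.1, fun h => hP.2 ((mem_Fs hn).2 h)⟩)
  have h2 : (A.filter fun P => P.2 ∈ Fs p K n).card ≤ (curvePts p f n).card := by
    apply Finset.card_le_card
    intro P hP
    rw [Finset.mem_filter, hmemA] at hP
    exact mem_curvePts.2 ⟨⟨hP.1.1.1, hP.2⟩, hP.1.2⟩
  have h3 := Finset.card_filter_add_card_filter_not (s := A) (fun P => P.2 ∈ Fs p K n)
  obtain ⟨d, hd⟩ : ∃ d, f.natDegree = d + 1 :=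
    ⟨f.natDegree - 1, (Nat.succ_pred_eq_of_pos (natDegree_pos_of_derivative hder)).symm⟩
  have hQ : 1 ≤ p ^ (n / 2) := Nat.one_le_pow _ _ hp.out.pos
  rw [hd] at h1 hA ⊢
  rw [Nat.add_sub_cancel] at h1
  have h4 := Nat.mul_le_mul_right (d + 1) hG
  have h5 : N.natDegree * (d + 1) ≤ N.natDegree * (d + 1) * p ^ (n / 2) := Nat.le_mul_of_pos_right _ hQ
  nlinarith

end

section
variable {R : Type*} [CommRing R]

/-- The monic quadratic polynomial `z ^ 2 + b z + c`. -/
noncomputable def quadPoly (b c : R) : Polynomial R :=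
  Polynomial.X ^ 2 + Polynomial.C b * Polynomial.X + Polynomial.C c

theorem quadPoly_eq (b c : R) : quadPoly b c = Polynomial.C 1 * Polynomial.X ^ 2 +
    Polynomial.C b * Polynomial.X + Polynomial.C c := by
  rw [quadPoly, Polynomial.C_1, one_mul]

theorem natDegree_quadPoly [Nontrivial R] (b c : R) : (quadPoly b c).natDegree = 2 := by
  rw [quadPoly_eq, Polynomial.natDegree_quadratic one_ne_zero]

theorem quadPoly_monic (b c : R) : (quadPoly b c).Monic := by
  nontriviality R
  rw [Polynomial.Monic, quadPoly_eq, Polynomial.leadingCoeff_quadratic one_ne_zero]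

theorem coeff_quadPoly_one (b c : R) : (quadPoly b c).coeff 1 = b := by
  simp [quadPoly, Polynomial.coeff_C, Polynomial.coeff_X_pow]

theorem eval₂_quadPoly {S : Type*} [CommRing S] (b c : R) (i : R →+* S) (z : S) :
    (quadPoly b c).eval₂ i z = z ^ 2 + i b * z + i c := by
  simp [quadPoly]

theorem derivative_quadPoly (b c : R) :
    Polynomial.derivative (quadPoly b c) = Polynomial.C 2 * Polynomial.X + Polynomial.C b := by
  rw [← one_add_one_eq_two, Polynomial.C_add, Polynomial.C_1]
  simp [quadPoly]

theorem root_quadPoly_sq (b c : R) : AdjoinRoot.root (quadPoly b c) ^ 2 =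
    -(algebraMap R _ b * AdjoinRoot.root (quadPoly b c)) - algebraMap R _ c := by
  have h := (eval₂_quadPoly b c (AdjoinRoot.of (quadPoly b c)) _).symm.trans
    (AdjoinRoot.eval₂_root (quadPoly b c))
  rw [← AdjoinRoot.algebraMap_eq] at h
  linear_combination h

theorem exists_eq_add_mul_root_quadPoly (b c : R) (z : AdjoinRoot (quadPoly b c)) :
    ∃ u v : R, z = algebraMap R _ u + algebraMap R _ v * AdjoinRoot.root (quadPoly b c) := by
  obtain ⟨P, rfl⟩ := AdjoinRoot.mk_surjective z
  induction P using Polynomial.induction_on' with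
  | add P Q hP hQ =>
    obtain ⟨u, v, h⟩ := hP
    obtain ⟨u', v', h'⟩ := hQ
    refine ⟨u + u', v + v', ?_⟩
    rw [map_add, h, h', map_add, map_add]
    ring
  | monomial k a =>
    rw [← Polynomial.C_mul_X_pow_eq_monomial, map_mul, map_pow, AdjoinRoot.mk_X, AdjoinRoot.mk_C]
    have : ∃ u v : R, AdjoinRoot.root (quadPoly b c) ^ k =
        algebraMap R _ u + algebraMap R _ v * AdjoinRoot.root (quadPoly b c) := by
      induction k with
      | zero => exact ⟨1, 0, by simp⟩
      | succ k ih =>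
        obtain ⟨u, v, h⟩ := ih
        refine ⟨-(v * c), u - v * b, ?_⟩
        rw [pow_succ, h, map_neg, map_sub, map_mul, map_mul]
        linear_combination (algebraMap R _ v) * root_quadPoly_sq b c
    obtain ⟨u, v, h⟩ := this
    refine ⟨a * u, a * v, ?_⟩
    rw [h, map_mul, map_mul, ← AdjoinRoot.algebraMap_eq]
    ring

theorem isDomain_adjoinRoot_quadPoly [IsDomain R] (b c : R)
    (h : ∀ u v : R, u ^ 2 + b * u * v + c * v ^ 2 = 0 → v = 0) :
    IsDomain (AdjoinRoot (quadPoly b c)) := by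
  have hinj : Function.Injective (algebraMap R (AdjoinRoot (quadPoly b c))) := by
    apply AdjoinRoot.of.injective_of_degree_ne_zero
    rw [Polynomial.degree_eq_natDegree (quadPoly_monic b c).ne_zero, natDegree_quadPoly]
    norm_num
  have : Nontrivial (AdjoinRoot (quadPoly b c)) := hinj.nontrivial
  have key : ∀ u v : R, u ^ 2 + b * u * v + c * v ^ 2 = 0 → u = 0 ∧ v = 0 := by
    intro u v huv
    have hv := h u v huv
    subst hv
    exact ⟨by simpa using huv, rfl⟩
  have : NoZeroDivisors (AdjoinRoot (quadPoly b c)) := by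
    constructor
    intro z z' hzz
    obtain ⟨u, v, rfl⟩ := exists_eq_add_mul_root_quadPoly b c z
    obtain ⟨u', v', rfl⟩ := exists_eq_add_mul_root_quadPoly b c z'
    have hw := root_quadPoly_sq b c
    set w := AdjoinRoot.root (quadPoly b c)
    have h1 : algebraMap R (AdjoinRoot (quadPoly b c)) (((-u) ^ 2 + b * (-u) * v + c * v ^ 2) *
        ((-u') ^ 2 + b * (-u') * v' + c * v' ^ 2)) = 0 := by
      simp only [map_add, map_mul, map_neg, map_pow]
      set ι := algebraMap R (AdjoinRoot (quadPoly b c))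
      have e1 : ∀ u v : R, (-ι u) ^ 2 + ι b * (-ι u) * ι v + ι c * ι v ^ 2 =
          (ι u + ι v * w) * (ι u - ι b * ι v - ι v * w) := by
        intro u v
        linear_combination (ι v) ^ 2 * hw
      rw [e1, e1]
      linear_combination (ι u - ι b * ι v - ι v * w) * (ι u' - ι b * ι v' - ι v' * w) * hzz
    rw [map_eq_zero_iff _ hinj, mul_eq_zero] at h1
    rcases h1 with h1 | h1
    · left
      obtain ⟨e1, e2⟩ := key _ _ h1
      rw [neg_eq_zero.1 e1, e2]; simp
    · right
      obtain ⟨e1, e2⟩ := key _ _ h1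
      rw [neg_eq_zero.1 e1, e2]; simp
  exact NoZeroDivisors.to_isDomain _

end

section
variable {K : Type} [Field K]

/-- The binary quadratic form `a y² + b y z + d z²` has a nontrivial zero in `S`. -/
def Isot (S : Finset K) (a b d : K) : Prop :=
  ∃ y ∈ S, ∃ z ∈ S, (y ≠ 0 ∨ z ≠ 0) ∧ a * y ^ 2 + b * y * z + d * z ^ 2 = 0

variable {p : ℕ} [hp : Fact p.Prime] [CharP K p]

theorem isot_of_eq_zero {n : ℕ} (hn : 0 < n) (b d : K) : Isot (Fs p K n) 0 b d :=
  ⟨1, Fs_one_mem hn, 0, Fs_zero_mem hn, Or.inl one_ne_zero, by simp⟩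

theorem isot_of_root {n : ℕ} {a b d w : K} (hn : 0 < n) (ha : a ∈ Fs p K n) (hw : w ∈ Fs p K n)
    (h : w ^ 2 + b * w + a * d = 0) : Isot (Fs p K n) a b d := by
  by_cases ha0 : a = 0
  · rw [ha0]; exact isot_of_eq_zero hn b d
  · exact ⟨w, hw, a, ha, Or.inr ha0, by linear_combination a * h⟩

theorem isot_of_disc_eq_zero {n : ℕ} {a b d : K} (hn : 0 < n) (ha : a ∈ Fs p K n)
    (hb : b ∈ Fs p K n) (hd : d ∈ Fs p K n) (h : b ^ 2 - 4 * a * d = 0) :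
    Isot (Fs p K n) a b d := by
  by_cases ha0 : a = 0
  · rw [ha0]; exact isot_of_eq_zero hn b d
  by_cases h2 : (2 : K) = 0
  · have hp2 : p = 2 := by
      have : ((2 : ℕ) : K) = 0 := by exact_mod_cast h2
      rw [CharP.cast_eq_zero_iff K p] at this
      exact (Nat.prime_dvd_prime_iff_eq hp.out Nat.prime_two).1 this
    have hb0 : b = 0 := by
      have : b ^ 2 = 0 := by linear_combination h + 2 * a * d * h2
      exact pow_eq_zero_iff two_ne_zero |>.1 this
    have hs : ∀ x ∈ Fs p K n, (x ^ p ^ (n - 1)) ^ 2 = x := by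
      intro x hx
      rw [← hp2, ← pow_mul, ← pow_succ, Nat.sub_add_cancel hn]
      exact (mem_Fs hn).1 hx
    refine ⟨d ^ p ^ (n - 1), Fs_pow_mem hn hd _, a ^ p ^ (n - 1), Fs_pow_mem hn ha _,
      Or.inr (pow_ne_zero _ ha0), ?_⟩
    rw [hs d hd, hs a ha, hb0]
    linear_combination a * d * h2
  · refine ⟨-b, Fs_neg_mem hn hb, 2 * a, ?_, Or.inr (mul_ne_zero h2 ha0), ?_⟩
    · rw [two_mul]; exact Fs_add_mem hn ha ha
    · linear_combination (-a) * h

/-- Points of a curve where a quadratic form is anisotropic. -/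
noncomputable def curveNeg (p : ℕ) (f A B D : Polynomial (Polynomial K)) (n : ℕ) :
    Finset (K × K) :=
  open scoped Classical in (curvePts p f n).filter fun P =>
    ¬ Isot (Fs p K n) (A.evalEval P.1 P.2) (B.evalEval P.1 P.2) (D.evalEval P.1 P.2)

/-- Points of a curve where a quadratic form is isotropic and nondegenerate. -/
noncomputable def curvePos (p : ℕ) (f A B D : Polynomial (Polynomial K)) (n : ℕ) :
    Finset (K × K) :=
  open scoped Classical in (curvePts p f n).filter fun P =>
    Isot (Fs p K n) (A.evalEval P.1 P.2) (B.evalEval P.1 P.2) (D.evalEval P.1 P.2) ∧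
      (B ^ 2 - 4 * A * D : Polynomial (Polynomial K)).evalEval P.1 P.2 ≠ 0

theorem mem_curveNeg {f A B D : Polynomial (Polynomial K)} {n : ℕ} {P : K × K} :
    P ∈ curveNeg p f A B D n ↔ P ∈ curvePts p f n ∧
      ¬ Isot (Fs p K n) (A.evalEval P.1 P.2) (B.evalEval P.1 P.2) (D.evalEval P.1 P.2) := by
  classical
  rw [curveNeg, Finset.mem_filter]

theorem mem_curvePos {f A B D : Polynomial (Polynomial K)} {n : ℕ} {P : K × K} :
    P ∈ curvePos p f A B D n ↔ P ∈ curvePts p f n ∧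
      Isot (Fs p K n) (A.evalEval P.1 P.2) (B.evalEval P.1 P.2) (D.evalEval P.1 P.2) ∧
      (B ^ 2 - 4 * A * D : Polynomial (Polynomial K)).evalEval P.1 P.2 ≠ 0 := by
  classical
  rw [curvePos, Finset.mem_filter]

theorem evalEval_disc (A B D : Polynomial (Polynomial K)) (x y : K) :
    (B ^ 2 - 4 * A * D : Polynomial (Polynomial K)).evalEval x y =
      B.evalEval x y ^ 2 - 4 * A.evalEval x y * D.evalEval x y := by
  have := map_ofNat (Polynomial.evalEvalRingHom x y) 4
  rw [Polynomial.coe_evalEvalRingHom] at this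
  rw [Polynomial.evalEval_sub, Polynomial.evalEval_mul, Polynomial.evalEval_mul,
    Polynomial.evalEval_pow, this]

end

section
variable {K : Type} [Field K] [IsAlgClosed K] {p : ℕ} [hp : Fact p.Prime] [CharP K p] [LocFin p K]

theorem exists_finset_quad_algHom (f A B D : Polynomial (Polynomial K)) (n : ℕ)
    (hn : 0 < n) (hA : ∀ x ∈ Fs p K n, ∀ y ∈ Fs p K n, A.evalEval x y ∈ Fs p K n)
    (hB : ∀ x ∈ Fs p K n, ∀ y ∈ Fs p K n, B.evalEval x y ∈ Fs p K n)
    (hD : ∀ x ∈ Fs p K n, ∀ y ∈ Fs p K n, D.evalEval x y ∈ Fs p K n) :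
    let b := AdjoinRoot.mk f B
    let g := quadPoly b (AdjoinRoot.mk f (A * D))
    ∃ T : Finset (AdjoinRoot g →ₐ[K] K), T.card = 2 * (curveNeg p f A B D n).card ∧
      ∀ φ ∈ T, (φ (algebraMap (AdjoinRoot f) _ (algebraMap (Polynomial K) _ Polynomial.X))) ^ p ^ n =
        φ (algebraMap (AdjoinRoot f) _ (algebraMap (Polynomial K) _ Polynomial.X)) ∧
      (φ (algebraMap (AdjoinRoot f) _ (AdjoinRoot.root f))) ^ p ^ n =
        φ (algebraMap (AdjoinRoot f) _ (AdjoinRoot.root f)) ∧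
      (φ (AdjoinRoot.root g)) ^ p ^ n = φ (-(algebraMap _ _ b) - AdjoinRoot.root g) := by
  classical
  intro b g
  let r : K × K → Finset K := fun P =>
    (quadPoly (B.evalEval P.1 P.2) (A.evalEval P.1 P.2 * D.evalEval P.1 P.2)).roots.toFinset
  have hr : ∀ P w, w ∈ r P ↔ w ^ 2 + B.evalEval P.1 P.2 * w +
      A.evalEval P.1 P.2 * D.evalEval P.1 P.2 = 0 := by
    intro P w
    rw [Multiset.mem_toFinset, Polynomial.mem_roots (quadPoly_monic _ _).ne_zero,
      Polynomial.IsRoot.def, quadPoly]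
    simp
  let U := (curveNeg p f A B D n).sigma r
  have hU : ∀ u ∈ U, (u.1 ∈ curvePts p f n ∧ ¬ Isot (Fs p K n) (A.evalEval u.1.1 u.1.2)
      (B.evalEval u.1.1 u.1.2) (D.evalEval u.1.1 u.1.2)) ∧
      u.2 ^ 2 + B.evalEval u.1.1 u.1.2 * u.2 + A.evalEval u.1.1 u.1.2 * D.evalEval u.1.1 u.1.2 = 0 := by
    intro u hu
    rw [Finset.mem_sigma, mem_curveNeg, hr] at hu
    exact hu
  have hUc : U.card = 2 * (curveNeg p f A B D n).card := by
    rw [Finset.card_sigma, mul_comm, Finset.sum_const_nat]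
    intro P hP
    rw [mem_curveNeg, mem_curvePts] at hP
    obtain ⟨⟨⟨hx, hy⟩, -⟩, hiso⟩ := hP
    rw [card_roots_of_derivative_ne_zero (quadPoly_monic _ _).ne_zero, natDegree_quadPoly]
    intro w hw hw'
    apply hiso
    refine isot_of_disc_eq_zero hn (hA _ hx _ hy) (hB _ hx _ hy) (hD _ hx _ hy) ?_
    rw [derivative_quadPoly] at hw'
    simp only [quadPoly, Polynomial.eval_add, Polynomial.eval_mul, Polynomial.eval_pow,
      Polynomial.eval_X, Polynomial.eval_C] at hw hw'
    linear_combination (-4) * hw + (2 * w + B.evalEval P.1 P.2) * hw'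
  have hex : ∀ u : U, ∃ φ : AdjoinRoot g →ₐ[K] K,
      φ (algebraMap (AdjoinRoot f) _ (algebraMap (Polynomial K) _ Polynomial.X)) = u.1.1.1 ∧
      φ (algebraMap (AdjoinRoot f) _ (AdjoinRoot.root f)) = u.1.1.2 ∧
      φ (AdjoinRoot.root g) = u.1.2 ∧ φ (algebraMap _ _ b) = B.evalEval u.1.1.1 u.1.1.2 := by
    rintro ⟨⟨⟨x, y⟩, w⟩, hu⟩
    obtain ⟨⟨h1, -⟩, h2⟩ := hU _ hu
    rw [mem_curvePts] at h1
    obtain ⟨-, hf⟩ := h1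
    have hg : g.eval₂ (ptHom f x y hf : AdjoinRoot f →+* K) w = 0 := by
      rw [eval₂_quadPoly]
      simp only [RingHom.coe_coe, b, ptHom_mk, Polynomial.evalEval_mul]
      exact h2
    refine ⟨AdjoinRoot.liftAlgHom g (ptHom f x y hf) w hg, ?_, ?_, ?_, ?_⟩
    · exact (AdjoinRoot.liftAlgHom_of _ _ _ hg _).trans ((ptHom_X _ _ _ _ _).trans Polynomial.eval_X)
    · exact (AdjoinRoot.liftAlgHom_of _ _ _ hg _).trans (ptHom_root _ _ _ _)
    · exact AdjoinRoot.liftAlgHom_root _ _ _ hg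
    · exact (AdjoinRoot.liftAlgHom_of _ _ _ hg _).trans (ptHom_mk _ _ _ _ _)
  choose φ h1 h2 h3 h4 using hex
  refine ⟨Finset.univ.image φ, ?_, ?_⟩
  · rw [Finset.card_image_of_injective, Finset.card_univ, Fintype.card_coe, hUc]
    intro u v huv
    have e1 := (h1 u).symm.trans ((DFunLike.congr_fun huv _).trans (h1 v))
    have e2 := (h2 u).symm.trans ((DFunLike.congr_fun huv _).trans (h2 v))
    have e3 := (h3 u).symm.trans ((DFunLike.congr_fun huv _).trans (h3 v))
    exact Subtype.ext (Sigma.ext (Prod.ext e1 e2) (heq_of_eq e3))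
  · intro ψ hψ
    obtain ⟨u, -, rfl⟩ := Finset.mem_image.1 hψ
    obtain ⟨⟨h5, h6⟩, h7⟩ := hU _ u.2
    rw [mem_curvePts] at h5
    have hx := h5.1.1
    have hy := h5.1.2
    have hAm := hA _ hx _ hy
    have hBm := hB _ hx _ hy
    have hDm := hD _ hx _ hy
    rw [map_sub, map_neg, h1, h2, h3, h4]
    refine ⟨(mem_Fs hn).1 hx, (mem_Fs hn).1 hy, ?_⟩
    have hw : u.1.2 ^ p ^ n ≠ u.1.2 := fun h => h6 (isot_of_root hn hAm ((mem_Fs hn).2 h) h7)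
    have h8 := congrArg (· ^ p ^ n) h7
    simp only [add_pow_char_pow, mul_pow, (mem_Fs hn).1 hAm, (mem_Fs hn).1 hBm,
      (mem_Fs hn).1 hDm, zero_pow (pow_pos hp.out.pos n).ne', pow_right_comm _ 2] at h8
    have h9 : (u.1.2 ^ p ^ n - u.1.2) *
      (u.1.2 ^ p ^ n + u.1.2 + B.evalEval u.1.1.1 u.1.1.2) = 0 := by
      linear_combination h8 - h7
    have := (mul_eq_zero.1 h9).resolve_left (sub_ne_zero.2 hw)
    linear_combination this

theorem two_mul_card_curveNeg_le {f A B D : Polynomial (Polynomial K)} (hm : f.Monic)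
    (hirr : Irreducible f) (hder : f.derivative ≠ 0)
    (hdisc : AdjoinRoot.mk f (B ^ 2 - 4 * A * D) ≠ 0)
    (hdom : IsDomain (AdjoinRoot (quadPoly (AdjoinRoot.mk f B) (AdjoinRoot.mk f (A * D))))) :
    ∃ M : ℕ, ∀ᶠ n in divFilter,
      2 * (curveNeg p f A B D n).card ≤ p ^ n + M * p ^ (n / 2) := by
  have := isDomain_adjoinRoot_of_irreducible hirr
  have := isIntegral_adjoinRoot hm
  obtain ⟨κ, hκ⟩ := (LinFilt.polynomial K).exists_weight f
  replace hκ := hκ κ le_rfl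
  let F := (LinFilt.polynomial K).ext f hm κ hκ
  set b := AdjoinRoot.mk f B with hb
  set g := quadPoly b (AdjoinRoot.mk f (A * D)) with hg
  have hgm : g.Monic := quadPoly_monic _ _
  have hgd : g.natDegree = 2 := natDegree_quadPoly _ _
  obtain ⟨κ', hκ'⟩ := F.exists_weight g
  replace hκ' := hκ' κ' le_rfl
  let F' := F.ext g hgm κ' hκ'
  have hbF : b ∈ F.L κ' := by
    have := hκ' 1 (by omega)
    rwa [hgd, coeff_quadPoly_one, show 2 - 1 = 1 from rfl, mul_one] at this
  have hβ : g.eval₂ ((IsScalarTower.toAlgHom K (AdjoinRoot f) (AdjoinRoot g) :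
      AdjoinRoot f →ₐ[K] AdjoinRoot g) : AdjoinRoot f →+* AdjoinRoot g)
      (-(algebraMap _ _ b) - AdjoinRoot.root g) = 0 := by
    rw [eval₂_quadPoly]
    have := root_quadPoly_sq b (AdjoinRoot.mk f (A * D))
    rw [← hg] at this
    simp only [RingHom.coe_coe, IsScalarTower.coe_toAlgHom']
    linear_combination this
  let β : AdjoinRoot g →ₐ[K] AdjoinRoot g := AdjoinRoot.liftAlgHom g
    (IsScalarTower.toAlgHom K (AdjoinRoot f) (AdjoinRoot g)) _ hβ
  have hβa : ∀ s, β (algebraMap _ _ s) = algebraMap _ _ s :=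
    fun s => AdjoinRoot.liftAlgHom_of _ _ _ _ _
  have hβr : β (AdjoinRoot.root g) = -(algebraMap _ _ b) - AdjoinRoot.root g :=
    AdjoinRoot.liftAlgHom_root _ _ _ _
  have hβL : ∀ n, ∀ x ∈ F'.L n, β x ∈ F'.L n := by
    intro n
    refine LinFilt.map_extL_mem F g κ' F' β (fun n s hs => ?_) ?_ n
    · rw [hβa]
      exact F.algebraMap_mem_extL g κ' hs
    · rw [hβr]
      exact sub_mem (neg_mem (F.algebraMap_mem_extL g κ' hbF)) (F.root_mem_extL g κ')
  obtain ⟨N, hN, -, hlam⟩ := exists_curve_embedding hm hirr hder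
  obtain ⟨N', hN', hdN'⟩ := exists_ne_zero_of_eval_ne_zero (K := K) hdisc
  obtain ⟨x0, hx0⟩ := exists_eval_ne_zero (mul_ne_zero hN hN')
  rw [Polynomial.eval_mul] at hx0
  obtain ⟨lam, hinj, hlam⟩ := hlam x0 (left_ne_zero_of_mul hx0)
  obtain ⟨lam', hinj', hlam'⟩ := exists_powerSeries_embedding_ext lam hinj hlam g hgm (by omega) (by
    intro φ hφ y hy hy'
    refine hdN' φ (by rw [hφ]; exact right_ne_zero_of_mul hx0) ?_
    rw [eval₂_quadPoly] at hy
    rw [derivative_quadPoly] at hy'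
    simp only [Polynomial.eval₂_add, Polynomial.eval₂_mul, Polynomial.eval₂_X,
      Polynomial.eval₂_C, RingHom.coe_coe] at hy hy'
    rw [map_ofNat] at hy'
    rw [map_mul, map_mul] at hy
    simp only [map_sub, map_mul, map_pow, map_ofNat]
    linear_combination (2 * y + φ b) * hy' - 4 * hy)
  obtain ⟨M, hM⟩ := LinFilt.stepanov (K := K) p (1 * f.natDegree * g.natDegree) _ _ 1
    (by rw [one_mul]; exact mul_pos (natDegree_pos_of_derivative hder) (by omega))
  refine ⟨M, ?_⟩
  filter_upwards [eventually_evalEval_mem (p := p) A, eventually_evalEval_mem (p := p) B,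
    eventually_evalEval_mem (p := p) D, eventually_le_pow_half hp.out M,
    eventually_pow_eq_sq (p := p), eventually_pos_divFilter] with n hA hB hD hMn hsq hn
  obtain ⟨T, hTc, hT⟩ := exists_finset_quad_algHom f A B D n hn hA hB hD
  rw [← hTc]
  refine (hM F' lam' hinj' ((hlam' _).trans (taylorHom_X_sub x0)) F'.L F'.fin
    (fun n => by rw [mul_one]; exact F'.le n) F'.mul (AlgHom.id K _) β (fun _ _ h => h) hβL
    _ (LinFilt.extL_le_span _ g κ' _ (LinFilt.extL_le_span _ f κ _ LinFilt.polynomial_le_span))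
    (n / 2) hMn T ?_).trans_eq (by rw [one_mul, hsq])
  intro φ hφ
  refine ⟨φ, fun x => rfl, ?_⟩
  obtain ⟨h1, h2, h3⟩ := hT φ hφ
  rintro _ ⟨_, ⟨_, ⟨i, rfl⟩, k, rfl⟩, l, rfl⟩
  rw [← hsq, map_mul, hβa, map_pow β, hβr, map_mul φ, map_pow φ, ← h3, map_mul φ, map_pow φ,
    map_mul (algebraMap _ _), map_mul φ, map_pow, map_pow, map_pow, map_pow, map_pow, mul_pow,
    mul_pow, pow_right_comm _ i, h1, pow_right_comm _ k, h2, pow_right_comm _ l]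

end

section
variable {K : Type} [Field K]

/-- A plane curve has at least about `q` points, and the quadratic forms with coefficients on it
are isotropic at about half of the points, at least. -/
def CurveGood (p : ℕ) (f : Polynomial (Polynomial K)) : Prop :=
  (∃ M : ℕ, ∀ᶠ n in divFilter, p ^ n ≤ (curvePts p f n).card + M * p ^ (n / 2)) ∧
  ∀ A B D, ∃ M : ℕ, ∀ᶠ n in divFilter,
    (curveNeg p f A B D n).card ≤ (curvePos p f A B D n).card + M * p ^ (n / 2)

variable {p : ℕ} [hp : Fact p.Prime] [CharP K p] [LocFin p K]

theorem curveNeg_eq_empty_of_disc {f A B D : Polynomial (Polynomial K)}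
    (h : AdjoinRoot.mk f (B ^ 2 - 4 * A * D) = 0) :
    ∀ᶠ n in divFilter, curveNeg p f A B D n = ∅ := by
  filter_upwards [eventually_evalEval_mem (p := p) A, eventually_evalEval_mem (p := p) B,
    eventually_evalEval_mem (p := p) D, eventually_pos_divFilter] with n hA hB hD hn
  rw [Finset.eq_empty_iff_forall_notMem]
  intro P hP
  rw [mem_curveNeg, mem_curvePts] at hP
  obtain ⟨⟨⟨hx, hy⟩, hf⟩, hiso⟩ := hP
  refine hiso (isot_of_disc_eq_zero hn (hA _ hx _ hy) (hB _ hx _ hy) (hD _ hx _ hy) ?_)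
  rw [← evalEval_disc, ← ptHom_mk f _ _ hf, h, map_zero]

theorem card_curveNeg_le_of_root {f A B D : Polynomial (Polynomial K)} (hm : f.Monic)
    (hirr : Irreducible f) {u v : AdjoinRoot f} (hv : v ≠ 0)
    (h : u ^ 2 + AdjoinRoot.mk f B * u * v + AdjoinRoot.mk f (A * D) * v ^ 2 = 0) :
    ∃ M : ℕ, ∀ᶠ n in divFilter, (curveNeg p f A B D n).card ≤ M := by
  obtain ⟨U, rfl⟩ := AdjoinRoot.mk_surjective u
  obtain ⟨V, rfl⟩ := AdjoinRoot.mk_surjective v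
  obtain ⟨M, hM⟩ := card_common_zeros_le hm hirr hv
  refine ⟨M, ?_⟩
  filter_upwards [eventually_evalEval_mem (p := p) A, eventually_evalEval_mem (p := p) U,
    eventually_evalEval_mem (p := p) V, eventually_pos_divFilter] with n hA hU hV hn
  refine hM _ fun P hP => ?_
  rw [mem_curveNeg, mem_curvePts] at hP
  obtain ⟨⟨⟨hx, hy⟩, hf⟩, hiso⟩ := hP
  refine ⟨hf, ?_⟩
  by_contra hV0
  apply hiso
  apply isot_of_root hn (hA _ hx _ hy) (Fs_mul_mem hn (hU _ hx _ hy) (Fs_inv_mem hn (hV _ hx _ hy)))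
  have := congrArg (ptHom f P.1 P.2 hf) h
  simp only [map_add, map_mul, map_pow, ptHom_mk, map_zero] at this
  field_simp
  linear_combination this

theorem curveGood_of_monic [IsAlgClosed K] {f : Polynomial (Polynomial K)} (hm : f.Monic)
    (hirr : Irreducible f) (hder : f.derivative ≠ 0) : CurveGood p f := by
  classical
  obtain ⟨M0, hM0⟩ := card_curvePts_ge_of_monic (p := p) hm hirr hder
  refine ⟨⟨M0, hM0⟩, fun A B D => ?_⟩
  by_cases hdisc : AdjoinRoot.mk f (B ^ 2 - 4 * A * D) = 0
  · refine ⟨0, ?_⟩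
    filter_upwards [curveNeg_eq_empty_of_disc (p := p) hdisc] with n hn
    rw [hn]
    simp
  have := isDomain_adjoinRoot_of_irreducible hirr
  by_cases hroot : ∀ u v : AdjoinRoot f,
      u ^ 2 + AdjoinRoot.mk f B * u * v + AdjoinRoot.mk f (A * D) * v ^ 2 = 0 → v = 0
  · obtain ⟨M1, hM1⟩ := two_mul_card_curveNeg_le (p := p) hm hirr hder hdisc
      (isDomain_adjoinRoot_quadPoly _ _ hroot)
    obtain ⟨M2, hM2⟩ := card_common_zeros_le hm hirr hdisc
    refine ⟨M0 + M1 + M2, ?_⟩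
    filter_upwards [hM0, hM1] with n h0 h1
    have h2 : (curvePts p f n).card ≤
        (curveNeg p f A B D n).card + (curvePos p f A B D n).card + M2 := by
      calc (curvePts p f n).card ≤ ((curveNeg p f A B D n ∪ curvePos p f A B D n) ∪
            (curvePts p f n).filter fun P =>
              (B ^ 2 - 4 * A * D : Polynomial (Polynomial K)).evalEval P.1 P.2 = 0).card := by
            apply Finset.card_le_card
            intro P hP
            simp only [Finset.mem_union, mem_curveNeg, mem_curvePos, Finset.mem_filter]
            tauto
        _ ≤ _ := by
            refine (Finset.card_union_le _ _).trans (add_le_add (Finset.card_union_le _ _) ?_)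
            refine hM2 _ fun P hP => ?_
            rw [Finset.mem_filter, mem_curvePts] at hP
            exact ⟨hP.1.2, hP.2⟩
    have hQ : 1 ≤ p ^ (n / 2) := Nat.one_le_pow _ _ hp.out.pos
    nlinarith
  · push Not at hroot
    obtain ⟨u, v, h, hv⟩ := hroot
    obtain ⟨M, hM⟩ := card_curveNeg_le_of_root (p := p) hm hirr hv h
    refine ⟨M, ?_⟩
    filter_upwards [hM] with n hn
    have hQ : 1 ≤ p ^ (n / 2) := Nat.one_le_pow _ _ hp.out.pos
    nlinarith

theorem CurveGood.transfer {f f' : Polynomial (Polynomial K)} (h : CurveGood p f')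
    (E E' : K × K → Prop) (M : ℕ)
    (hE : ∀ T : Finset (K × K), (∀ P ∈ T, f.evalEval P.1 P.2 = 0 ∧ E P) → T.card ≤ M)
    (hE' : ∀ T : Finset (K × K), (∀ P ∈ T, f'.evalEval P.1 P.2 = 0 ∧ E' P) → T.card ≤ M)
    (σ : K × K → K × K)
    (hσ : ∀ᶠ n in divFilter, (∀ P ∈ curvePts p f n, ¬ E P → σ P ∈ curvePts p f' n) ∧
      (∀ P ∈ curvePts p f n, ∀ P' ∈ curvePts p f n, ¬ E P → ¬ E P' → σ P = σ P' → P = P') ∧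
      ∀ P' ∈ curvePts p f' n, ¬ E' P' → ∃ P ∈ curvePts p f n, ¬ E P ∧ σ P = P')
    (hF : ∀ A B D : Polynomial (Polynomial K), ∃ A' B' D' : Polynomial (Polynomial K),
      ∀ᶠ n in divFilter, ∀ P ∈ curvePts p f n, ¬ E P →
      (Isot (Fs p K n) (A.evalEval P.1 P.2) (B.evalEval P.1 P.2) (D.evalEval P.1 P.2) ↔
        Isot (Fs p K n) (A'.evalEval (σ P).1 (σ P).2) (B'.evalEval (σ P).1 (σ P).2)
          (D'.evalEval (σ P).1 (σ P).2)) ∧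
      ((B ^ 2 - 4 * A * D).evalEval P.1 P.2 = 0 ↔
        (B' ^ 2 - 4 * A' * D').evalEval (σ P).1 (σ P).2 = 0)) : CurveGood p f := by
  classical
  have hEf : ∀ n, ((curvePts p f n).filter E).card ≤ M := fun n => hE _ fun P hP => by
    rw [Finset.mem_filter, mem_curvePts] at hP
    exact ⟨hP.1.2, hP.2⟩
  have hEf' : ∀ n, ((curvePts p f' n).filter E').card ≤ M := fun n => hE' _ fun P hP => by
    rw [Finset.mem_filter, mem_curvePts] at hP
    exact ⟨hP.1.2, hP.2⟩
  have hQ : ∀ n, 1 ≤ p ^ (n / 2) := fun n => Nat.one_le_pow _ _ hp.out.pos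
  obtain ⟨⟨M0, hM0⟩, h⟩ := h
  refine ⟨⟨M0 + M, ?_⟩, fun A B D => ?_⟩
  · filter_upwards [hM0, hσ] with n h0 hσ
    have : (curvePts p f' n).card ≤ (curvePts p f n).card + M := by
      refine (Finset.card_le_card (t := (curvePts p f n).image σ ∪
        (curvePts p f' n).filter E') fun P hP => ?_).trans
        ((Finset.card_union_le _ _).trans (add_le_add Finset.card_image_le (hEf' n)))
      rw [Finset.mem_union, Finset.mem_filter, Finset.mem_image]
      by_cases hEP : E' P
      · exact Or.inr ⟨hP, hEP⟩
      · obtain ⟨P0, h1, -, h2⟩ := hσ.2.2 P hP hEP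
        exact Or.inl ⟨P0, h1, h2⟩
    nlinarith [hQ n]
  · obtain ⟨A', B', D', hF⟩ := hF A B D
    obtain ⟨M1, hM1⟩ := h A' B' D'
    refine ⟨M1 + 2 * M, ?_⟩
    filter_upwards [hM1, hσ, hF] with n h1 hσ hF
    have hneg : (curveNeg p f A B D n).card ≤ (curveNeg p f' A' B' D' n).card + M := by
      rw [← Finset.card_filter_add_card_filter_not (fun P => ¬ E P)]
      refine add_le_add ?_ ((Finset.card_le_card fun P hP => ?_).trans (hEf n))
      · refine Finset.card_le_card_of_injOn σ (fun P hP => ?_) (fun P hP P' hP' => ?_)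
        · rw [Finset.mem_coe, Finset.mem_filter, mem_curveNeg] at hP
          rw [Finset.mem_coe, mem_curveNeg, ← (hF P hP.1.1 hP.2).1]
          exact ⟨hσ.1 P hP.1.1 hP.2, hP.1.2⟩
        · rw [Finset.mem_coe, Finset.mem_filter, mem_curveNeg] at hP hP'
          exact hσ.2.1 P hP.1.1 P' hP'.1.1 hP.2 hP'.2
      · rw [Finset.mem_filter, not_not, mem_curveNeg] at hP
        exact Finset.mem_filter.2 ⟨hP.1.1, hP.2⟩
    have hpos : (curvePos p f' A' B' D' n).card ≤ (curvePos p f A B D n).card + M := by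
      refine (Finset.card_le_card (t := (curvePos p f A B D n).image σ ∪
        (curvePts p f' n).filter E') fun P hP => ?_).trans
        ((Finset.card_union_le _ _).trans (add_le_add Finset.card_image_le (hEf' n)))
      rw [mem_curvePos] at hP
      rw [Finset.mem_union, Finset.mem_filter, Finset.mem_image]
      by_cases hEP : E' P
      · exact Or.inr ⟨hP.1, hEP⟩
      · obtain ⟨P0, h1, h2, rfl⟩ := hσ.2.2 P hP.1 hEP
        refine Or.inl ⟨P0, ?_, rfl⟩
        rw [mem_curvePos, (hF P0 h1 h2).1, Ne, (hF P0 h1 h2).2]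
        exact ⟨h1, hP.2⟩
    nlinarith [hQ n]

end

section
variable {K : Type} [Field K]

theorem isot_smul {S : Finset K} {l : K} (hl : l ≠ 0) (a b d : K) :
    Isot S (l * a) (l * b) (l * d) ↔ Isot S a b d := by
  unfold Isot
  have : ∀ y z : K, l * a * y ^ 2 + l * b * y * z + l * d * z ^ 2 = 0 ↔
      a * y ^ 2 + b * y * z + d * z ^ 2 = 0 := by
    intro y z
    have e : l * a * y ^ 2 + l * b * y * z + l * d * z ^ 2 =
      l * (a * y ^ 2 + b * y * z + d * z ^ 2) := by ring
    rw [e, mul_eq_zero, or_iff_right hl]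
  simp only [this]

theorem map_evalRingHom_ne_zero {f : Polynomial (Polynomial K)} (hirr : Irreducible f)
    (hd : 0 < f.natDegree) (x : K) : f.map (Polynomial.evalRingHom x) ≠ 0 := by
  intro h
  have h1 : Polynomial.C (Polynomial.X - Polynomial.C x) ∣ f := by
    rw [Polynomial.C_dvd_iff_dvd_coeff]
    intro i
    rw [Polynomial.dvd_iff_isRoot, Polynomial.IsRoot.def, ← Polynomial.coe_evalRingHom,
      ← Polynomial.coeff_map, h, Polynomial.coeff_zero]
  obtain ⟨g, hg⟩ := h1
  rcases hirr.isUnit_or_isUnit hg with h2 | h2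
  · rw [Polynomial.isUnit_C] at h2
    exact Polynomial.not_isUnit_X_sub_C x h2
  · rw [hg, Polynomial.natDegree_C_mul (Polynomial.X_sub_C_ne_zero x),
      Polynomial.natDegree_eq_zero_of_isUnit h2] at hd
    exact lt_irrefl _ hd

theorem irreducible_integralNormalization {f : Polynomial (Polynomial K)} (hirr : Irreducible f)
    (hd : 0 < f.natDegree) : Irreducible f.integralNormalization := by
  have hm := Polynomial.monic_integralNormalization hirr.ne_zero
  let L := FractionRing (Polynomial K)
  rw [hm.irreducible_iff_irreducible_map_fraction_map (K := L)]
  have h := ((hirr.isPrimitive hd.ne').irreducible_iff_irreducible_map_fraction_map (K := L)).1 hirr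
  set c := algebraMap (Polynomial K) L f.leadingCoeff with hc
  have hc0 : c ≠ 0 := by
    rw [hc, Ne, map_eq_zero_iff _ (IsFractionRing.injective _ L), Polynomial.leadingCoeff_eq_zero]
    exact hirr.ne_zero
  let _ : Invertible c := invertibleOfNonzero hc0
  rw [← MulEquiv.irreducible_iff (Polynomial.algEquivCMulXAddC c 0)]
  have key : Polynomial.algEquivCMulXAddC c 0 (f.integralNormalization.map (algebraMap _ L)) =
      Polynomial.C (c ^ (f.natDegree - 1)) * f.map (algebraMap _ L) := by
    have := Polynomial.integralNormalization_eval₂_leadingCoeff_mul (p := f) hd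
      (Polynomial.C.comp (algebraMap (Polynomial K) L)) Polynomial.X
    simp only [Polynomial.algEquivCMulXAddC_apply, Polynomial.C_0, add_zero, Polynomial.aeval_def,
      Polynomial.eval₂_map]
    rw [RingHom.comp_apply, ← hc, ← Polynomial.C_pow] at this
    exact this
  rw [key, irreducible_isUnit_mul]
  · exact h
  · exact Polynomial.isUnit_C.2 (IsUnit.mk0 _ (pow_ne_zero _ hc0))

theorem derivative_integralNormalization_ne_zero [IsAlgClosed K] {f : Polynomial (Polynomial K)}
    (hder : f.derivative ≠ 0) : f.integralNormalization.derivative ≠ 0 := by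
  intro h
  apply hder
  ext1 i
  have h1 := congrArg (fun P => P.coeff i) h
  simp only [Polynomial.coeff_derivative, Polynomial.coeff_zero] at h1 ⊢
  have hd := natDegree_pos_of_derivative hder
  by_cases hi : i + 1 = f.natDegree
  · rw [hi, Polynomial.integralNormalization_coeff_natDegree (by rintro rfl; simp at hder),
      one_mul] at h1
    rw [h1, mul_zero]
  · rw [Polynomial.integralNormalization_coeff_ne_natDegree hi] at h1
    have : f.leadingCoeff ^ (f.natDegree - 1 - (i + 1)) ≠ 0 := by
      apply pow_ne_zero
      rw [Ne, Polynomial.leadingCoeff_eq_zero]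
      rintro rfl
      simp at hder
    have h2 : f.leadingCoeff ^ (f.natDegree - 1 - (i + 1)) *
      (f.coeff (i + 1) * ((i : Polynomial K) + 1)) = 0 := by linear_combination h1
    exact (mul_eq_zero.1 h2).resolve_left this

theorem evalEval_integralNormalization {f : Polynomial (Polynomial K)} (hd : 0 < f.natDegree)
    (x y : K) : f.integralNormalization.evalEval x (f.leadingCoeff.eval x * y) =
      f.leadingCoeff.eval x ^ (f.natDegree - 1) * f.evalEval x y := by
  have := Polynomial.integralNormalization_eval₂_leadingCoeff_mul (p := f) hd
      (Polynomial.evalRingHom x) y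
  simpa only [Polynomial.eval₂_evalRingHom, Polynomial.coe_evalRingHom] using this

theorem exists_evalEval_mul (c : Polynomial K) (A : Polynomial (Polynomial K)) :
    ∃ N0, ∀ N ≥ N0, ∃ A' : Polynomial (Polynomial K), ∀ x y,
      A'.evalEval x (c.eval x * y) = c.eval x ^ N * A.evalEval x y := by
  induction A using Polynomial.induction_on' with
  | add P Q hP hQ =>
    obtain ⟨N1, h1⟩ := hP
    obtain ⟨N2, h2⟩ := hQ
    refine ⟨max N1 N2, fun N hN => ?_⟩
    obtain ⟨A1, h1⟩ := h1 N ((le_max_left _ _).trans hN)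
    obtain ⟨A2, h2⟩ := h2 N ((le_max_right _ _).trans hN)
    refine ⟨A1 + A2, fun x y => ?_⟩
    rw [Polynomial.evalEval_add, Polynomial.evalEval_add, h1, h2, mul_add]
  | monomial k a =>
    refine ⟨k, fun N hN => ⟨Polynomial.monomial k (a * c ^ (N - k)), fun x y => ?_⟩⟩
    obtain ⟨m, rfl⟩ := Nat.exists_eq_add_of_le hN
    simp only [Polynomial.evalEval, Polynomial.eval_monomial, Polynomial.eval_mul,
      Polynomial.eval_pow, Polynomial.eval_C, Nat.add_sub_cancel_left]
    ring

variable {p : ℕ} [hp : Fact p.Prime] [CharP K p] [LocFin p K]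

theorem isot_pow {n : ℕ} (hn : 0 < n) (a b d : K) :
    Isot (Fs p K n) (a ^ p) (b ^ p) (d ^ p) ↔ Isot (Fs p K n) a b d := by
  have key : ∀ y z : K, a ^ p * (y ^ p) ^ 2 + b ^ p * y ^ p * z ^ p + d ^ p * (z ^ p) ^ 2 =
      (a * y ^ 2 + b * y * z + d * z ^ 2) ^ p := by
    intro y z
    rw [add_pow_char, add_pow_char]
    ring
  constructor
  · rintro ⟨y, hy, z, hz, h0, h⟩
    have hs : ∀ x ∈ Fs p K n, (x ^ p ^ (n - 1)) ^ p = x := by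
      intro x hx
      rw [← pow_mul, ← pow_succ, Nat.sub_add_cancel hn]
      exact (mem_Fs hn).1 hx
    refine ⟨_, Fs_pow_mem hn hy (p ^ (n - 1)), _, Fs_pow_mem hn hz (p ^ (n - 1)), ?_, ?_⟩
    · exact h0.imp (pow_ne_zero _) (pow_ne_zero _)
    · rw [← hs y hy, ← hs z hz, key] at h
      exact pow_eq_zero_iff hp.out.ne_zero |>.1 h
  · rintro ⟨y, hy, z, hz, h0, h⟩
    refine ⟨_, Fs_pow_mem hn hy p, _, Fs_pow_mem hn hz p, ?_, ?_⟩
    · exact h0.imp (pow_ne_zero _) (pow_ne_zero _)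
    · rw [key, h, zero_pow hp.out.ne_zero]

variable [IsAlgClosed K]

theorem curveGood_of_derivative {f : Polynomial (Polynomial K)} (hirr : Irreducible f)
    (hder : f.derivative ≠ 0) : CurveGood p f := by
  have hd := natDegree_pos_of_derivative hder
  have hm := Polynomial.monic_integralNormalization hirr.ne_zero
  have h := curveGood_of_monic (p := p) hm (irreducible_integralNormalization hirr hd)
    (derivative_integralNormalization_ne_zero hder)
  set c := f.leadingCoeff with hc
  have hc0 : c ≠ 0 := by rw [hc, Ne, Polynomial.leadingCoeff_eq_zero]; exact hirr.ne_zero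
  refine h.transfer (fun P => c.eval P.1 = 0) (fun P => c.eval P.1 = 0)
    (max (c.natDegree * f.natDegree) (c.natDegree * f.integralNormalization.natDegree))
    (fun T hT => (card_le_of_fst_root (map_evalRingHom_ne_zero hirr hd) hc0 T hT).trans
      (le_max_left _ _)) (fun T hT => (card_le_of_fst_root (fun _ => (hm.map _).ne_zero) hc0 T
        hT).trans (le_max_right _ _)) (fun P => (P.1, c.eval P.1 * P.2)) ?_ ?_
  · have hmem : ∀ᶠ n in divFilter, ∀ x ∈ Fs p K n, c.eval x ∈ Fs p K n := by
      filter_upwards [eventually_frobenius_eval (p := p) c, eventually_pos_divFilter] with n h hn x hx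
      rw [mem_Fs hn] at *
      rw [← h, hx]
    filter_upwards [hmem, eventually_pos_divFilter] with n hmem hn
    refine ⟨?_, ?_, ?_⟩
    · intro P hP hE
      rw [mem_curvePts] at *
      refine ⟨⟨hP.1.1, Fs_mul_mem hn (hmem _ hP.1.1) hP.1.2⟩, ?_⟩
      rw [evalEval_integralNormalization hd, hP.2, mul_zero]
    · rintro ⟨x, y⟩ hP ⟨x', y'⟩ hP' hE hE' hPP
      simp only [Prod.mk.injEq] at hPP hE
      obtain ⟨rfl, h2⟩ := hPP
      rw [mul_right_inj' hE] at h2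
      rw [h2]
    · rintro ⟨x, y⟩ hP hE
      simp only at hE
      rw [mem_curvePts] at hP
      obtain ⟨⟨hx, hy⟩, h0⟩ := hP
      have e : c.eval x * (y * (c.eval x)⁻¹) = y := by field_simp
      refine ⟨(x, y * (c.eval x)⁻¹), ?_, hE, ?_⟩
      · rw [mem_curvePts]
        refine ⟨⟨hx, Fs_mul_mem hn hy (Fs_inv_mem hn (hmem _ hx))⟩, ?_⟩
        rw [← e] at h0
        simp only at h0
        rw [evalEval_integralNormalization hd] at h0
        exact (mul_eq_zero.1 h0).resolve_left (pow_ne_zero _ hE)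
      · simp only [e]
  · intro A B D
    obtain ⟨N1, h1⟩ := exists_evalEval_mul c A
    obtain ⟨N2, h2⟩ := exists_evalEval_mul c B
    obtain ⟨N3, h3⟩ := exists_evalEval_mul c D
    obtain ⟨A', h1⟩ := h1 (N1 + N2 + N3) (by omega)
    obtain ⟨B', h2⟩ := h2 (N1 + N2 + N3) (by omega)
    obtain ⟨D', h3⟩ := h3 (N1 + N2 + N3) (by omega)
    refine ⟨A', B', D', Filter.Eventually.of_forall fun n P _ hE => ?_⟩
    have hl := pow_ne_zero (N1 + N2 + N3) hE
    simp only [evalEval_disc, h1, h2, h3]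
    refine ⟨(isot_smul hl _ _ _).symm, ?_⟩
    rw [← mul_right_inj' (pow_ne_zero 2 hl) (c := 0), mul_zero]
    ring_nf

theorem curveGood_of_expand {f : Polynomial (Polynomial K)}
    (h : CurveGood p f) : CurveGood p (Polynomial.expand (Polynomial K) p f) := by
  have hev : ∀ (x y : K), (Polynomial.expand (Polynomial K) p f).evalEval x y =
      f.evalEval x (y ^ p) := by
    intro x y
    rw [Polynomial.evalEval, Polynomial.expand_eval, ← Polynomial.C_pow]
  refine h.transfer (fun _ => False) (fun _ => False) 0 ?_ ?_ (fun P => (P.1, P.2 ^ p)) ?_ ?_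
  · intro T hT
    rw [Finset.eq_empty_of_forall_notMem fun P hP => (hT P hP).2, Finset.card_empty]
  · intro T hT
    rw [Finset.eq_empty_of_forall_notMem fun P hP => (hT P hP).2, Finset.card_empty]
  · filter_upwards [eventually_pos_divFilter] with n hn
    refine ⟨?_, ?_, ?_⟩
    · intro P hP _
      rw [mem_curvePts] at *
      exact ⟨⟨hP.1.1, Fs_pow_mem hn hP.1.2 p⟩, by rw [← hev]; exact hP.2⟩
    · rintro ⟨x, y⟩ hP ⟨x', y'⟩ hP' hE hE' hPP
      simp only [Prod.mk.injEq] at hPP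
      obtain ⟨rfl, h2⟩ := hPP
      rw [frobenius_inj K p h2]
    · rintro ⟨x, y⟩ hP hE
      rw [mem_curvePts] at hP
      obtain ⟨⟨hx, hy⟩, h0⟩ := hP
      have e : (y ^ p ^ (n - 1)) ^ p = y := by
        rw [← pow_mul, ← pow_succ, Nat.sub_add_cancel hn]
        exact (mem_Fs hn).1 hy
      refine ⟨(x, y ^ p ^ (n - 1)), ?_, hE, by simp only [e]⟩
      rw [mem_curvePts, hev]
      exact ⟨⟨hx, Fs_pow_mem hn hy _⟩, by simp only [e]; exact h0⟩
  · intro A B D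
    have hA : ∀ (A : Polynomial (Polynomial K)) (x y : K),
        (A.map (frobenius (Polynomial K) p)).evalEval x (y ^ p) = A.evalEval x y ^ p := by
      intro A x y
      induction A using Polynomial.induction_on' with
      | add P Q hP hQ =>
        rw [Polynomial.map_add, Polynomial.evalEval_add, Polynomial.evalEval_add, hP, hQ,
          add_pow_char]
      | monomial k a =>
        simp only [Polynomial.map_monomial, Polynomial.evalEval, Polynomial.eval_monomial,
          Polynomial.eval_mul, Polynomial.eval_pow, Polynomial.eval_C, frobenius_def]
        ring
    refine ⟨A.map (frobenius _ p), B.map (frobenius _ p), D.map (frobenius _ p), ?_⟩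
    filter_upwards [eventually_pos_divFilter] with n hn P _ _
    simp only [evalEval_disc, hA]
    refine ⟨(isot_pow hn _ _ _).symm, ?_⟩
    have h4 : (4 : K) ^ p = 4 := by
      have := map_ofNat (frobenius K p) 4
      rwa [frobenius_def] at this
    have : ∀ a b d : K, (b ^ p) ^ 2 - 4 * a ^ p * d ^ p = (b ^ 2 - 4 * a * d) ^ p := by
      intro a b d
      rw [sub_pow_char]
      nth_rewrite 1 [← h4]
      ring
    rw [this, pow_eq_zero_iff hp.out.ne_zero]

theorem curveGood_of_natDegree_eq_zero {f : Polynomial (Polynomial K)} (hirr : Irreducible f)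
    (hd : f.natDegree = 0) : CurveGood p f := by
  obtain ⟨g, rfl⟩ := Polynomial.natDegree_eq_zero.1 hd
  have hg : Irreducible g := by
    refine ⟨fun h => hirr.not_isUnit (Polynomial.isUnit_C.2 h), fun a b hab => ?_⟩
    have := hirr.isUnit_or_isUnit (a := Polynomial.C a) (b := Polynomial.C b)
      (by rw [hab, Polynomial.C_mul])
    simpa only [Polynomial.isUnit_C] using this
  have hg1 := IsAlgClosed.degree_eq_one_of_irreducible K hg
  obtain ⟨α, hα⟩ := Polynomial.exists_root_of_degree_eq_one hg1
  have hroot : ∀ x, g.eval x = 0 ↔ x = α := by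
    intro x
    refine ⟨fun hx => ?_, by rintro rfl; exact hα⟩
    have e := Polynomial.eq_X_add_C_of_degree_le_one hg1.le
    have ha : g.coeff 1 ≠ 0 := Polynomial.coeff_ne_zero_of_eq_degree hg1
    have h1 : g.eval α = 0 := hα
    rw [e] at hx h1
    simp only [Polynomial.eval_add, Polynomial.eval_mul, Polynomial.eval_C,
      Polynomial.eval_X] at hx h1
    exact mul_left_cancel₀ ha (by linear_combination hx - h1)
  have h := curveGood_of_monic (p := p) (K := K) Polynomial.monic_X Polynomial.irreducible_X
    (by rw [Polynomial.derivative_X]; exact one_ne_zero)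
  refine h.transfer (fun _ => False) (fun _ => False) 0 ?_ ?_ (fun P => (P.2, 0)) ?_ ?_
  · intro T hT
    rw [Finset.eq_empty_of_forall_notMem fun P hP => (hT P hP).2, Finset.card_empty]
  · intro T hT
    rw [Finset.eq_empty_of_forall_notMem fun P hP => (hT P hP).2, Finset.card_empty]
  · filter_upwards [eventually_pos_divFilter, eventually_mem_Fs (p := p) α] with n hn hαn
    simp only [mem_curvePts, Polynomial.evalEval_C, hroot, Polynomial.evalEval_X]
    refine ⟨fun P hP _ => ⟨⟨hP.1.2, Fs_zero_mem hn⟩, trivial⟩, ?_, ?_⟩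
    · rintro ⟨x, y⟩ ⟨-, h1⟩ ⟨x', y'⟩ ⟨-, h2⟩ - - h3
      simp only [Prod.mk.injEq] at *
      exact ⟨h1.trans h2.symm, h3.1⟩
    · rintro ⟨x, y⟩ ⟨⟨hx, -⟩, h1⟩ -
      exact ⟨(α, x), ⟨⟨hαn, hx⟩, rfl⟩, not_false, by simp only at h1; rw [h1]⟩
  · intro A B D
    have hA : ∀ (A : Polynomial (Polynomial K)) (y : K),
        (Polynomial.C (A.map (Polynomial.evalRingHom α))).evalEval y 0 = A.evalEval α y := by
      intro A y
      rw [Polynomial.evalEval_C, Polynomial.map_evalRingHom_eval]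
    refine ⟨Polynomial.C (A.map (Polynomial.evalRingHom α)),
      Polynomial.C (B.map (Polynomial.evalRingHom α)),
      Polynomial.C (D.map (Polynomial.evalRingHom α)), Filter.Eventually.of_forall ?_⟩
    rintro n ⟨x, y⟩ hP -
    rw [mem_curvePts] at hP
    have hx : x = α := by
      rw [← hroot]
      simpa only [Polynomial.evalEval_C] using hP.2
    subst hx
    simp only [evalEval_disc, hA]
    trivial

theorem curveGood_of_irreducible (d : ℕ) : ∀ f : Polynomial (Polynomial K), f.natDegree = d →
    Irreducible f → CurveGood p f := by
  induction d using Nat.strong_induction_on with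
  | _ d ih =>
    intro f hd hirr
    rcases Nat.eq_zero_or_pos d with h0 | h0
    · exact curveGood_of_natDegree_eq_zero hirr (hd.trans h0)
    by_cases hder : f.derivative = 0
    · have he := Polynomial.expand_contract p hder hp.out.ne_zero
      rw [← he] at hirr ⊢
      refine curveGood_of_expand (ih _ ?_ _ rfl (Polynomial.of_irreducible_expand
        hp.out.ne_zero hirr))
      rw [← he, Polynomial.natDegree_expand] at hd
      rw [← hd] at h0 ⊢
      exact lt_mul_of_one_lt_right (Nat.pos_of_mul_pos_right h0) hp.out.one_lt
    · exact curveGood_of_derivative hirr hder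

end

section
variable {K : Type} [Field K]

theorem exists_map_eq_C_mul {h : Polynomial (FractionRing (Polynomial K))} :
    ∃ b : Polynomial K, b ≠ 0 ∧ ∃ h' : Polynomial (Polynomial K),
      h'.map (algebraMap _ (FractionRing (Polynomial K))) =
        Polynomial.C (algebraMap _ (FractionRing (Polynomial K)) b) * h := by
  obtain ⟨b, hbm, hb⟩ := IsLocalization.integerNormalization_spec
    (nonZeroDivisors (Polynomial K)) h
  refine ⟨b, nonZeroDivisors.ne_zero hbm, _, hb.trans ?_⟩
  rw [← Polynomial.smul_eq_C_mul, algebraMap_smul]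

theorem card_common_zeros_le_of_not_dvd {f g : Polynomial (Polynomial K)} (hirr : Irreducible f)
    (hg : ¬ f ∣ g) : ∃ B : ℕ, ∀ T : Finset (K × K),
      (∀ P ∈ T, f.evalEval P.1 P.2 = 0 ∧ g.evalEval P.1 P.2 = 0) → T.card ≤ B := by
  classical
  rcases Nat.eq_zero_or_pos f.natDegree with hd | hd
  · obtain ⟨g0, rfl⟩ := Polynomial.natDegree_eq_zero.1 hd
    have hg0 : g0 ≠ 0 := by rintro rfl; exact hirr.ne_zero (Polynomial.C_0)
    have hirr0 : Irreducible g0 := by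
      refine ⟨fun h => hirr.not_isUnit (Polynomial.isUnit_C.2 h), fun a b hab => ?_⟩
      have := hirr.isUnit_or_isUnit (a := Polynomial.C a) (b := Polynomial.C b)
        (by rw [hab, Polynomial.C_mul])
      simpa only [Polynomial.isUnit_C] using this
    have hm : ∀ x, g0.eval x = 0 → g.map (Polynomial.evalRingHom x) ≠ 0 := by
      intro x hx h
      apply hg
      rw [Polynomial.C_dvd_iff_dvd_coeff]
      intro i
      have h1 : Polynomial.X - Polynomial.C x ∣ g0 := Polynomial.dvd_iff_isRoot.2 hx
      refine ((Polynomial.irreducible_X_sub_C x).associated_of_dvd hirr0 h1).symm.dvd.trans ?_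
      rw [Polynomial.dvd_iff_isRoot, Polynomial.IsRoot.def, ← Polynomial.coe_evalRingHom,
        ← Polynomial.coeff_map, h, Polynomial.coeff_zero]
    refine ⟨g0.natDegree * g.natDegree, fun T hT => ?_⟩
    calc T.card ≤ (g0.roots.toFinset.biUnion fun x =>
          (g.map (Polynomial.evalRingHom x)).roots.toFinset.image fun y => (x, y)).card := by
          apply Finset.card_le_card
          rintro ⟨x, y⟩ hP
          obtain ⟨h1, h2⟩ := hT _ hP
          simp only [Polynomial.evalEval_C] at h1
          simp only [Finset.mem_biUnion, Finset.mem_image, Multiset.mem_toFinset]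
          refine ⟨x, (Polynomial.mem_roots hg0).2 h1, y, ?_, rfl⟩
          rw [Polynomial.mem_roots (hm x h1), Polynomial.IsRoot.def, Polynomial.map_evalRingHom_eval]
          exact h2
      _ ≤ ∑ x ∈ g0.roots.toFinset, g.natDegree := by
          refine Finset.card_biUnion_le.trans (Finset.sum_le_sum fun x _ => ?_)
          exact Finset.card_image_le.trans ((Multiset.toFinset_card_le _).trans
            ((Polynomial.card_roots' _).trans Polynomial.natDegree_map_le))
      _ ≤ g0.natDegree * g.natDegree := by
          rw [Finset.sum_const, smul_eq_mul]
          exact Nat.mul_le_mul_right _ ((Multiset.toFinset_card_le _).trans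
            (Polynomial.card_roots' _))
  · let L := FractionRing (Polynomial K)
    have h := ((hirr.isPrimitive hd.ne').irreducible_iff_irreducible_map_fraction_map
      (K := L)).1 hirr
    have hinj : Function.Injective (Polynomial.map (algebraMap (Polynomial K) L)) :=
      Polynomial.map_injective _ (IsFractionRing.injective _ L)
    have hcop : IsCoprime (f.map (algebraMap _ L)) (g.map (algebraMap _ L)) := by
      rw [h.coprime_iff_not_dvd]
      rintro ⟨r, hr⟩
      obtain ⟨b, hb, r', hr'⟩ := exists_map_eq_C_mul (h := r)
      have e : Polynomial.C b * g = f * r' := by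
        apply hinj
        rw [Polynomial.map_mul, Polynomial.map_mul, Polynomial.map_C, hr, hr']
        ring
      rcases hirr.prime.dvd_or_dvd (Dvd.intro r' e.symm) with h1 | h1
      · have := Polynomial.natDegree_le_of_dvd h1 (Polynomial.C_ne_zero.2 hb)
        rw [Polynomial.natDegree_C] at this
        omega
      · exact hg h1
    obtain ⟨u, v, huv⟩ := hcop
    obtain ⟨b, hb, u', hu⟩ := exists_map_eq_C_mul (h := u)
    obtain ⟨c, hc, v', hv⟩ := exists_map_eq_C_mul (h := v)
    have e : Polynomial.C c * u' * f + Polynomial.C b * v' * g = Polynomial.C (b * c) := by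
      apply hinj
      simp only [Polynomial.map_add, Polynomial.map_mul, Polynomial.map_C, map_mul]
      linear_combination (Polynomial.C (algebraMap _ L b) * Polynomial.C (algebraMap _ L c)) * huv
        + (Polynomial.C (algebraMap _ L c) * f.map (algebraMap _ L)) * hu
        + (Polynomial.C (algebraMap _ L b) * g.map (algebraMap _ L)) * hv
    refine ⟨_, fun T hT => card_le_of_fst_root (map_evalRingHom_ne_zero hirr hd)
      (mul_ne_zero hb hc) T fun P hP => ⟨(hT P hP).1, ?_⟩⟩
    have := congrArg (fun F => F.evalEval P.1 P.2) e
    simp only [Polynomial.evalEval_add, Polynomial.evalEval_mul, (hT P hP).1, (hT P hP).2,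
      Polynomial.evalEval_C, mul_zero, add_zero] at this
    exact this.symm

variable {p : ℕ} [hp : Fact p.Prime] [CharP K p] [LocFin p K] [IsAlgClosed K]

theorem card_curvePts_ge_or (κ : Polynomial (Polynomial K)) :
    (∃ M : ℕ, ∀ᶠ n in divFilter, p ^ n ≤ (curvePts p κ n).card + M * p ^ (n / 2)) ∨
      ∃ c ≠ 0, ∀ x y, κ.evalEval x y = c := by
  by_cases h0 : κ = 0
  · left
    refine ⟨0, ?_⟩
    filter_upwards [eventually_pos_divFilter] with n hn
    rw [zero_mul, add_zero, ← card_Fs (p := p) (K := K) hn]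
    refine Finset.card_le_card_of_injOn (fun x => (x, 0)) ?_ ?_
    · intro x hx
      simp [mem_curvePts, h0, Fs_zero_mem hn, Finset.mem_coe.1 hx]
    · intro x _ y _ h
      exact (Prod.mk.inj h).1
  by_cases hu : IsUnit κ
  · right
    obtain ⟨r, hr, rfl⟩ := Polynomial.isUnit_iff.1 hu
    obtain ⟨c, hc, rfl⟩ := Polynomial.isUnit_iff.1 hr
    exact ⟨c, hc.ne_zero, fun x y => by rw [Polynomial.evalEval_C, Polynomial.eval_C]⟩
  · left
    obtain ⟨f, hf, g, rfl⟩ := WfDvdMonoid.exists_irreducible_factor hu h0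
    obtain ⟨M, hM⟩ := (curveGood_of_irreducible (p := p) _ f rfl hf).1
    refine ⟨M, hM.mono fun n h => h.trans (Nat.add_le_add_right (Finset.card_le_card ?_) _)⟩
    intro P hP
    rw [mem_curvePts] at *
    exact ⟨hP.1, by rw [Polynomial.evalEval_mul, hP.2, zero_mul]⟩

open scoped Classical in
theorem card_filter_union_le {α : Type} [DecidableEq α] {V U W : Finset α} (hV : V = U ∪ W) (Good Bad : α → Prop)
    {m1 m2 b : ℕ} (h1 : (U.filter Bad).card ≤ (U.filter Good).card + m1)
    (h2 : (W.filter Bad).card ≤ (W.filter Good).card + m2) (hb : (U ∩ W).card ≤ b) :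
    (V.filter Bad).card ≤ (V.filter Good).card + (m2 + m1 + b) := by
  rw [hV, Finset.filter_union, Finset.filter_union]
  have e1 := Finset.card_union_le (U.filter Bad) (W.filter Bad)
  have e2 := Finset.card_union_add_card_inter (U.filter Good) (W.filter Good)
  have e3 := Finset.card_le_card (Finset.inter_subset_inter (Finset.filter_subset Good U)
    (Finset.filter_subset Good W))
  omega

open scoped Classical in
theorem card_bad_le_card_good_of_irreducible {ι : Type} (A B D : ι → Polynomial (Polynomial K))
    (Z : K × K → Prop) (Good Bad : ℕ → K × K → Prop)
    (hgood : ∀ᶠ n in divFilter, ∀ P : K × K, P.1 ∈ Fs p K n → P.2 ∈ Fs p K n → Z P → ∀ i,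
      (B i ^ 2 - 4 * A i * D i : Polynomial (Polynomial K)).evalEval P.1 P.2 ≠ 0 →
      Isot (Fs p K n) ((A i).evalEval P.1 P.2) ((B i).evalEval P.1 P.2) ((D i).evalEval P.1 P.2) →
      Good n P)
    (hgb : ∀ n P, Good n P → ¬ Bad n P)
    (hbad : ∀ᶠ n in divFilter, ∀ P : K × K, P.1 ∈ Fs p K n → P.2 ∈ Fs p K n → Z P →
      (∀ i, (B i ^ 2 - 4 * A i * D i : Polynomial (Polynomial K)).evalEval P.1 P.2 = 0) →
      ¬ Bad n P)
    {π : Polynomial (Polynomial K)} (hπ : Irreducible π)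
    (hZπ : ∀ P : K × K, π.evalEval P.1 P.2 = 0 → Z P) :
    ∃ M : ℕ, ∀ᶠ n in divFilter, ((curvePts p π n).filter (Bad n)).card ≤
      ((curvePts p π n).filter (Good n)).card + M * p ^ (n / 2) := by
  by_cases hall : ∀ i, π ∣ B i ^ 2 - 4 * A i * D i
  · refine ⟨0, hbad.mono fun n hn => ?_⟩
    rw [Finset.card_eq_zero.2]
    · exact Nat.zero_le _
    · rw [Finset.filter_eq_empty_iff]
      intro P hP
      rw [mem_curvePts] at hP
      refine hn P hP.1.1 hP.1.2 (hZπ P hP.2) fun i => ?_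
      obtain ⟨g, hg⟩ := hall i
      rw [hg, Polynomial.evalEval_mul, hP.2, zero_mul]
  · push Not at hall
    obtain ⟨i, hi⟩ := hall
    obtain ⟨M, hM⟩ := (curveGood_of_irreducible (p := p) _ π rfl hπ).2 (A i) (B i) (D i)
    obtain ⟨b, hb⟩ := card_common_zeros_le_of_not_dvd hπ hi
    refine ⟨M + b, ?_⟩
    filter_upwards [hgood, hM] with n hg hM
    have hsub : (curvePts p π n).filter (Bad n) ⊆ curveNeg p π (A i) (B i) (D i) n ∪
        (curvePts p π n).filter (fun P => (B i ^ 2 - 4 * A i * D i :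
          Polynomial (Polynomial K)).evalEval P.1 P.2 = 0) := by
      intro P hP
      rw [Finset.mem_filter] at hP
      rw [Finset.mem_union, Finset.mem_filter, mem_curveNeg]
      have hP' := mem_curvePts.1 hP.1
      by_cases hd : (B i ^ 2 - 4 * A i * D i : Polynomial (Polynomial K)).evalEval P.1 P.2 = 0
      · exact Or.inr ⟨hP.1, hd⟩
      · exact Or.inl ⟨hP.1, fun hI => hgb n P
          (hg P hP'.1.1 hP'.1.2 (hZπ P hP'.2) i hd hI) hP.2⟩
    have hsub2 : curvePos p π (A i) (B i) (D i) n ⊆ (curvePts p π n).filter (Good n) := by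
      intro P hP
      rw [mem_curvePos] at hP
      have hP' := mem_curvePts.1 hP.1
      rw [Finset.mem_filter]
      exact ⟨hP.1, hg P hP'.1.1 hP'.1.2 (hZπ P hP'.2) i hP.2.2 hP.2.1⟩
    have e1 := (Finset.card_le_card hsub).trans (Finset.card_union_le _ _)
    have e2 := Finset.card_le_card hsub2
    have e3 := hb ((curvePts p π n).filter (fun P => (B i ^ 2 - 4 * A i * D i :
          Polynomial (Polynomial K)).evalEval P.1 P.2 = 0)) (fun P hP => by
      rw [Finset.mem_filter, mem_curvePts] at hP
      exact ⟨hP.1.2, hP.2⟩)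
    have e4 : b ≤ b * p ^ (n / 2) := Nat.le_mul_of_pos_right _ (pow_pos hp.out.pos _)
    rw [add_mul]
    omega

open scoped Classical in
theorem card_bad_le_card_good {ι : Type} (A B D : ι → Polynomial (Polynomial K))
    (Z : K × K → Prop) (Good Bad : ℕ → K × K → Prop)
    (hgood : ∀ᶠ n in divFilter, ∀ P : K × K, P.1 ∈ Fs p K n → P.2 ∈ Fs p K n → Z P → ∀ i,
      (B i ^ 2 - 4 * A i * D i : Polynomial (Polynomial K)).evalEval P.1 P.2 ≠ 0 →
      Isot (Fs p K n) ((A i).evalEval P.1 P.2) ((B i).evalEval P.1 P.2) ((D i).evalEval P.1 P.2) →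
      Good n P)
    (hgb : ∀ n P, Good n P → ¬ Bad n P)
    (hbad : ∀ᶠ n in divFilter, ∀ P : K × K, P.1 ∈ Fs p K n → P.2 ∈ Fs p K n → Z P →
      (∀ i, (B i ^ 2 - 4 * A i * D i : Polynomial (Polynomial K)).evalEval P.1 P.2 = 0) →
      ¬ Bad n P)
    {δ : Polynomial (Polynomial K)} (hδ : δ ≠ 0) (hZ : ∀ P : K × K, δ.evalEval P.1 P.2 = 0 → Z P) :
    ∃ M : ℕ, ∀ᶠ n in divFilter, ((curvePts p δ n).filter (Bad n)).card ≤
      ((curvePts p δ n).filter (Good n)).card + M * p ^ (n / 2) := by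
  induction δ using WfDvdMonoid.induction_on_irreducible with
  | zero => exact absurd rfl hδ
  | unit u hu =>
    obtain ⟨r, hr, rfl⟩ := Polynomial.isUnit_iff.1 hu
    obtain ⟨c, hc, rfl⟩ := Polynomial.isUnit_iff.1 hr
    refine ⟨0, Filter.Eventually.of_forall fun n => ?_⟩
    rw [Finset.card_eq_zero.2]
    · exact Nat.zero_le _
    · ext P
      simp [mem_curvePts, Polynomial.evalEval_C, hc.ne_zero]
  | mul δ' π h0 hπ ih =>
    obtain ⟨M1, h1⟩ := ih h0 fun P hP => hZ P (by rw [Polynomial.evalEval_mul, hP, mul_zero])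
    by_cases hdvd : π ∣ δ'
    · have : ∀ n, curvePts p (π * δ') n = curvePts p δ' n := by
        intro n
        obtain ⟨g, rfl⟩ := hdvd
        ext P
        simp only [mem_curvePts, Polynomial.evalEval_mul, mul_eq_zero, ← or_assoc, or_self]
      exact ⟨M1, by simpa only [this] using h1⟩
    have hZπ : ∀ P : K × K, π.evalEval P.1 P.2 = 0 → Z P := fun P hP =>
      hZ P (by rw [Polynomial.evalEval_mul, hP, zero_mul])
    obtain ⟨M2, h2⟩ : ∃ M : ℕ, ∀ᶠ n in divFilter, ((curvePts p π n).filter (Bad n)).card ≤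
        ((curvePts p π n).filter (Good n)).card + M * p ^ (n / 2) :=
      card_bad_le_card_good_of_irreducible A B D Z Good Bad hgood hgb hbad hπ hZπ
    obtain ⟨b, hb⟩ := card_common_zeros_le_of_not_dvd hπ hdvd
    refine ⟨M1 + M2 + b, ?_⟩
    filter_upwards [h1, h2] with n h1 h2
    have hun : curvePts p (π * δ') n = curvePts p π n ∪ curvePts p δ' n := by
      ext P
      simp only [mem_curvePts, Polynomial.evalEval_mul, mul_eq_zero, Finset.mem_union, and_or_left]
    refine (card_filter_union_le hun (Good n) (Bad n) h2 h1 (hb _ fun P hP => ?_)).trans ?_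
    · rw [Finset.mem_inter, mem_curvePts, mem_curvePts] at hP
      exact ⟨hP.1.2, hP.2.2⟩
    · have e4 : b ≤ b * p ^ (n / 2) := Nat.le_mul_of_pos_right _ (pow_pos hp.out.pos _)
      rw [add_mul, add_mul]
      omega

end

open scoped Classical in
/-- The number of zeros with coordinates in `S` of a ternary quadratic form. -/
noncomputable def conicCount {F : Type} [Field F] (S : Finset F) (a b d f g h : F) : ℕ :=
  ((S ×ˢ S ×ˢ S).filter fun u : F × F × F => a * u.1 ^ 2 + b * u.1 * u.2.1 + d * u.2.1 ^ 2 +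
    f * u.1 * u.2.2 + g * u.2.1 * u.2.2 + h * u.2.2 ^ 2 = 0).card

/-- The half-discriminant of a ternary quadratic form. -/
def conicDisc {F : Type} [CommRing F] (a b d f g h : F) : F :=
  4 * a * d * h + b * f * g - a * g ^ 2 - d * f ^ 2 - h * b ^ 2

section
variable {F : Type} [Field F]

theorem conicCount_swap (S : Finset F) (a b d f g h : F) :
    conicCount S a b d f g h = conicCount S a f h b g d := by
  classical
  refine Finset.card_bij' (fun u _ => (u.1, u.2.2, u.2.1)) (fun u _ => (u.1, u.2.2, u.2.1))
    ?_ ?_ (fun _ _ => rfl) (fun _ _ => rfl)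
  all_goals
    rintro ⟨y, z, t⟩ hu
    simp only [Finset.mem_filter, Finset.mem_product] at hu ⊢
    exact ⟨⟨hu.1.1, hu.1.2.2, hu.1.2.1⟩, by linear_combination hu.2⟩

theorem conicCount_rotate (S : Finset F) (a b d f g h : F) :
    conicCount S a b d f g h = conicCount S d g h b f a := by
  classical
  refine Finset.card_bij' (fun u _ => (u.2.1, u.2.2, u.1)) (fun u _ => (u.2.2, u.1, u.2.1))
    ?_ ?_ (fun _ _ => rfl) (fun _ _ => rfl)
  · rintro ⟨y, z, t⟩ hu
    simp only [Finset.mem_filter, Finset.mem_product] at hu ⊢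
    exact ⟨⟨hu.1.2.1, hu.1.2.2, hu.1.1⟩, by linear_combination hu.2⟩
  · rintro ⟨y, z, t⟩ hu
    simp only [Finset.mem_filter, Finset.mem_product] at hu ⊢
    exact ⟨⟨hu.1.2.2, hu.1.1, hu.1.2.1⟩, by linear_combination hu.2⟩

variable [Fintype F]

theorem card_ker_mul {V : Type} [AddCommGroup V] [Module F V] [Finite V] (φ : V →ₗ[F] F) :
    Nat.card V ≤ Nat.card (LinearMap.ker φ) * Fintype.card F ∧
      (φ ≠ 0 → Nat.card (LinearMap.ker φ) * Fintype.card F = Nat.card V) := by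
  have : Module.Finite F V := Module.Finite.of_finite
  have h1 := LinearMap.finrank_range_add_finrank_ker φ
  have h2 : Module.finrank F (LinearMap.range φ) ≤ 1 := by
    simpa using Submodule.finrank_le (LinearMap.range φ)
  have h3 := Module.natCard_eq_pow_finrank (K := F) (V := V)
  have h4 := Module.natCard_eq_pow_finrank (K := F) (V := LinearMap.ker φ)
  rw [Nat.card_eq_fintype_card (α := F)] at h3 h4
  constructor
  · rw [h3, h4, ← pow_succ]
    exact Nat.pow_le_pow_right Fintype.card_pos (by omega)
  · intro hφ
    have h5 := LinearMap.range_eq_top.2 (LinearMap.surjective hφ)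
    rw [h5, finrank_top, Module.finrank_self] at h1
    rw [h3, h4, ← pow_succ, add_comm 1] at *
    rw [h1]

theorem card_linear_zeros (l m n : F) [DecidableEq F] :
    Fintype.card F ^ 2 ≤
      (Finset.univ.filter fun u : F × F × F => l * u.1 + m * u.2.1 + n * u.2.2 = 0).card ∧
    ((l ≠ 0 ∨ m ≠ 0 ∨ n ≠ 0) →
      (Finset.univ.filter fun u : F × F × F => l * u.1 + m * u.2.1 + n * u.2.2 = 0).card =
        Fintype.card F ^ 2) := by
  let φ : (F × F × F) →ₗ[F] F :=
    l • LinearMap.fst F F (F × F) + m • (LinearMap.fst F F F ∘ₗ LinearMap.snd F F (F × F)) +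
      n • (LinearMap.snd F F F ∘ₗ LinearMap.snd F F (F × F))
  have hφ : ∀ u, φ u = l * u.1 + m * u.2.1 + n * u.2.2 := fun u => rfl
  have hk : Nat.card (LinearMap.ker φ) =
      (Finset.univ.filter fun u : F × F × F => l * u.1 + m * u.2.1 + n * u.2.2 = 0).card := by
    rw [← Fintype.card_subtype, ← Nat.card_eq_fintype_card]
    exact Nat.card_congr (Equiv.subtypeEquivRight fun u => by rw [LinearMap.mem_ker, hφ])
  have hV : Nat.card (F × F × F) = Fintype.card F ^ 2 * Fintype.card F := by
    rw [Nat.card_eq_fintype_card, Fintype.card_prod, Fintype.card_prod]; ring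
  obtain ⟨h1, h2⟩ := card_ker_mul φ
  rw [hk, hV] at h1 h2
  refine ⟨Nat.le_of_mul_le_mul_right h1 Fintype.card_pos, fun h => ?_⟩
  refine Nat.eq_of_mul_eq_mul_right Fintype.card_pos (h2 ?_)
  intro h0
  have e1 := hφ (1, 0, 0)
  have e2 := hφ (0, 1, 0)
  have e3 := hφ (0, 0, 1)
  rw [h0] at e1 e2 e3
  simp at e1 e2 e3
  simp [← e1, ← e2, ← e3] at h

theorem exists_conic_zero (a b d f g h : F) : ∃ y z t : F, (y ≠ 0 ∨ z ≠ 0 ∨ t ≠ 0) ∧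
    a * y ^ 2 + b * y * z + d * z ^ 2 + f * y * t + g * z * t + h * t ^ 2 = 0 := by
  classical
  obtain ⟨p, hp⟩ := CharP.exists F
  have hpp : p.Prime := CharP.char_is_prime F p
  let P : MvPolynomial (Fin 3) F := C a * X 0 ^ 2 + C b * X 0 * X 1 + C d * X 1 ^ 2 +
    C f * X 0 * X 2 + C g * X 1 * X 2 + C h * X 2 ^ 2
  have hP : P.IsHomogeneous 2 := by
    refine ((((IsHomogeneous.add ?_ ?_).add ?_).add ?_).add ?_).add ?_
    · exact (isHomogeneous_C _ a).mul ((isHomogeneous_X F 0).pow 2)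
    · exact ((isHomogeneous_C _ b).mul (isHomogeneous_X F 0)).mul (isHomogeneous_X F 1)
    · exact (isHomogeneous_C _ d).mul ((isHomogeneous_X F 1).pow 2)
    · exact ((isHomogeneous_C _ f).mul (isHomogeneous_X F 0)).mul (isHomogeneous_X F 2)
    · exact ((isHomogeneous_C _ g).mul (isHomogeneous_X F 1)).mul (isHomogeneous_X F 2)
    · exact (isHomogeneous_C _ h).mul ((isHomogeneous_X F 2).pow 2)
  have hdvd := char_dvd_card_solutions p (f := P)
    (hP.totalDegree_le.trans_lt (by rw [Fintype.card_fin]; norm_num))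
  have h0 : eval (0 : Fin 3 → F) P = 0 := by simp [P]
  have h1 : 1 < Fintype.card {x : Fin 3 → F // eval x P = 0} := by
    have : 0 < Fintype.card {x : Fin 3 → F // eval x P = 0} := Fintype.card_pos_iff.2 ⟨⟨0, h0⟩⟩
    exact hpp.one_lt.trans_le (Nat.le_of_dvd this hdvd)
  obtain ⟨⟨x, hx⟩, hne⟩ := Fintype.exists_ne_of_one_lt_card h1 ⟨0, h0⟩
  refine ⟨x 0, x 1, x 2, ?_, by simpa [P] using hx⟩
  by_contra! hc
  apply hne
  rw [Subtype.mk.injEq]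
  funext i
  fin_cases i
  exacts [hc.1, hc.2.1, hc.2.2]

/-- The zeros of a ternary quadratic form off the polar of a zero which is not a vertex. -/
theorem card_off_polar {a b d f g h y z t : F} [DecidableEq F]
    (h0 : a * y ^ 2 + b * y * z + d * z ^ 2 + f * y * t + g * z * t + h * t ^ 2 = 0)
    (hv : 2 * a * y + b * z + f * t ≠ 0 ∨ b * y + 2 * d * z + g * t ≠ 0 ∨
      f * y + g * z + 2 * h * t ≠ 0) :
    Fintype.card F ^ 2 ≤ (Finset.univ.filter fun u : F × F × F =>
      a * u.1 ^ 2 + b * u.1 * u.2.1 + d * u.2.1 ^ 2 +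
        f * u.1 * u.2.2 + g * u.2.1 * u.2.2 + h * u.2.2 ^ 2 = 0 ∧
      (2 * a * y + b * z + f * t) * u.1 + (b * y + 2 * d * z + g * t) * u.2.1 +
        (f * y + g * z + 2 * h * t) * u.2.2 ≠ 0).card + Fintype.card F := by
  set l := 2 * a * y + b * z + f * t with hl
  set m := b * y + 2 * d * z + g * t with hm
  set k := f * y + g * z + 2 * h * t with hk
  have hlin := (card_linear_zeros l m k).2 hv
  have hpol : l * y + m * z + k * t = 0 := by rw [hl, hm, hk]; linear_combination 2 * h0
  let Z := Finset.univ.filter fun u : F × F × F =>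
      a * u.1 ^ 2 + b * u.1 * u.2.1 + d * u.2.1 ^ 2 +
        f * u.1 * u.2.2 + g * u.2.1 * u.2.2 + h * u.2.2 ^ 2 = 0 ∧
      l * u.1 + m * u.2.1 + k * u.2.2 ≠ 0
  let U := Finset.univ.filter fun u : F × F × F => l * u.1 + m * u.2.1 + k * u.2.2 ≠ 0
  have hU : U.card + Fintype.card F ^ 2 = Fintype.card F ^ 3 := by
    have := Finset.card_filter_add_card_filter_not (s := (Finset.univ : Finset (F × F × F)))
      (fun u : F × F × F => l * u.1 + m * u.2.1 + k * u.2.2 = 0)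
    rw [hlin, Finset.card_univ, Fintype.card_prod, Fintype.card_prod] at this
    rw [add_comm, this]
    ring
  have hle : U.card ≤ Z.card * Fintype.card F := by
    rw [← Finset.card_univ, ← Finset.card_product]
    refine Finset.card_le_card_of_injOn (fun u =>
      let s := -(a * u.1 ^ 2 + b * u.1 * u.2.1 + d * u.2.1 ^ 2 +
        f * u.1 * u.2.2 + g * u.2.1 * u.2.2 + h * u.2.2 ^ 2) / (l * u.1 + m * u.2.1 + k * u.2.2)
      ((u.1 + s * y, u.2.1 + s * z, u.2.2 + s * t), s)) ?_ ?_
    · rintro ⟨u, v, w⟩ hu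
      simp only [U, Finset.coe_filter, Finset.mem_univ, true_and, Set.mem_ofPred_eq] at hu
      simp only [Finset.coe_product, Set.mem_prod, Finset.coe_univ, Set.mem_univ, and_true, Z,
        Finset.coe_filter, Finset.mem_univ, true_and, Set.mem_ofPred_eq]
      set s := -(a * u ^ 2 + b * u * v + d * v ^ 2 + f * u * w + g * v * w + h * w ^ 2) /
        (l * u + m * v + k * w) with hs
      have e : s * (l * u + m * v + k * w) =
        -(a * u ^ 2 + b * u * v + d * v ^ 2 + f * u * w + g * v * w + h * w ^ 2) := by
        rw [hs, div_mul_cancel₀ _ hu]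
      constructor
      · rw [hl, hm, hk] at e
        linear_combination e + s ^ 2 * h0
      · intro h
        apply hu
        linear_combination h - s * hpol
    · rintro ⟨u, v, w⟩ hu ⟨u', v', w'⟩ hu' he
      simp only [Prod.mk.injEq] at he
      obtain ⟨⟨h1, h2, h3⟩, h4⟩ := he
      rw [h4] at h1 h2 h3
      rw [add_right_cancel h1, add_right_cancel h2, add_right_cancel h3]
  have hq : 0 < Fintype.card F := Fintype.card_pos
  change Fintype.card F ^ 2 ≤ Z.card + Fintype.card F
  refine Nat.le_of_mul_le_mul_right ?_ hq
  nlinarith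

theorem le_conicCount (a b d f g h : F) :
    Fintype.card F ≤ conicCount Finset.univ a b d f g h := by
  classical
  obtain ⟨y, z, t, hne, h0⟩ := exists_conic_zero a b d f g h
  rw [← Finset.card_univ]
  refine Finset.card_le_card_of_injOn (fun s => (s * y, s * z, s * t)) ?_ ?_
  · intro s _
    simp only [Finset.coe_filter, Finset.mem_product, Finset.mem_univ, true_and, and_true,
      Set.mem_ofPred_eq]
    linear_combination s ^ 2 * h0
  · intro s _ s' _ h
    simp only [Prod.mk.injEq] at h
    rcases hne with h1 | h1 | h1
    exacts [mul_right_cancel₀ h1 h.1, mul_right_cancel₀ h1 h.2.1, mul_right_cancel₀ h1 h.2.2]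

theorem sq_le_conicCount_of_disc_ne_zero {a b d f g h : F} (hδ : conicDisc a b d f g h ≠ 0) :
    Fintype.card F ^ 2 ≤ conicCount Finset.univ a b d f g h := by
  classical
  obtain ⟨y, z, t, hne, h0⟩ := exists_conic_zero a b d f g h
  have hv : 2 * a * y + b * z + f * t ≠ 0 ∨ b * y + 2 * d * z + g * t ≠ 0 ∨
      f * y + g * z + 2 * h * t ≠ 0 := by
    by_contra! hc
    obtain ⟨e1, e2, e3⟩ := hc
    have key : conicDisc a b d f g h * t ^ 2 = 0 ∧ conicDisc a b d f g h * z ^ 2 = 0 ∧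
        conicDisc a b d f g h * y ^ 2 = 0 := by
      unfold conicDisc
      refine ⟨?_, ?_, ?_⟩
      · linear_combination (4 * a * d - b ^ 2) * h0 -
          d * (2 * a * y + b * z + f * t) * e1 + b * (2 * a * y + b * z + f * t) * e2 -
          a * (b * y + 2 * d * z + g * t) * e2
      · linear_combination (4 * a * h - f ^ 2) * h0 -
          h * (2 * a * y + b * z + f * t) * e1 + f * (2 * a * y + b * z + f * t) * e3 -
          a * (f * y + g * z + 2 * h * t) * e3
      · linear_combination (4 * d * h - g ^ 2) * h0 -
          h * (b * y + 2 * d * z + g * t) * e2 + g * (b * y + 2 * d * z + g * t) * e3 -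
          d * (f * y + g * z + 2 * h * t) * e3
    simp only [mul_eq_zero, hδ, false_or, pow_eq_zero_iff two_ne_zero] at key
    simp [key] at hne
  have h1 := card_off_polar h0 hv
  refine h1.trans ?_
  rw [← Finset.card_univ, ← Finset.card_image_of_injective (s := Finset.univ)
    (f := fun s : F => (s * y, s * z, s * t)), ← Finset.card_union_of_disjoint]
  · apply Finset.card_le_card
    intro u hu
    simp only [Finset.mem_union, Finset.mem_filter, Finset.mem_univ, true_and,
      Finset.mem_image] at hu
    simp only [Finset.mem_filter, Finset.mem_product, Finset.mem_univ, true_and]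
    rcases hu with hu | ⟨s, rfl⟩
    · exact hu.1
    · linear_combination s ^ 2 * h0
  · rw [Finset.disjoint_left]
    rintro u hu hu'
    simp only [Finset.mem_filter, Finset.mem_univ, true_and, Finset.mem_image] at hu hu'
    obtain ⟨s, rfl⟩ := hu'
    apply hu.2
    linear_combination 2 * s * h0
  · intro s s' h
    simp only [Prod.mk.injEq] at h
    rcases hne with h1 | h1 | h1
    exacts [mul_right_cancel₀ h1 h.1, mul_right_cancel₀ h1 h.2.1, mul_right_cancel₀ h1 h.2.2]

theorem le_conicCount_of_isot {a b d f g h : F} (hδ : conicDisc a b d f g h = 0)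
    (hd : b ^ 2 - 4 * a * d ≠ 0) (hi : Isot Finset.univ a b d) :
    2 * Fintype.card F ^ 2 ≤ conicCount Finset.univ a b d f g h + Fintype.card F := by
  classical
  obtain ⟨y, -, z, -, hne, h0⟩ := hi
  have hv : 2 * a * y + b * z + f * 0 ≠ 0 ∨ b * y + 2 * d * z + g * 0 ≠ 0 ∨
      f * y + g * z + 2 * h * 0 ≠ 0 := by
    by_contra! hc
    obtain ⟨e1, e2, -⟩ := hc
    have k1 : (b ^ 2 - 4 * a * d) * y = 0 := by linear_combination b * e2 - 2 * d * e1
    have k2 : (b ^ 2 - 4 * a * d) * z = 0 := by linear_combination b * e1 - 2 * a * e2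
    simp [(mul_eq_zero.1 k1).resolve_left hd, (mul_eq_zero.1 k2).resolve_left hd] at hne
  have h1 := card_off_polar (a := a) (b := b) (d := d) (f := f) (g := g) (h := h) (y := y) (z := z)
    (t := 0) (by linear_combination h0) hv
  have h2 := (card_linear_zeros (2 * a * y + b * z + f * 0) (b * y + 2 * d * z + g * 0)
    (f * y + g * z + 2 * h * 0)).1
  rw [two_mul]
  refine (add_le_add h1 h2).trans ?_
  rw [add_right_comm]
  refine Nat.add_le_add_right ?_ _
  rw [← Finset.card_union_of_disjoint]
  · apply Finset.card_le_card
    rintro ⟨u, v, w⟩ hu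
    simp only [Finset.mem_filter, Finset.mem_product, Finset.mem_univ, true_and]
    rw [Finset.mem_union] at hu
    rcases hu with hu | hu
    · exact (Finset.mem_filter.1 hu).2.1
    · have e := (Finset.mem_filter.1 hu).2
      simp only at e
      have e' : y * (2 * a * u + b * v + f * w) + z * (b * u + 2 * d * v + g * w) = 0 := by
        linear_combination e
      obtain ⟨κ, k1, k2⟩ : ∃ κ, 2 * a * u + b * v + f * w = κ * z ∧
          b * u + 2 * d * v + g * w = - κ * y := by
        rcases hne with hy | hz
        · refine ⟨-(b * u + 2 * d * v + g * w) / y, ?_, ?_⟩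
          · field_simp; linear_combination e'
          · field_simp
        · refine ⟨(2 * a * u + b * v + f * w) / z, ?_, ?_⟩
          · field_simp
          · field_simp; linear_combination e'
      have hd' : 4 * a * d - b ^ 2 ≠ 0 := by rw [← neg_ne_zero, neg_sub]; exact hd
      refine (mul_eq_zero.1 (?_ : (4 * a * d - b ^ 2) * _ = 0)).resolve_left hd'
      unfold conicDisc at hδ
      have e3 : d * (2 * a * u + b * v + f * w) ^ 2 - b * (2 * a * u + b * v + f * w) *
          (b * u + 2 * d * v + g * w) + a * (b * u + 2 * d * v + g * w) ^ 2 = 0 := by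
        rw [k1, k2]; linear_combination κ ^ 2 * h0
      linear_combination e3 + w ^ 2 * hδ
  · rw [Finset.disjoint_left]
    intro u hu hu'
    exact (Finset.mem_filter.1 hu).2.2 (Finset.mem_filter.1 hu').2

theorem sq_le_conicCount_of_disc_eq_zero {a b d f g h : F} (hδ : conicDisc a b d f g h = 0)
    (h1 : b ^ 2 - 4 * a * d = 0) (h2 : f ^ 2 - 4 * a * h = 0) (h3 : g ^ 2 - 4 * d * h = 0) :
    Fintype.card F ^ 2 ≤ conicCount Finset.univ a b d f g h := by
  classical
  obtain ⟨l, m, k, hlin⟩ : ∃ l m k : F, ∀ y z t, l * y + m * z + k * t = 0 →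
      a * y ^ 2 + b * y * z + d * z ^ 2 + f * y * t + g * z * t + h * t ^ 2 = 0 := by
    unfold conicDisc at hδ
    by_cases hc : (2 : F) = 0
    · have h4 : (4 : F) = 0 := by linear_combination 2 * hc
      have hb : b = 0 := pow_eq_zero_iff two_ne_zero |>.1 (by linear_combination h1 + a * d * h4)
      have hf : f = 0 := pow_eq_zero_iff two_ne_zero |>.1 (by linear_combination h2 + a * h * h4)
      have hg : g = 0 := pow_eq_zero_iff two_ne_zero |>.1 (by linear_combination h3 + d * h * h4)
      have : CharP F 2 := CharTwo.of_one_ne_zero_of_two_eq_zero one_ne_zero hc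
      obtain ⟨a', rfl⟩ := surjective_frobenius F 2 a
      obtain ⟨d', rfl⟩ := surjective_frobenius F 2 d
      obtain ⟨h', rfl⟩ := surjective_frobenius F 2 h
      refine ⟨a', d', h', fun y z t e => ?_⟩
      simp only [hb, hf, hg, frobenius_def]
      linear_combination (a' * y + d' * z + h' * t) * e -
        (a' * y * d' * z + a' * y * h' * t + d' * z * h' * t) * hc
    · have hc4 : (4 : F) ≠ 0 := by
        intro h; apply hc
        exact pow_eq_zero_iff two_ne_zero |>.1 (by linear_combination h)
      by_cases ha : a = 0
      · subst ha
        have hb : b = 0 := pow_eq_zero_iff two_ne_zero |>.1 (by linear_combination h1)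
        have hf : f = 0 := pow_eq_zero_iff two_ne_zero |>.1 (by linear_combination h2)
        by_cases hd : d = 0
        · subst hd
          have hg : g = 0 := pow_eq_zero_iff two_ne_zero |>.1 (by linear_combination h3)
          refine ⟨0, 0, 1, fun y z t e => ?_⟩
          simp only [hb, hf, hg]
          linear_combination h * t * e
        · refine ⟨0, 2 * d, g, fun y z t e => ?_⟩
          refine (mul_eq_zero.1 (?_ : (4 * d) * _ = 0)).resolve_left (mul_ne_zero hc4 hd)
          simp only [hb, hf]
          linear_combination (2 * d * z + g * t) * e - t ^ 2 * h3
      · refine ⟨2 * a, b, f, fun y z t e => ?_⟩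
        refine (mul_eq_zero.1 (?_ : (4 * a) * _ = 0)).resolve_left (mul_ne_zero hc4 ha)
        have hag : 2 * a * g = b * f := by
          have e1 : (2 * a * g - b * f) * (2 * a * g + b * f) = 0 := by
            linear_combination 4 * a ^ 2 * h3 - f ^ 2 * h1 - 4 * a * d * h2
          rcases mul_eq_zero.1 e1 with e2 | e2
          · linear_combination e2
          · have e3 : 16 * (d * h) * a = 0 := by
              linear_combination (-1) * hδ * 1 + g * e2 - 3 * a * h3 - d * h2 - h * h1
            have e4 : (4 : F) ^ 2 * (d * h) = 0 := by
              refine (mul_eq_zero.1 (?_ : _ * a = 0)).resolve_right ha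
              linear_combination e3
            have e5 : d * h = 0 := (mul_eq_zero.1 e4).resolve_left (pow_ne_zero 2 hc4)
            have e6 : b * f = 0 := by
              refine pow_eq_zero_iff two_ne_zero |>.1 ?_
              linear_combination f ^ 2 * h1 + 4 * a * d * h2 + 16 * a ^ 2 * e5
            linear_combination e2 - 2 * e6
        linear_combination (2 * a * y + b * z + f * t) * e - z ^ 2 * h1 - t ^ 2 * h2 +
          2 * z * t * hag
  refine (card_linear_zeros l m k).1.trans (Finset.card_le_card ?_)
  rintro ⟨u, v, w⟩ hu
  simp only [Finset.mem_filter, Finset.mem_product, Finset.mem_univ, true_and] at hu ⊢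
  exact hlin _ _ _ hu

end

section
variable {F : Type} [Field F] [Fintype F] [DecidableEq F]

theorem card_dot_zeros {m : ℕ} {l : Fin m → F} (hl : ∃ i, l i ≠ 0) :
    (Finset.univ.filter fun x : Fin m → F => ∑ i, l i * x i = 0).card * Fintype.card F =
      Fintype.card F ^ m := by
  let φ : (Fin m → F) →ₗ[F] F := ∑ i, l i • LinearMap.proj i
  have hφ : ∀ u, φ u = ∑ i, l i * u i := fun u => by simp [φ]
  have hk : Nat.card (LinearMap.ker φ) =
      (Finset.univ.filter fun x : Fin m → F => ∑ i, l i * x i = 0).card := by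
    rw [← Fintype.card_subtype, ← Nat.card_eq_fintype_card]
    exact Nat.card_congr (Equiv.subtypeEquivRight fun u => by rw [LinearMap.mem_ker, hφ])
  rw [← hk, (card_ker_mul φ).2, Nat.card_eq_fintype_card, Fintype.card_fun, Fintype.card_fin]
  obtain ⟨i, hi⟩ := hl
  intro h0
  have := hφ (Pi.single i 1)
  rw [h0] at this
  simp [Pi.single_apply] at this
  exact hi this.symm

theorem conicCount_add_eq (a b d f g h : F) :
    conicCount Finset.univ a b d f g h +
      (Finset.univ.filter fun w : F × F => a * w.1 ^ 2 + b * w.1 * w.2 + d * w.2 ^ 2 +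
        f * w.1 + g * w.2 + h = 0).card =
    (Finset.univ.filter fun w : F × F => a * w.1 ^ 2 + b * w.1 * w.2 + d * w.2 ^ 2 = 0).card +
      Fintype.card F * (Finset.univ.filter fun w : F × F =>
        a * w.1 ^ 2 + b * w.1 * w.2 + d * w.2 ^ 2 + f * w.1 + g * w.2 + h = 0).card := by
  classical
  set N := Finset.univ.filter fun w : F × F => a * w.1 ^ 2 + b * w.1 * w.2 + d * w.2 ^ 2 +
        f * w.1 + g * w.2 + h = 0 with hN
  set Z := Finset.univ.filter fun w : F × F => a * w.1 ^ 2 + b * w.1 * w.2 + d * w.2 ^ 2 = 0 with hZ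
  have h1 : conicCount Finset.univ a b d f g h =
      Z.card + ((Finset.univ.erase (0 : F)) ×ˢ N).card := by
    rw [conicCount, ← Finset.card_filter_add_card_filter_not (fun u : F × F × F => u.2.2 = 0),
      Finset.filter_filter, Finset.filter_filter]
    congr 1
    · refine Finset.card_bij' (fun u _ => (u.1, u.2.1)) (fun w _ => (w.1, w.2, 0)) ?_ ?_ ?_ ?_
      · rintro ⟨y, z, t⟩ hu
        simp only [Finset.mem_filter, Finset.mem_product, Finset.mem_univ, true_and, hZ] at hu ⊢
        rw [hu.2] at hu
        linear_combination hu.1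
      · rintro ⟨y, z⟩ hu
        simp only [Finset.mem_filter, Finset.mem_product, Finset.mem_univ, true_and, hZ,
          and_true] at hu ⊢
        linear_combination hu
      · rintro ⟨y, z, t⟩ hu
        simp only [Finset.mem_filter] at hu
        rw [← hu.2.2]
      · intro _ _; rfl
    · refine Finset.card_bij' (fun u _ => (u.2.2, (u.1 / u.2.2, u.2.1 / u.2.2)))
        (fun w _ => (w.1 * w.2.1, w.1 * w.2.2, w.1)) ?_ ?_ ?_ ?_
      · rintro ⟨y, z, t⟩ hu
        simp only [Finset.mem_filter, Finset.mem_product, Finset.mem_univ, true_and, hN,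
          Finset.mem_erase, and_true] at hu ⊢
        obtain ⟨hu, ht⟩ := hu
        refine ⟨ht, ?_⟩
        field_simp
        linear_combination hu
      · rintro ⟨t, y, z⟩ hu
        simp only [Finset.mem_filter, Finset.mem_product, Finset.mem_univ, true_and, hN,
          Finset.mem_erase, and_true] at hu ⊢
        exact ⟨by linear_combination t ^ 2 * hu.2, hu.1⟩
      · rintro ⟨y, z, t⟩ hu
        simp only [Finset.mem_filter] at hu
        have ht := hu.2.2
        simp only [Prod.mk.injEq, and_true]
        exact ⟨by field_simp, by field_simp⟩
      · rintro ⟨t, y, z⟩ hu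
        have ht := Finset.ne_of_mem_erase (Finset.mem_product.1 hu).1
        simp only at ht
        simp only [Prod.mk.injEq, true_and]
        exact ⟨by field_simp, by field_simp⟩
  rw [h1, Finset.card_product, Finset.card_erase_of_mem (Finset.mem_univ _), Finset.card_univ]
  obtain ⟨q, hq⟩ := Nat.exists_eq_add_of_lt (Fintype.card_pos (α := F))
  rw [hq]
  simp only [zero_add, Nat.add_sub_cancel]
  ring

theorem sum_card_form_zeros {α β γ : Fin 3 → F}
    (hns : ∀ y z : F, (y ≠ 0 ∨ z ≠ 0) → ∃ i, α i * y ^ 2 + β i * y * z + γ i * z ^ 2 ≠ 0) :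
    ∑ x : Fin 3 → F, (Finset.univ.filter fun w : F × F => (∑ i, α i * x i) * w.1 ^ 2 +
      (∑ i, β i * x i) * w.1 * w.2 + (∑ i, γ i * x i) * w.2 ^ 2 = 0).card + Fintype.card F ^ 2 =
    Fintype.card F ^ 3 + Fintype.card F ^ 4 := by
  have hq : 0 < Fintype.card F := Fintype.card_pos
  have h1 : ∑ x : Fin 3 → F, (Finset.univ.filter fun w : F × F => (∑ i, α i * x i) * w.1 ^ 2 +
      (∑ i, β i * x i) * w.1 * w.2 + (∑ i, γ i * x i) * w.2 ^ 2 = 0).card =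
      ∑ w : F × F, (Finset.univ.filter fun x : Fin 3 → F => (∑ i, α i * x i) * w.1 ^ 2 +
      (∑ i, β i * x i) * w.1 * w.2 + (∑ i, γ i * x i) * w.2 ^ 2 = 0).card := by
    simp only [Finset.card_filter]
    exact Finset.sum_comm
  have h2 : ∀ w : F × F, (Finset.univ.filter fun x : Fin 3 → F => (∑ i, α i * x i) * w.1 ^ 2 +
      (∑ i, β i * x i) * w.1 * w.2 + (∑ i, γ i * x i) * w.2 ^ 2 = 0).card =
      if w = 0 then Fintype.card F ^ 3 else Fintype.card F ^ 2 := by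
    rintro ⟨y, z⟩
    split_ifs with hw
    · rw [Prod.mk_eq_zero] at hw
      simp [hw]
    · have := card_dot_zeros (l := fun i => α i * y ^ 2 + β i * y * z + γ i * z ^ 2) (hns y z (by
        by_contra! hc; exact hw (Prod.mk_eq_zero.2 hc)))
      rw [pow_succ _ 2] at this
      rw [← Nat.eq_of_mul_eq_mul_right hq this]
      congr 1
      ext x
      rw [Finset.mem_filter, Finset.mem_filter]
      have e : (∑ i, α i * x i) * y ^ 2 + (∑ i, β i * x i) * y * z + (∑ i, γ i * x i) * z ^ 2 =
          ∑ i, (α i * y ^ 2 + β i * y * z + γ i * z ^ 2) * x i := by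
        simp only [Finset.sum_mul, ← Finset.sum_add_distrib]
        exact Finset.sum_congr rfl fun i _ => by ring
      rw [e]
  rw [h1, Finset.sum_congr rfl fun w _ => h2 w, ← Finset.add_sum_erase _ _ (Finset.mem_univ 0),
    if_pos rfl, Finset.sum_congr rfl (g := fun _ => Fintype.card F ^ 2) fun w hw => if_neg
      (Finset.ne_of_mem_erase hw), Finset.sum_const, Finset.card_erase_of_mem (Finset.mem_univ _),
    Finset.card_univ, Fintype.card_prod, smul_eq_mul]
  obtain ⟨q, hq⟩ := Nat.exists_eq_add_of_lt hq
  rw [hq]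
  simp only [zero_add]
  have : (q + 1) * (q + 1) - 1 = q ^ 2 + 2 * q := by
    rw [show (q + 1) * (q + 1) = q ^ 2 + 2 * q + 1 by ring, Nat.add_sub_cancel]
  rw [this]
  ring

theorem card_cubic_with_line_ge {α β γ : Fin 3 → F} (f g h : (Fin 3 → F) → F)
    (hns : ∀ y z : F, (y ≠ 0 ∨ z ≠ 0) → ∃ i, α i * y ^ 2 + β i * y * z + γ i * z ^ 2 ≠ 0)
    (Np Nm : Finset (Fin 3 → F))
    (hNp : ∀ x ∈ Np, 2 * Fintype.card F ^ 2 ≤ conicCount Finset.univ (∑ i, α i * x i)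
      (∑ i, β i * x i) (∑ i, γ i * x i) (f x) (g x) (h x) + Fintype.card F)
    (hNm : ∀ x ∉ Nm, Fintype.card F ^ 2 ≤ conicCount Finset.univ (∑ i, α i * x i)
      (∑ i, β i * x i) (∑ i, γ i * x i) (f x) (g x) (h x)) :
    Fintype.card F ^ 4 + Fintype.card F * Np.card ≤
      (Finset.univ.filter fun v : (Fin 3 → F) × F × F =>
        (∑ i, α i * v.1 i) * v.2.1 ^ 2 + (∑ i, β i * v.1 i) * v.2.1 * v.2.2 +
        (∑ i, γ i * v.1 i) * v.2.2 ^ 2 + f v.1 * v.2.1 + g v.1 * v.2.2 + h v.1 = 0).card +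
      Fintype.card F ^ 2 + Fintype.card F * Nm.card := by
  set q := Fintype.card F with hq
  have hq1 : 1 < q := Fintype.one_lt_card
  set c := fun x : Fin 3 → F => conicCount Finset.univ (∑ i, α i * x i)
      (∑ i, β i * x i) (∑ i, γ i * x i) (f x) (g x) (h x) with hc
  set N2 := fun x : Fin 3 → F => (Finset.univ.filter fun w : F × F => (∑ i, α i * x i) * w.1 ^ 2 +
      (∑ i, β i * x i) * w.1 * w.2 + (∑ i, γ i * x i) * w.2 ^ 2 + f x * w.1 + g x * w.2 +
      h x = 0).card with hN2
  have hN : (Finset.univ.filter fun v : (Fin 3 → F) × F × F =>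
        (∑ i, α i * v.1 i) * v.2.1 ^ 2 + (∑ i, β i * v.1 i) * v.2.1 * v.2.2 +
        (∑ i, γ i * v.1 i) * v.2.2 ^ 2 + f v.1 * v.2.1 + g v.1 * v.2.2 + h v.1 = 0).card =
        ∑ x, N2 x := by
    simp only [hN2, Finset.card_filter]
    rw [← Finset.univ_product_univ, Finset.sum_product]
  rw [hN]
  have e1 := sum_card_form_zeros hns
  have e2 : ∑ x, c x + ∑ x, N2 x =
      ∑ x : Fin 3 → F, (Finset.univ.filter fun w : F × F => (∑ i, α i * x i) * w.1 ^ 2 +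
      (∑ i, β i * x i) * w.1 * w.2 + (∑ i, γ i * x i) * w.2 ^ 2 = 0).card + q * ∑ x, N2 x := by
    rw [← Finset.sum_add_distrib, Finset.sum_congr rfl fun x _ => conicCount_add_eq _ _ _ _ _ _,
      Finset.sum_add_distrib, ← Finset.mul_sum]
  have e3 : ∀ x, q ^ 2 + (if x ∈ Np then q ^ 2 - q else 0) ≤
      c x + (if x ∈ Nm then q ^ 2 - q else 0) := by
    intro x
    have hqq : q ≤ q ^ 2 := Nat.le_self_pow two_ne_zero q
    have h0 : q ≤ c x := le_conicCount _ _ _ _ _ _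
    have h1 : x ∈ Np → 2 * q ^ 2 ≤ c x + q := hNp x
    have h2 : x ∉ Nm → q ^ 2 ≤ c x := hNm x
    split_ifs with a b b
    · have := h1 a; omega
    · have := h1 a; omega
    · omega
    · have := h2 b; omega
  have e4 := Finset.sum_le_sum (s := Finset.univ) fun x _ => e3 x
  simp only [Finset.sum_add_distrib, Finset.sum_ite_mem, Finset.univ_inter, Finset.sum_const,
    Finset.card_univ, Fintype.card_fun, Fintype.card_fin, smul_eq_mul] at e4
  rw [← hq] at e1 e4
  clear_value q
  obtain ⟨r, rfl⟩ : ∃ r, q = r + 1 := ⟨q - 1, by omega⟩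
  have hr : 0 < r := by omega
  have e5 : (r + 1) ^ 2 - (r + 1) = r * (r + 1) := by
    rw [show (r + 1) ^ 2 = r * (r + 1) + (r + 1) by ring, Nat.add_sub_cancel]
  rw [e5] at e4
  refine Nat.le_of_mul_le_mul_left ?_ hr
  set SN := ∑ x, N2 x
  set SC := ∑ x, c x
  have e6 : (r + 1) ^ 3 * (r + 1) ^ 2 + Np.card * (r * (r + 1)) + (r + 1) ^ 2 ≤
      r * SN + (r + 1) ^ 3 + (r + 1) ^ 4 + Nm.card * (r * (r + 1)) := by
    have : (r + 1) * SN = r * SN + SN := by ring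
    omega
  nlinarith

end

section
variable {K : Type} [Field K] {p : ℕ} [hp : Fact p.Prime] [CharP K p]

/-- The subfield with `p ^ n` elements. -/
def FsField (p : ℕ) (K : Type) [Field K] [Fact p.Prime] [CharP K p] (n : ℕ) : Subfield K :=
  RingHom.eqLocusField (iterateFrobenius K p n) (RingHom.id K)

theorem mem_FsField {n : ℕ} (hn : 0 < n) {x : K} : x ∈ FsField p K n ↔ x ∈ Fs p K n := by
  rw [mem_Fs hn]
  rfl

theorem finite_FsField {n : ℕ} (hn : 0 < n) : Finite (FsField p K n) :=
  Set.Finite.to_subtype ((Fs p K n).finite_toSet.subset fun _ hx =>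
    Finset.mem_coe.2 ((mem_FsField hn).1 hx))

theorem card_FsField [IsAlgClosed K] {n : ℕ} (hn : 0 < n) [Fintype (FsField p K n)] :
    Fintype.card (FsField p K n) = p ^ n := by
  rw [← card_Fs (K := K) hn, ← Finset.card_univ]
  exact Finset.card_bij (fun x _ => (x : K)) (fun x _ => (mem_FsField hn).1 x.2)
    (fun _ _ _ _ h => Subtype.ext h) fun y hy => ⟨⟨y, (mem_FsField hn).2 hy⟩, Finset.mem_univ _, rfl⟩

theorem conicCount_coe {n : ℕ} (hn : 0 < n) [Fintype (FsField p K n)]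
    (a b d f g h : FsField p K n) : conicCount Finset.univ a b d f g h =
      conicCount (Fs p K n) (a : K) b d f g h := by
  refine Finset.card_bij (fun u _ => ((u.1 : K), (u.2.1 : K), (u.2.2 : K))) ?_ ?_ ?_
  · rintro ⟨y, z, t⟩ hu
    simp only [Finset.mem_filter, Finset.mem_product, Finset.mem_univ, true_and] at hu ⊢
    refine ⟨⟨(mem_FsField hn).1 y.2, (mem_FsField hn).1 z.2, (mem_FsField hn).1 t.2⟩, ?_⟩
    have := congrArg (Subtype.val : FsField p K n → K) hu
    push_cast at this
    exact this
  · rintro ⟨y, z, t⟩ _ ⟨y', z', t'⟩ _ h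
    simp only [Prod.mk.injEq, SetLike.coe_eq_coe] at h ⊢
    exact h
  · rintro ⟨y, z, t⟩ hu
    simp only [Finset.mem_filter, Finset.mem_product] at hu
    refine ⟨(⟨y, (mem_FsField hn).2 hu.1.1⟩, ⟨z, (mem_FsField hn).2 hu.1.2.1⟩,
      ⟨t, (mem_FsField hn).2 hu.1.2.2⟩), ?_, rfl⟩
    simp only [Finset.mem_filter, Finset.mem_product, Finset.mem_univ, true_and]
    apply Subtype.ext
    push_cast
    exact hu.2

theorem conicDisc_map {R S : Type} [CommRing R] [CommRing S] (φ : R →+* S) (a b d f g h : R) :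
    φ (conicDisc a b d f g h) = conicDisc (φ a) (φ b) (φ d) (φ f) (φ g) (φ h) := by
  simp only [conicDisc, map_sub, map_add, map_mul, map_pow, map_ofNat]

variable [IsAlgClosed K]

theorem sq_le_conicCount_Fs {n : ℕ} (hn : 0 < n) {a b d f g h : K} (ha : a ∈ Fs p K n)
    (hb : b ∈ Fs p K n) (hd : d ∈ Fs p K n) (hf : f ∈ Fs p K n) (hg : g ∈ Fs p K n)
    (hh : h ∈ Fs p K n) (H : conicDisc a b d f g h ≠ 0 ∨ (b ^ 2 - 4 * a * d = 0 ∧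
      f ^ 2 - 4 * a * h = 0 ∧ g ^ 2 - 4 * d * h = 0)) :
    (p ^ n) ^ 2 ≤ conicCount (Fs p K n) a b d f g h := by
  have := finite_FsField (p := p) (K := K) hn
  have := Fintype.ofFinite (FsField p K n)
  rw [← mem_FsField hn] at ha hb hd hf hg hh
  lift a to FsField p K n using ha
  lift b to FsField p K n using hb
  lift d to FsField p K n using hd
  lift f to FsField p K n using hf
  lift g to FsField p K n using hg
  lift h to FsField p K n using hh
  rw [← conicCount_coe hn, ← card_FsField (K := K) hn]
  have e : conicDisc (a : K) b d f g h = (conicDisc a b d f g h : FsField p K n) :=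
    (conicDisc_map (FsField p K n).subtype a b d f g h).symm
  rw [e] at H
  by_cases h0 : conicDisc a b d f g h = 0
  · rw [h0] at H
    obtain ⟨h1, h2, h3⟩ := H.resolve_left (by simp)
    exact sq_le_conicCount_of_disc_eq_zero h0 (Subtype.ext (by push_cast; exact h1))
      (Subtype.ext (by push_cast; exact h2)) (Subtype.ext (by push_cast; exact h3))
  · exact sq_le_conicCount_of_disc_ne_zero h0

theorem le_conicCount_Fs_of_isot {n : ℕ} (hn : 0 < n) {a b d f g h : K} (ha : a ∈ Fs p K n)
    (hb : b ∈ Fs p K n) (hd : d ∈ Fs p K n) (hf : f ∈ Fs p K n) (hg : g ∈ Fs p K n)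
    (hh : h ∈ Fs p K n) (hδ : conicDisc a b d f g h = 0)
    (H : b ^ 2 - 4 * a * d ≠ 0) (hi : Isot (Fs p K n) a b d) :
    2 * (p ^ n) ^ 2 ≤ conicCount (Fs p K n) a b d f g h + p ^ n := by
  have := finite_FsField (p := p) (K := K) hn
  have := Fintype.ofFinite (FsField p K n)
  rw [← mem_FsField hn] at ha hb hd hf hg hh
  lift a to FsField p K n using ha
  lift b to FsField p K n using hb
  lift d to FsField p K n using hd
  lift f to FsField p K n using hf
  lift g to FsField p K n using hg
  lift h to FsField p K n using hh
  rw [← conicCount_coe hn, ← card_FsField (K := K) hn]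
  have e : conicDisc (a : K) b d f g h = (conicDisc a b d f g h : FsField p K n) :=
    (conicDisc_map (FsField p K n).subtype a b d f g h).symm
  rw [e] at hδ
  refine le_conicCount_of_isot (Subtype.ext hδ) (fun h => H ?_) ?_
  · have := congrArg (Subtype.val : FsField p K n → K) h
    push_cast at this
    exact this
  · obtain ⟨y, hy, z, hz, hne, h0⟩ := hi
    refine ⟨⟨y, (mem_FsField hn).2 hy⟩, Finset.mem_univ _, ⟨z, (mem_FsField hn).2 hz⟩,
      Finset.mem_univ _, ?_, ?_⟩
    · simpa only [ne_eq, ← Subtype.coe_inj, ZeroMemClass.coe_zero] using hne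
    · apply Subtype.ext
      push_cast
      exact h0

open scoped Classical in
/-- The number of vectors with coordinates in `S` satisfying a condition. -/
noncomputable def affCount {m : ℕ} (S : Finset K) (P : (Fin m → K) → Prop) : ℕ :=
  ((Fintype.piFinset fun _ : Fin m => S).filter P).card

theorem affCount_cone (n : ℕ) (hn : 0 < n) (P : (Fin 3 → K) → Prop)
    [DecidablePred fun w : K × K => P ![0, w.1, w.2]]
    [DecidablePred fun w : K × K => P ![1, w.1, w.2]]
    (hP : ∀ l ∈ Fs p K n, l ≠ 0 → ∀ x, (∀ i, x i ∈ Fs p K n) → P x → P (l • x)) :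
    affCount (Fs p K n) P = ((Fs p K n ×ˢ Fs p K n).filter fun w => P ![0, w.1, w.2]).card +
      (p ^ n - 1) * ((Fs p K n ×ˢ Fs p K n).filter fun w => P ![1, w.1, w.2]).card := by
  classical
  rw [affCount, ← Finset.card_filter_add_card_filter_not (fun x : Fin 3 → K => x 0 = 0),
    Finset.filter_filter, Finset.filter_filter]
  have e3 : ∀ x : Fin 3 → K, ![x 0, x 1, x 2] = x := by
    intro x; ext i; fin_cases i <;> rfl
  congr 1
  · refine Finset.card_bij' (fun x _ => (x 1, x 2)) (fun w _ => ![0, w.1, w.2]) ?_ ?_ ?_ ?_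
    · intro x hx
      simp only [Finset.mem_filter, Fintype.mem_piFinset, Finset.mem_product] at hx ⊢
      refine ⟨⟨hx.1 _, hx.1 _⟩, ?_⟩
      rw [← hx.2.2, e3]
      exact hx.2.1
    · rintro ⟨a, b⟩ hx
      simp only [Finset.mem_filter, Fintype.mem_piFinset, Finset.mem_product] at hx ⊢
      refine ⟨fun i => ?_, hx.2, rfl⟩
      fin_cases i
      exacts [Fs_zero_mem hn, hx.1.1, hx.1.2]
    · intro x hx
      simp only [Finset.mem_filter] at hx
      rw [← hx.2.2, e3]
    · intro w _; rfl
  · rw [← card_Fs (K := K) hn, ← Finset.card_erase_of_mem (Fs_zero_mem hn), ← Finset.card_product]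
    refine Finset.card_bij' (fun x _ => (x 0, (x 1 / x 0, x 2 / x 0)))
      (fun w _ => w.1 • ![1, w.2.1, w.2.2]) ?_ ?_ ?_ ?_
    · intro x hx
      simp only [Finset.mem_filter, Fintype.mem_piFinset, Finset.mem_product, Finset.mem_erase,
        div_eq_mul_inv] at hx ⊢
      refine ⟨⟨hx.2.2, hx.1 0⟩, ⟨Fs_mul_mem hn (hx.1 _) (Fs_inv_mem hn (hx.1 0)),
        Fs_mul_mem hn (hx.1 _) (Fs_inv_mem hn (hx.1 0))⟩, ?_⟩
      have := hP _ (Fs_inv_mem hn (hx.1 0)) (inv_ne_zero hx.2.2) x hx.1 hx.2.1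
      convert this using 1
      ext i
      fin_cases i
      · simp [hx.2.2]
      · exact mul_comm _ _
      · exact mul_comm _ _
    · rintro ⟨l, a, b⟩ hx
      simp only [Finset.mem_filter, Fintype.mem_piFinset, Finset.mem_product,
        Finset.mem_erase] at hx ⊢
      have hm : ∀ i, (![1, a, b] : Fin 3 → K) i ∈ Fs p K n := by
        intro i
        fin_cases i
        exacts [Fs_one_mem hn, hx.2.1.1, hx.2.1.2]
      refine ⟨fun i => Fs_mul_mem hn hx.1.2 (hm i), hP l hx.1.2 hx.1.1 _ hm hx.2.2, ?_⟩
      simpa using hx.1.1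
    · intro x hx
      simp only [Finset.mem_filter] at hx
      ext i
      fin_cases i
      · simp
      · simp only [Fin.mk_one, Pi.smul_apply, smul_eq_mul, Matrix.cons_val_one]
        exact mul_div_cancel₀ _ hx.2.2
      · exact mul_div_cancel₀ _ hx.2.2
    · rintro ⟨l, a, b⟩ hx
      simp only [Finset.mem_product, Finset.mem_erase] at hx
      have := hx.1.1
      simp [this]

theorem eventually_eval_mem [LocFin p K] {m : ℕ} (P : MvPolynomial (Fin m) K) :
    ∀ᶠ n in divFilter, ∀ x : Fin m → K, (∀ i, x i ∈ Fs p K n) → eval x P ∈ Fs p K n := by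
  induction P using MvPolynomial.induction_on with
  | C a =>
    filter_upwards [eventually_mem_Fs (p := p) a] with n hn x _
    rwa [eval_C]
  | add P Q h1 h2 =>
    filter_upwards [h1, h2, eventually_pos_divFilter] with n h1 h2 hn x hx
    rw [map_add]
    exact Fs_add_mem hn (h1 x hx) (h2 x hx)
  | mul_X P i h1 =>
    filter_upwards [h1, eventually_pos_divFilter] with n h1 hn x hx
    rw [map_mul, eval_X]
    exact Fs_mul_mem hn (h1 x hx) (hx i)

theorem card_curvePts_le {g : Polynomial (Polynomial K)} (hg : g ≠ 0) :
    ∃ M : ℕ, ∀ n, 0 < n → (curvePts p g n).card ≤ M * p ^ n := by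
  classical
  refine ⟨g.leadingCoeff.natDegree + g.natDegree, fun n hn => ?_⟩
  have hsub : curvePts p g n ⊆ (g.leadingCoeff.roots.toFinset ×ˢ Fs p K n) ∪
      ((Fs p K n).filter fun x => g.leadingCoeff.eval x ≠ 0).biUnion fun x =>
        (g.map (Polynomial.evalRingHom x)).roots.toFinset.image fun y => (x, y) := by
    rintro ⟨x, y⟩ hP
    rw [mem_curvePts] at hP
    by_cases hx : g.leadingCoeff.eval x = 0
    · refine Finset.mem_union_left _ (Finset.mem_product.2 ⟨?_, hP.1.2⟩)
      rw [Multiset.mem_toFinset, Polynomial.mem_roots (Polynomial.leadingCoeff_ne_zero.2 hg)]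
      exact hx
    · refine Finset.mem_union_right _ ?_
      simp only [Finset.mem_biUnion, Finset.mem_image, Multiset.mem_toFinset, Finset.mem_filter]
      refine ⟨x, ⟨hP.1.1, hx⟩, y, ?_, rfl⟩
      rw [Polynomial.mem_roots, Polynomial.IsRoot.def, Polynomial.map_evalRingHom_eval]
      · exact hP.2
      · intro h0
        apply hx
        have := congrArg (fun P => P.coeff g.natDegree) h0
        simpa using this
  refine (Finset.card_le_card hsub).trans ((Finset.card_union_le _ _).trans ?_)
  rw [add_mul, Finset.card_product, card_Fs hn]
  refine add_le_add (Nat.mul_le_mul_right _ ((Multiset.toFinset_card_le _).trans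
    (Polynomial.card_roots' _))) (Finset.card_biUnion_le.trans ?_)
  rw [← card_Fs (K := K) hn, mul_comm, ← smul_eq_mul]
  refine (Finset.sum_le_card_nsmul _ _ g.natDegree fun x _ => ?_).trans
    (Nat.mul_le_mul_right _ (Finset.card_le_card (Finset.filter_subset _ _)))
  exact Finset.card_image_le.trans ((Multiset.toFinset_card_le _).trans
    ((Polynomial.card_roots' _).trans Polynomial.natDegree_map_le))

end

section
variable {K : Type} [Field K] {p : ℕ} [hp : Fact p.Prime] [CharP K p]

theorem conicCount_scale {n : ℕ} (hn : 0 < n) {l : K} (hl : l ∈ Fs p K n) (hl0 : l ≠ 0)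
    (a b d f g h : K) : conicCount (Fs p K n) (l * a) (l * b) (l * d) (l ^ 2 * f) (l ^ 2 * g)
      (l ^ 3 * h) = conicCount (Fs p K n) a b d f g h := by
  refine Finset.card_bij' (fun u _ => (u.1, u.2.1, l * u.2.2))
    (fun u _ => (u.1, u.2.1, l⁻¹ * u.2.2)) ?_ ?_ ?_ ?_
  · rintro ⟨y, z, t⟩ hu
    simp only [Finset.mem_filter, Finset.mem_product] at hu ⊢
    refine ⟨⟨hu.1.1, hu.1.2.1, Fs_mul_mem hn hl hu.1.2.2⟩, ?_⟩
    apply mul_left_cancel₀ hl0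
    linear_combination hu.2
  · rintro ⟨y, z, t⟩ hu
    simp only [Finset.mem_filter, Finset.mem_product] at hu ⊢
    refine ⟨⟨hu.1.1, hu.1.2.1, Fs_mul_mem hn (Fs_inv_mem hn hl) hu.1.2.2⟩, ?_⟩
    obtain ⟨s, rfl⟩ : ∃ s, t = l * s := ⟨l⁻¹ * t, by field_simp⟩
    rw [inv_mul_cancel_left₀ hl0]
    linear_combination l * hu.2
  · rintro ⟨y, z, t⟩ _
    simp [hl0]
  · rintro ⟨y, z, t⟩ _
    simp [hl0]

/-- Restriction of a ternary form to an affine plane. -/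
noncomputable def planeSlice (s : K) : MvPolynomial (Fin 3) K →+* Polynomial (Polynomial K) :=
  eval₂Hom (Polynomial.C.comp Polynomial.C)
    ![Polynomial.C (Polynomial.C s), Polynomial.C Polynomial.X, Polynomial.X]

theorem evalEval_planeSlice (s x y : K) (P : MvPolynomial (Fin 3) K) :
    (planeSlice s P).evalEval x y = eval ![s, x, y] P := by
  have : (Polynomial.evalEvalRingHom x y).comp (planeSlice s) = eval ![s, x, y] := by
    apply MvPolynomial.ringHom_ext
    · intro r
      simp [planeSlice]
    · intro i
      fin_cases i <;> simp [planeSlice]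
  exact RingHom.congr_fun this P

theorem affCount_eq_card {m n : ℕ} (hn : 0 < n) [Fintype (FsField p K n)]
    (P : (Fin m → K) → Prop) [DecidablePred fun x : Fin m → FsField p K n => P fun i => x i] :
    affCount (Fs p K n) P =
      (Finset.univ.filter fun x : Fin m → FsField p K n => P fun i => x i).card := by
  symm
  refine Finset.card_bij (fun x _ i => (x i : K)) ?_ ?_ ?_
  · intro x hx
    simp only [Finset.mem_filter, Finset.mem_univ, true_and, Fintype.mem_piFinset] at hx ⊢
    exact ⟨fun i => (mem_FsField hn).1 (x i).2, hx⟩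
  · intro x _ y _ h
    funext i
    exact Subtype.ext (congrFun h i)
  · intro x hx
    simp only [Finset.mem_filter, Fintype.mem_piFinset] at hx
    exact ⟨fun i => ⟨x i, (mem_FsField hn).2 (hx.1 i)⟩, by simpa using hx.2, rfl⟩

/-- The number of zeros of a function of five variables over large enough finite fields is
bounded below with a square root error term. -/
def LowerBound (p : ℕ) [Fact p.Prime] [CharP K p] (c : (Fin 5 → K) → K) : Prop :=
  ∃ M : ℕ, ∀ᶠ n in divFilter, (p ^ n) ^ 4 ≤ affCount (Fs p K n) (fun v => c v = 0) +
    M * ((p ^ n) ^ 2 * p ^ (n / 2))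

variable [IsAlgClosed K]

theorem lowerBound_aux {n : ℕ} (hn : 0 < n) {α β γ : Fin 3 → K} {f g h : MvPolynomial (Fin 3) K}
    (hα : ∀ i, α i ∈ Fs p K n) (hβ : ∀ i, β i ∈ Fs p K n) (hγ : ∀ i, γ i ∈ Fs p K n)
    (hf : ∀ x : Fin 3 → K, (∀ i, x i ∈ Fs p K n) → eval x f ∈ Fs p K n)
    (hg : ∀ x : Fin 3 → K, (∀ i, x i ∈ Fs p K n) → eval x g ∈ Fs p K n)
    (hh : ∀ x : Fin 3 → K, (∀ i, x i ∈ Fs p K n) → eval x h ∈ Fs p K n)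
    (hns : ∀ y z : K, (y ≠ 0 ∨ z ≠ 0) → ∃ i, α i * y ^ 2 + β i * y * z + γ i * z ^ 2 ≠ 0)
    {c : (Fin 5 → K) → K}
    (hc : ∀ v, c v = (∑ i, α i * ![v 0, v 1, v 2] i) * v 3 ^ 2 +
      (∑ i, β i * ![v 0, v 1, v 2] i) * v 3 * v 4 + (∑ i, γ i * ![v 0, v 1, v 2] i) * v 4 ^ 2 +
      eval ![v 0, v 1, v 2] f * v 3 + eval ![v 0, v 1, v 2] g * v 4 + eval ![v 0, v 1, v 2] h)
    (Np Nm : (Fin 3 → K) → Prop)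
    (hNp : ∀ x : Fin 3 → K, (∀ i, x i ∈ Fs p K n) → Np x → 2 * (p ^ n) ^ 2 ≤
      conicCount (Fs p K n) (∑ i, α i * x i) (∑ i, β i * x i) (∑ i, γ i * x i)
        (eval x f) (eval x g) (eval x h) + p ^ n)
    (hNm : ∀ x : Fin 3 → K, (∀ i, x i ∈ Fs p K n) → ¬ Nm x → (p ^ n) ^ 2 ≤
      conicCount (Fs p K n) (∑ i, α i * x i) (∑ i, β i * x i) (∑ i, γ i * x i)
        (eval x f) (eval x g) (eval x h)) :
    (p ^ n) ^ 4 + p ^ n * affCount (Fs p K n) Np ≤ affCount (Fs p K n) (fun v => c v = 0) +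
      (p ^ n) ^ 2 + p ^ n * affCount (Fs p K n) Nm := by
  classical
  have := finite_FsField (p := p) (K := K) hn
  have := Fintype.ofFinite (FsField p K n)
  simp only [← mem_FsField hn] at hα hβ hγ
  lift α to Fin 3 → FsField p K n using hα
  lift β to Fin 3 → FsField p K n using hβ
  lift γ to Fin 3 → FsField p K n using hγ
  have hm : ∀ (x : Fin 3 → FsField p K n) i, (x i : K) ∈ Fs p K n :=
    fun x i => (mem_FsField hn).1 (x i).2
  let f' : (Fin 3 → FsField p K n) → FsField p K n := fun x =>
    ⟨eval (fun i => (x i : K)) f, (mem_FsField hn).2 (hf _ (hm x))⟩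
  let g' : (Fin 3 → FsField p K n) → FsField p K n := fun x =>
    ⟨eval (fun i => (x i : K)) g, (mem_FsField hn).2 (hg _ (hm x))⟩
  let h' : (Fin 3 → FsField p K n) → FsField p K n := fun x =>
    ⟨eval (fun i => (x i : K)) h, (mem_FsField hn).2 (hh _ (hm x))⟩
  have key := card_cubic_with_line_ge (α := α) (β := β) (γ := γ) f' g' h' ?_
    (Finset.univ.filter fun x => Np fun i => x i) (Finset.univ.filter fun x => Nm fun i => x i)
    ?_ ?_
  · rw [card_FsField (K := K) hn, ← affCount_eq_card hn, ← affCount_eq_card hn] at key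
    convert key using 3
    rw [affCount_eq_card hn]
    refine Finset.card_bij' (fun v _ => (![v 0, v 1, v 2], v 3, v 4))
      (fun u _ => ![u.1 0, u.1 1, u.1 2, u.2.1, u.2.2]) ?_ ?_ ?_ ?_
    · intro v hv
      simp only [Finset.mem_filter, Finset.mem_univ, true_and] at hv ⊢
      rw [hc] at hv
      apply Subtype.ext
      have e : (fun i => ((![v 0, v 1, v 2] : Fin 3 → FsField p K n) i : K)) =
          ![(v 0 : K), v 1, v 2] := by
        funext i; fin_cases i <;> rfl
      simp only [f', g', h', e]
      push_cast
      rw [← hv]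
      simp only [Fin.sum_univ_three]
      rfl
    · rintro ⟨x, y, z⟩ hu
      simp only [Finset.mem_filter, Finset.mem_univ, true_and] at hu ⊢
      rw [hc]
      have hu := congrArg (Subtype.val : FsField p K n → K) hu
      have e : (fun i => (x i : K)) = ![(x 0 : K), x 1, x 2] := by
        funext i; fin_cases i <;> rfl
      simp only [f', g', h', e] at hu
      push_cast at hu
      rw [← hu]
      simp only [Fin.sum_univ_three]
      rfl
    · intro v _
      funext i; fin_cases i <;> rfl
    · rintro ⟨x, y, z⟩ _
      refine Prod.ext ?_ rfl
      funext i; fin_cases i <;> rfl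
  · intro y z hyz
    obtain ⟨i, hi⟩ := hns y z (by simpa using hyz)
    exact ⟨i, fun h0 => hi (by simpa using congrArg (Subtype.val : FsField p K n → K) h0)⟩
  · intro x hx
    rw [card_FsField (K := K) hn, conicCount_coe hn]
    push_cast
    exact hNp _ (hm x) (by simpa using hx)
  · intro x hx
    rw [card_FsField (K := K) hn, conicCount_coe hn]
    push_cast
    exact hNm _ (hm x) (by simpa using hx)

variable [LocFin p K]

theorem lowerBound_of_line {α β γ : Fin 3 → K} {f g h : MvPolynomial (Fin 3) K}
    (hf : ∀ (l : K) x, eval (l • x) f = l ^ 2 * eval x f)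
    (hg : ∀ (l : K) x, eval (l • x) g = l ^ 2 * eval x g)
    (hh : ∀ (l : K) x, eval (l • x) h = l ^ 3 * eval x h)
    (hns : ∀ y z : K, (y ≠ 0 ∨ z ≠ 0) → ∃ i, α i * y ^ 2 + β i * y * z + γ i * z ^ 2 ≠ 0)
    {x₀ : Fin 3 → K} (hx₀ : x₀ 0 = 0)
    (hδ : conicDisc (∑ i, α i * x₀ i) (∑ i, β i * x₀ i) (∑ i, γ i * x₀ i)
        (eval x₀ f) (eval x₀ g) (eval x₀ h) ≠ 0)
    {c : (Fin 5 → K) → K}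
    (hc : ∀ v, c v = (∑ i, α i * ![v 0, v 1, v 2] i) * v 3 ^ 2 +
      (∑ i, β i * ![v 0, v 1, v 2] i) * v 3 * v 4 + (∑ i, γ i * ![v 0, v 1, v 2] i) * v 4 ^ 2 +
      eval ![v 0, v 1, v 2] f * v 3 + eval ![v 0, v 1, v 2] g * v 4 + eval ![v 0, v 1, v 2] h) :
    LowerBound p c := by
  classical
  let L : (Fin 3 → K) → MvPolynomial (Fin 3) K := fun α => ∑ i, C (α i) * X i
  have hL : ∀ α x, eval x (L α) = ∑ i, α i * x i := fun α x => by simp [L]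
  have hLs : ∀ α (l : K) x, eval (l • x) (L α) = l * eval x (L α) := fun α l x => by
    rw [hL, hL, Finset.mul_sum]
    exact Finset.sum_congr rfl fun i _ => by simp only [Pi.smul_apply, smul_eq_mul]; ring
  simp only [← hL] at hδ
  let Δ := conicDisc (L α) (L β) (L γ) f g h
  have hΔ : ∀ x, eval x Δ = conicDisc (eval x (L α)) (eval x (L β)) (eval x (L γ))
      (eval x f) (eval x g) (eval x h) := fun x => conicDisc_map (eval x) _ _ _ _ _ _
  rw [← hΔ] at hδ
  have hΔs : ∀ (l : K) x, eval (l • x) Δ = l ^ 5 * eval x Δ := by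
    intro l x
    rw [hΔ, hΔ, hLs, hLs, hLs, hf, hg, hh]
    simp only [conicDisc]
    ring
  have hx₀' : x₀ = ![0, x₀ 1, x₀ 2] := by
    funext i; fin_cases i
    exacts [hx₀, rfl, rfl]
  have h0 : planeSlice 0 Δ ≠ 0 := by
    intro h0
    apply hδ
    rw [hx₀', ← evalEval_planeSlice, h0, Polynomial.evalEval_zero]
  have h1 : planeSlice 1 Δ ≠ 0 := by
    intro h1
    have hz : ∀ s : K, s ≠ 0 → eval ![s, x₀ 1, x₀ 2] Δ = 0 := by
      intro s hs
      have : ![s, x₀ 1, x₀ 2] = s • ![1, s⁻¹ * x₀ 1, s⁻¹ * x₀ 2] := by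
        funext i; fin_cases i <;> simp [hs]
      rw [this, hΔs, ← evalEval_planeSlice, h1, Polynomial.evalEval_zero, mul_zero]
    let P : Polynomial K := aeval ![Polynomial.X, Polynomial.C (x₀ 1), Polynomial.C (x₀ 2)] Δ
    have hP : ∀ s, P.eval s = eval ![s, x₀ 1, x₀ 2] Δ := by
      intro s
      have : (Polynomial.evalRingHom s).comp (aeval (R := K)
          ![Polynomial.X, Polynomial.C (x₀ 1), Polynomial.C (x₀ 2)]).toRingHom =
          eval ![s, x₀ 1, x₀ 2] := by
        apply MvPolynomial.ringHom_ext
        · intro r; simp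
        · intro i; fin_cases i <;> simp
      exact RingHom.congr_fun this Δ
    have hP0 : P = 0 := by
      have : Polynomial.X * P = 0 := Polynomial.funext fun s => by
        rw [Polynomial.eval_mul, Polynomial.eval_X, Polynomial.eval_zero, hP]
        rcases eq_or_ne s 0 with rfl | hs
        · exact zero_mul _
        · rw [hz s hs, mul_zero]
      exact (mul_eq_zero.1 this).resolve_left Polynomial.X_ne_zero
    apply hδ
    rw [hx₀', ← hP, hP0, Polynomial.eval_zero]
  let cc : ℕ → (Fin 3 → K) → ℕ := fun n x => conicCount (Fs p K n) (eval x (L α)) (eval x (L β))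
    (eval x (L γ)) (eval x f) (eval x g) (eval x h)
  have hmem : ∀ᶠ n in divFilter, 0 < n ∧ ∀ x : Fin 3 → K, (∀ i, x i ∈ Fs p K n) →
      (eval x (L α) ∈ Fs p K n ∧ eval x (L β) ∈ Fs p K n ∧ eval x (L γ) ∈ Fs p K n ∧
      eval x f ∈ Fs p K n ∧ eval x g ∈ Fs p K n ∧ eval x h ∈ Fs p K n) := by
    filter_upwards [eventually_pos_divFilter, eventually_eval_mem (p := p) (L α),
      eventually_eval_mem (p := p) (L β), eventually_eval_mem (p := p) (L γ),
      eventually_eval_mem (p := p) f, eventually_eval_mem (p := p) g,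
      eventually_eval_mem (p := p) h] with n hn h1 h2 h3 h4 h5 h6
    exact ⟨hn, fun x hx => ⟨h1 x hx, h2 x hx, h3 x hx, h4 x hx, h5 x hx, h6 x hx⟩⟩
  have hm1 : ∀ n, 0 < n → ∀ P : K × K, P.1 ∈ Fs p K n → P.2 ∈ Fs p K n →
      ∀ i, (![1, P.1, P.2] : Fin 3 → K) i ∈ Fs p K n := by
    intro n hn P h1 h2 i
    fin_cases i
    exacts [Fs_one_mem hn, h1, h2]
  have h4 : ∀ x y : K, (4 : Polynomial (Polynomial K)).evalEval x y = 4 := fun x y =>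
    map_ofNat (Polynomial.evalEvalRingHom x y) 4
  have hgb := card_bad_le_card_good (p := p) (ι := Fin 3)
    (![planeSlice 1 (L α), planeSlice 1 (L α), planeSlice 1 (L γ)])
    (![planeSlice 1 (L β), planeSlice 1 f, planeSlice 1 g])
    (![planeSlice 1 (L γ), planeSlice 1 h, planeSlice 1 h])
    (fun P => eval ![1, P.1, P.2] Δ = 0)
    (fun n P => 2 * (p ^ n) ^ 2 ≤ cc n ![1, P.1, P.2] + p ^ n)
    (fun n P => cc n ![1, P.1, P.2] < (p ^ n) ^ 2) ?_ ?_ ?_ h1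
    (fun P h => by rwa [evalEval_planeSlice] at h)
  rotate_left
  · filter_upwards [hmem] with n hmem P hP1 hP2 hZ i
    obtain ⟨hn, hmem⟩ := hmem
    obtain ⟨m1, m2, m3, m4, m5, m6⟩ := hmem _ (hm1 n hn P hP1 hP2)
    rw [hΔ] at hZ
    simp only [Polynomial.evalEval_sub, Polynomial.evalEval_mul, Polynomial.evalEval_pow,
      h4]
    fin_cases i
    · simp only [Fin.zero_eta, Matrix.cons_val_zero, evalEval_planeSlice]
      intro hd hi
      exact le_conicCount_Fs_of_isot hn m1 m2 m3 m4 m5 m6 hZ hd hi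
    · simp only [Fin.mk_one, Matrix.cons_val_one, Matrix.cons_val_zero, evalEval_planeSlice]
      intro hd hi
      simp only [cc]
      rw [conicCount_swap]
      refine le_conicCount_Fs_of_isot hn m1 m4 m6 m2 m5 m3 ?_ hd hi
      rw [← hZ]; simp only [conicDisc]; ring
    · simp only [Fin.reduceFinMk, Matrix.cons_val, evalEval_planeSlice]
      intro hd hi
      simp only [cc]
      rw [conicCount_rotate]
      refine le_conicCount_Fs_of_isot hn m3 m5 m6 m2 m4 m1 ?_ hd hi
      rw [← hZ]; simp only [conicDisc]; ring
  · intro n P h1 h2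
    have : p ^ n ≤ (p ^ n) ^ 2 := Nat.le_self_pow two_ne_zero _
    omega
  · filter_upwards [hmem] with n hmem P hP1 hP2 hZ hi
    obtain ⟨hn, hmem⟩ := hmem
    obtain ⟨m1, m2, m3, m4, m5, m6⟩ := hmem _ (hm1 n hn P hP1 hP2)
    rw [not_lt]
    have i0 := hi 0
    have i1 := hi 1
    have i2 := hi 2
    simp only [Polynomial.evalEval_sub, Polynomial.evalEval_mul, Polynomial.evalEval_pow,
      h4, Matrix.cons_val, evalEval_planeSlice] at i0 i1 i2
    exact sq_le_conicCount_Fs hn m1 m2 m3 m4 m5 m6 (Or.inr ⟨i0, i1, i2⟩)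
  obtain ⟨M, hM⟩ := hgb
  obtain ⟨M0, hM0⟩ := card_curvePts_le (p := p) h0
  refine ⟨1 + M0 + M, ?_⟩
  have hcst : ∀ᶠ n in divFilter, ∀ i, α i ∈ Fs p K n ∧ β i ∈ Fs p K n ∧ γ i ∈ Fs p K n := by
    rw [Filter.eventually_all]
    intro i
    filter_upwards [eventually_mem_Fs (p := p) (α i), eventually_mem_Fs (p := p) (β i),
      eventually_mem_Fs (p := p) (γ i)] with n h1 h2 h3
    exact ⟨h1, h2, h3⟩
  filter_upwards [hmem, hM, hcst] with n hmem hM hcst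
  obtain ⟨hn, hmem⟩ := hmem
  have key := lowerBound_aux hn (fun i => (hcst i).1) (fun i => (hcst i).2.1)
    (fun i => (hcst i).2.2) (fun x hx => (hmem x hx).2.2.2.1) (fun x hx => (hmem x hx).2.2.2.2.1)
    (fun x hx => (hmem x hx).2.2.2.2.2) hns hc
    (fun x => eval x Δ = 0 ∧ 2 * (p ^ n) ^ 2 ≤ cc n x + p ^ n) (fun x => cc n x < (p ^ n) ^ 2)
    ?_ ?_
  rotate_left
  · intro x _ h
    simpa only [cc, hL] using h.2
  · intro x _ h
    simpa only [cc, hL, not_lt] using h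
  have hscale : ∀ l ∈ Fs p K n, l ≠ 0 → ∀ x, cc n (l • x) = cc n x := by
    intro l hl hl0 x
    simp only [cc, hLs, hf, hg, hh]
    exact conicCount_scale hn hl hl0 _ _ _ _ _ _
  have ep := affCount_cone (K := K) n hn
    (fun x => eval x Δ = 0 ∧ 2 * (p ^ n) ^ 2 ≤ cc n x + p ^ n) (by
      intro l hl hl0 x _ h
      rw [hscale l hl hl0, hΔs, h.1, mul_zero]
      exact ⟨rfl, h.2⟩)
  have em := affCount_cone (K := K) n hn (fun x => cc n x < (p ^ n) ^ 2) (by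
      intro l hl hl0 x _ h
      rwa [hscale l hl hl0])
  have hbadΔ : ∀ x : Fin 3 → K, (∀ i, x i ∈ Fs p K n) → cc n x < (p ^ n) ^ 2 → eval x Δ = 0 := by
    intro x hx h
    by_contra hne
    obtain ⟨m1, m2, m3, m4, m5, m6⟩ := hmem _ hx
    rw [hΔ] at hne
    exact absurd (sq_le_conicCount_Fs hn m1 m2 m3 m4 m5 m6 (Or.inl hne)) (not_le.2 h)
  have b0 : ((Fs p K n ×ˢ Fs p K n).filter fun w => cc n ![0, w.1, w.2] < (p ^ n) ^ 2).card ≤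
      M0 * p ^ n := by
    refine (Finset.card_le_card fun w hw => ?_).trans (hM0 n hn)
    rw [Finset.mem_filter, Finset.mem_product] at hw
    rw [mem_curvePts, evalEval_planeSlice]
    refine ⟨hw.1, hbadΔ _ (fun i => ?_) hw.2⟩
    fin_cases i
    exacts [Fs_zero_mem hn, hw.1.1, hw.1.2]
  have b1 : ((Fs p K n ×ˢ Fs p K n).filter fun w => cc n ![1, w.1, w.2] < (p ^ n) ^ 2).card ≤
      ((Fs p K n ×ˢ Fs p K n).filter fun w => eval ![1, w.1, w.2] Δ = 0 ∧
        2 * (p ^ n) ^ 2 ≤ cc n ![1, w.1, w.2] + p ^ n).card + M * p ^ (n / 2) := by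
    refine le_trans (Finset.card_le_card fun w hw => ?_) (hM.trans
      (Nat.add_le_add_right (Finset.card_le_card fun w hw => ?_) _))
    · rw [Finset.mem_filter, Finset.mem_product] at hw
      simp only [Finset.mem_filter, mem_curvePts, evalEval_planeSlice]
      exact ⟨⟨hw.1, hbadΔ _ (hm1 n hn w hw.1.1 hw.1.2) hw.2⟩, hw.2⟩
    · simp only [Finset.mem_filter, mem_curvePts, evalEval_planeSlice] at hw
      rw [Finset.mem_filter, Finset.mem_product]
      exact ⟨hw.1.1, hw.1.2, hw.2⟩
  have hq : 0 < p ^ n := pow_pos hp.out.pos _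
  have hQ : 0 < p ^ (n / 2) := pow_pos hp.out.pos _
  set q := p ^ n
  set Q := p ^ (n / 2)
  generalize affCount (Fs p K n) (fun v => c v = 0) = N at *
  simp only [ep, em] at key
  generalize ((Fs p K n ×ˢ Fs p K n).filter fun w => cc n ![0, w.1, w.2] < q ^ 2).card = m0 at *
  generalize ((Fs p K n ×ˢ Fs p K n).filter fun w => cc n ![1, w.1, w.2] < q ^ 2).card = m1 at *
  generalize ((Fs p K n ×ˢ Fs p K n).filter fun w => eval ![1, w.1, w.2] Δ = 0 ∧
        2 * q ^ 2 ≤ cc n ![1, w.1, w.2] + q).card = p1 at *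
  generalize ((Fs p K n ×ˢ Fs p K n).filter fun w => eval ![0, w.1, w.2] Δ = 0 ∧
        2 * q ^ 2 ≤ cc n ![0, w.1, w.2] + q).card = p0 at *
  obtain ⟨r, hr⟩ : ∃ r, q = r + 1 := ⟨q - 1, by omega⟩
  rw [hr, Nat.add_sub_cancel, ← hr] at key
  have c1 : q * (m0 + r * m1) ≤ q * (M0 * q + r * (p1 + M * Q)) := by gcongr
  have c2 : q * (r * (M * Q)) ≤ q * (q * (M * Q)) := by gcongr; omega
  have c3 : q ^ 2 ≤ q ^ 2 * Q := Nat.le_mul_of_pos_right _ hQ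
  have c4 : M0 * q ^ 2 ≤ M0 * (q ^ 2 * Q) := by gcongr
  nlinarith [Nat.zero_le (q * p0)]

end

section
variable {K : Type} [Field K]

theorem exists_extend_linearIndependent {V : Type} [AddCommGroup V] [Module K V]
    [FiniteDimensional K V] {m : ℕ} (v : Fin m → V) (hv : LinearIndependent K v) (k : ℕ)
    (hk : m + k = Module.finrank K V) :
    ∃ w : Fin (m + k) → V, LinearIndependent K w ∧ ∀ i, w (Fin.castAdd k i) = v i := by
  induction k generalizing m with
  | zero => exact ⟨v, hv, fun i => rfl⟩
  | succ k ih =>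
    obtain ⟨x, hx⟩ := exists_linearIndependent_snoc_of_lt_finrank hv (by omega)
    obtain ⟨w, hw, h⟩ := ih (Fin.snoc v x) hx (by omega)
    refine ⟨fun i => w (i.cast (by omega)), hw.comp _ (Fin.cast_injective (show m + (k + 1) = m + 1 + k by omega)), fun i => ?_⟩
    have := h i.castSucc
    rw [Fin.snoc_castSucc] at this
    rw [← this]
    rfl

theorem exists_equiv_of_vectors {m k d : ℕ} (hd : m + k = d) (v : Fin m → Fin d → K)
    (hv : LinearIndependent K v) : ∃ e : (Fin d → K) ≃ₗ[K] (Fin d → K),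
      ∀ i : Fin m, e (Pi.single (Fin.castLE (by omega) i) 1) = v i := by
  subst hd
  obtain ⟨w, hw, h⟩ := exists_extend_linearIndependent v hv k (by simp)
  let b := basisOfLinearIndependentOfCardEqFinrank' w hw (by simp)
  refine ⟨b.equivFun.symm, fun i => ?_⟩
  rw [← h i, Module.Basis.equivFun_symm_apply]
  simp [b, Pi.single_apply]
  rfl

theorem exists_equiv_of_functionals {m k d : ℕ} (hd : m + k = d)
    (φ : Fin m → Module.Dual K (Fin d → K)) (hφ : LinearIndependent K φ) :
    ∃ e : (Fin d → K) ≃ₗ[K] (Fin d → K), ∀ x (i : Fin m),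
      e x (Fin.castLE (by omega) i) = φ i x := by
  subst hd
  obtain ⟨w, hw, h⟩ := exists_extend_linearIndependent φ hφ k
    (by rw [Subspace.dual_finrank_eq]; simp)
  have hspan := hw.span_eq_top_of_card_eq_finrank' (by rw [Subspace.dual_finrank_eq]; simp)
  let f : (Fin (m + k) → K) →ₗ[K] (Fin (m + k) → K) := LinearMap.pi w
  have hinj : Function.Injective f := by
    rw [← LinearMap.ker_eq_bot, LinearMap.ker_eq_bot']
    intro x hx
    rw [← Module.forall_dual_apply_eq_zero_iff K]
    intro g
    have hg : g ∈ Submodule.span K (Set.range w) := hspan ▸ Submodule.mem_top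
    induction hg using Submodule.span_induction with
    | mem y hy =>
      obtain ⟨i, rfl⟩ := hy
      exact congrFun hx i
    | zero => rfl
    | add y z _ _ h1 h2 => rw [LinearMap.add_apply, h1, h2, add_zero]
    | smul a y _ h1 => rw [LinearMap.smul_apply, h1, smul_zero]
  refine ⟨LinearEquiv.ofInjectiveEndo f hinj, fun x i => ?_⟩
  rw [← h i]
  rfl

theorem coeff_eq_zero_of_forall [Infinite K] {a b c d : K}
    (h : ∀ s : K, a + b * s + c * s ^ 2 + d * s ^ 3 = 0) : a = 0 ∧ b = 0 ∧ c = 0 ∧ d = 0 := by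
  have : (Polynomial.C d * Polynomial.X ^ 3 + Polynomial.C c * Polynomial.X ^ 2 +
      Polynomial.C b * Polynomial.X + Polynomial.C a : Polynomial K) = 0 :=
    Polynomial.funext fun s => by simpa using by linear_combination h s
  have e := fun i => congrArg (fun P => Polynomial.coeff P i) this
  have e0 := e 0
  have e1 := e 1
  have e2 := e 2
  have e3 := e 3
  simp [Polynomial.coeff_X, Polynomial.coeff_C] at e0 e1 e2 e3
  exact ⟨e0, e1, e2, e3⟩

section
variable {V : Type} [AddCommGroup V] [Module K V]

/-- The derivative of the cubic form of a trilinear form. -/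
def cubDer (T : V →ₗ[K] V →ₗ[K] V →ₗ[K] K) (v w : V) : K := T v v w + T v w v + T w v v

/-- The full polarization of the cubic form of a trilinear form. -/
def cubPolar (T : V →ₗ[K] V →ₗ[K] V →ₗ[K] K) (u v w : V) : K :=
  T u v w + T u w v + T v u w + T v w u + T w u v + T w v u

variable (T : V →ₗ[K] V →ₗ[K] V →ₗ[K] K)

theorem cub_add (x y : V) : T (x + y) (x + y) (x + y) =
    T x x x + cubDer T x y + cubDer T y x + T y y y := by
  simp only [cubDer, map_add, LinearMap.add_apply]
  ring

theorem cub_smul (a : K) (x : V) : T (a • x) (a • x) (a • x) = a ^ 3 * T x x x := by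
  simp only [map_smul, LinearMap.smul_apply, smul_eq_mul]
  ring

theorem cubDer_add_left (x y w : V) : cubDer T (x + y) w =
    cubDer T x w + cubDer T y w + cubPolar T x y w := by
  simp only [cubDer, cubPolar, map_add, LinearMap.add_apply]
  ring

theorem cubDer_smul_left (a : K) (x w : V) : cubDer T (a • x) w = a ^ 2 * cubDer T x w := by
  simp only [cubDer, map_smul, LinearMap.smul_apply, smul_eq_mul]
  ring

theorem cubDer_add_right (x y w : V) : cubDer T x (y + w) = cubDer T x y + cubDer T x w := by
  simp only [cubDer, map_add, LinearMap.add_apply]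
  ring

theorem cubDer_smul_right (a : K) (x w : V) : cubDer T x (a • w) = a * cubDer T x w := by
  simp only [cubDer, map_smul, LinearMap.smul_apply, smul_eq_mul]
  ring

theorem cubDer_self (x : V) : cubDer T x x = 3 * T x x x := by
  simp only [cubDer]
  ring

theorem cubPolar_add_left (x y u w : V) :
    cubPolar T (x + y) u w = cubPolar T x u w + cubPolar T y u w := by
  simp only [cubPolar, map_add, LinearMap.add_apply]
  ring

theorem cubPolar_smul_left (a : K) (x u w : V) :
    cubPolar T (a • x) u w = a * cubPolar T x u w := by
  simp only [cubPolar, map_smul, LinearMap.smul_apply, smul_eq_mul]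
  ring

theorem cubPolar_comm' (x y w : V) : cubPolar T x y w = cubPolar T x w y := by
  simp only [cubPolar]
  ring

theorem cubPolar_self (x w : V) : cubPolar T x x w = 2 * cubDer T x w := by
  simp only [cubPolar, cubDer]
  ring

end

/-- A function on affine five-space which in suitable coordinates only depends on three of them. -/
def IsDoubleCone (c : (Fin 5 → K) → K) : Prop :=
  ∃ e : (Fin 5 → K) ≃ₗ[K] (Fin 5 → K), ∀ w w' : Fin 5 → K, w 0 = w' 0 → w 1 = w' 1 →
    w 2 = w' 2 → c (e w) = c (e w')

theorem IsDoubleCone.of_comp {c : (Fin 5 → K) → K} (e : (Fin 5 → K) ≃ₗ[K] (Fin 5 → K))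
    (h : IsDoubleCone fun v => c (e v)) : IsDoubleCone c := by
  obtain ⟨e', h⟩ := h
  exact ⟨e'.trans e, h⟩

variable {p : ℕ} [hp : Fact p.Prime] [CharP K p] [LocFin p K]

theorem eventually_linearMap_mem {m k : ℕ} (f : (Fin m → K) →ₗ[K] (Fin k → K)) :
    ∀ᶠ n in divFilter, ∀ x : Fin m → K, (∀ i, x i ∈ Fs p K n) → ∀ i, f x i ∈ Fs p K n := by
  have h : ∀ᶠ n in divFilter, ∀ i j, f (Pi.single j 1) i ∈ Fs p K n := by
    rw [Filter.eventually_all]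
    intro i
    rw [Filter.eventually_all]
    exact fun j => eventually_mem_Fs _
  filter_upwards [h, eventually_pos_divFilter] with n h hn x hx i
  rw [LinearMap.pi_apply_eq_sum_univ, Finset.sum_apply]
  have : ∀ j ∈ Finset.univ, (x j • f fun k => if j = k then 1 else 0) i ∈ FsField p K n := by
    intro j _
    rw [mem_FsField hn, Pi.smul_apply, smul_eq_mul]
    refine Fs_mul_mem hn (hx j) ?_
    convert h i j using 3
    simp [Pi.single_apply, eq_comm]
  exact (mem_FsField hn).1 (sum_mem this)

theorem LowerBound.of_comp {c : (Fin 5 → K) → K} (e : (Fin 5 → K) ≃ₗ[K] (Fin 5 → K))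
    (h : LowerBound p fun v => c (e v)) : LowerBound p c := by
  classical
  obtain ⟨M, h⟩ := h
  refine ⟨M, ?_⟩
  filter_upwards [h, eventually_linearMap_mem (p := p) e.toLinearMap] with n h hm
  refine h.trans (Nat.add_le_add_right (Finset.card_le_card_of_injOn e ?_ e.injective.injOn) _)
  intro v hv
  rw [Finset.mem_coe, Finset.mem_filter, Fintype.mem_piFinset] at hv ⊢
  exact ⟨hm v hv.1, hv.2⟩

end

section
variable {K : Type} [Field K]

theorem eval_eq_zero_of_forall_ne [Infinite K] {P : Polynomial K} (h : ∀ s, s ≠ 0 → P.eval s = 0)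
    (s : K) : P.eval s = 0 := by
  have : Polynomial.X * P = 0 := Polynomial.funext fun s => by
    rw [Polynomial.eval_mul, Polynomial.eval_X, Polynomial.eval_zero]
    rcases eq_or_ne s 0 with rfl | hs
    · exact zero_mul _
    · rw [h s hs, mul_zero]
  rw [(mul_eq_zero.1 this).resolve_left Polynomial.X_ne_zero, Polynomial.eval_zero]

theorem eval_aeval_curve {m : ℕ} (R : MvPolynomial (Fin m) K) (γ : Fin m → Polynomial K) (s : K) :
    (aeval γ R).eval s = eval (fun i => (γ i).eval s) R := by
  have : (Polynomial.evalRingHom s).comp (aeval (R := K) γ).toRingHom =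
      eval (fun i => (γ i).eval s) := by
    apply MvPolynomial.ringHom_ext
    · intro r; simp
    · intro i; simp
  exact RingHom.congr_fun this R

theorem evalEval_eval₂Hom {m : ℕ} (R : MvPolynomial (Fin m) K)
    (Ψ : Fin m → Polynomial (Polynomial K)) (x y : K) :
    (eval₂Hom (Polynomial.C.comp Polynomial.C) Ψ R).evalEval x y =
      eval (fun i => (Ψ i).evalEval x y) R := by
  have : (Polynomial.evalEvalRingHom x y).comp (eval₂Hom (Polynomial.C.comp Polynomial.C) Ψ) =
      eval (fun i => (Ψ i).evalEval x y) := by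
    apply MvPolynomial.ringHom_ext
    · intro r; simp
    · intro i; simp
  exact RingHom.congr_fun this R

variable {p : ℕ} [hp : Fact p.Prime] [CharP K p]

theorem affCount_add_le {m : ℕ} (S : Finset K) {P P' P'' : (Fin m → K) → Prop}
    (h : ∀ x, P x → P'' x) (h' : ∀ x, P' x → P'' x) (hd : ∀ x, P x → ¬ P' x) :
    affCount S P + affCount S P' ≤ affCount S P'' := by
  classical
  rw [affCount, affCount, ← Finset.card_union_of_disjoint]
  · refine Finset.card_le_card fun x hx => ?_
    rw [Finset.mem_union, Finset.mem_filter, Finset.mem_filter] at hx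
    rw [Finset.mem_filter]
    rcases hx with hx | hx
    · exact ⟨hx.1, h x hx.2⟩
    · exact ⟨hx.1, h' x hx.2⟩
  · rw [Finset.disjoint_left]
    intro x hx hx'
    rw [Finset.mem_filter] at hx hx'
    exact hd x hx.2 hx'.2

theorem affCount_le_add {m : ℕ} (S : Finset K) {P P' P'' : (Fin m → K) → Prop}
    (h : ∀ x, P'' x → P x ∨ P' x) : affCount S P'' ≤ affCount S P + affCount S P' := by
  classical
  rw [affCount, affCount, affCount]
  refine (Finset.card_le_card fun x hx => ?_).trans (Finset.card_union_le _ _)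
  rw [Finset.mem_filter] at hx
  rw [Finset.mem_union, Finset.mem_filter, Finset.mem_filter]
  rcases h x hx.2 with h | h
  · exact Or.inl ⟨hx.1, h⟩
  · exact Or.inr ⟨hx.1, h⟩

variable [IsAlgClosed K]

/-- A coordinate determined by the others costs one dimension. -/
theorem affCount_le_of_injOn {m k n : ℕ} (hn : 0 < n) (σ : Fin k → Fin m) {P : (Fin m → K) → Prop}
    (h : ∀ x y, P x → P y → (∀ i, x (σ i) = y (σ i)) → x = y) :
    affCount (Fs p K n) P ≤ (p ^ n) ^ k := by
  classical
  rw [← card_Fs (K := K) hn, ← Fintype.card_piFinset_const]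
  refine Finset.card_le_card_of_injOn (fun x i => x (σ i)) ?_ ?_
  · intro x hx
    simp only [Finset.mem_coe, Finset.mem_filter, Fintype.mem_piFinset] at hx ⊢
    exact fun i => hx.1 _
  · intro x hx y hy hxy
    simp only [Finset.mem_coe, Finset.mem_filter] at hx hy
    exact h x y hx.2 hy.2 (congrFun hxy)

theorem sq_le_affCount {m n : ℕ} (hn : 0 < n) (σ : K × K → Fin m → K)
    (hσ : Function.Injective σ) (hm : ∀ w : K × K, w.1 ∈ Fs p K n → w.2 ∈ Fs p K n →
      ∀ i, σ w i ∈ Fs p K n) {P : (Fin m → K) → Prop} (h : ∀ w, P (σ w)) :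
    (p ^ n) ^ 2 ≤ affCount (Fs p K n) P := by
  classical
  rw [← card_Fs (K := K) hn, pow_two, ← Finset.card_product]
  refine Finset.card_le_card_of_injOn σ ?_ hσ.injOn
  intro x hx
  simp only [Finset.mem_coe, Finset.mem_filter, Fintype.mem_piFinset, Finset.mem_product] at hx ⊢
  exact ⟨hm x hx.1 hx.2, h x⟩

variable [LocFin p K]

theorem sq_le_affCount_or {m : ℕ} (R : MvPolynomial (Fin m) K)
    (Ψ : Fin m → Polynomial (Polynomial K)) {i₀ i₁ i₂ : Fin m} (h0 : Ψ i₀ = 1)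
    (h1 : Ψ i₁ = Polynomial.C Polynomial.X) (h2 : Ψ i₂ = Polynomial.X)
    {P : (Fin m → K) → Prop} (hP : ∀ (l : K) (x y : K), l ≠ 0 →
      eval (fun i => (Ψ i).evalEval x y) R = 0 → P (l • fun i => (Ψ i).evalEval x y)) :
    (∃ M : ℕ, ∀ᶠ n in divFilter,
      (p ^ n) ^ 2 ≤ affCount (Fs p K n) P + M * (p ^ n * p ^ (n / 2))) ∨
    ∃ c : K, c ≠ 0 ∧ ∀ x y, eval (fun i => (Ψ i).evalEval x y) R = c := by
  classical
  rcases card_curvePts_ge_or (p := p) (eval₂Hom (Polynomial.C.comp Polynomial.C) Ψ R) with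
    ⟨M, hM⟩ | ⟨c, hc, h⟩
  swap
  · exact Or.inr ⟨c, hc, fun x y => by rw [← h x y, evalEval_eval₂Hom]⟩
  refine Or.inl ⟨M + 1, ?_⟩
  have hΨ : ∀ᶠ n in divFilter, ∀ i, ∀ x ∈ Fs p K n, ∀ y ∈ Fs p K n,
      (Ψ i).evalEval x y ∈ Fs p K n := by
    rw [Filter.eventually_all]
    exact fun i => eventually_evalEval_mem _
  filter_upwards [hM, hΨ, eventually_pos_divFilter] with n hM hΨ hn
  have key : (p ^ n - 1) * (curvePts p (eval₂Hom (Polynomial.C.comp Polynomial.C) Ψ R) n).card ≤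
      affCount (Fs p K n) P := by
    rw [← card_Fs (K := K) hn, ← Finset.card_erase_of_mem (Fs_zero_mem hn), ← Finset.card_product]
    refine Finset.card_le_card_of_injOn
      (fun u => u.1 • fun i => (Ψ i).evalEval u.2.1 u.2.2) ?_ ?_
    · rintro ⟨l, x, y⟩ hu
      simp only [Finset.mem_coe, Finset.mem_product, Finset.mem_erase, mem_curvePts,
        evalEval_eval₂Hom] at hu
      simp only [Finset.mem_coe, Finset.mem_filter, Fintype.mem_piFinset]
      exact ⟨fun i => Fs_mul_mem hn hu.1.2 (hΨ i x hu.2.1.1 y hu.2.1.2),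
        hP l x y hu.1.1 hu.2.2⟩
    · rintro ⟨l, x, y⟩ hu ⟨l', x', y'⟩ hu' he
      simp only [Finset.mem_coe, Finset.mem_product, Finset.mem_erase] at hu hu'
      have e0 := congrFun he i₀
      have e1 := congrFun he i₁
      have e2 := congrFun he i₂
      simp only [Pi.smul_apply, smul_eq_mul, h0, h1, h2, Polynomial.evalEval_one, mul_one,
        Polynomial.evalEval_C, Polynomial.eval_X, Polynomial.evalEval_X] at e0 e1 e2
      subst e0
      rw [mul_left_cancel₀ hu.1.1 e1, mul_left_cancel₀ hu.1.1 e2]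
  have hq : 0 < p ^ n := pow_pos hp.out.pos _
  have hQ : 0 < p ^ (n / 2) := pow_pos hp.out.pos _
  generalize (curvePts p (eval₂Hom (Polynomial.C.comp Polynomial.C) Ψ R) n).card = N at *
  generalize affCount (Fs p K n) P = A at *
  generalize p ^ (n / 2) = Q at *
  generalize p ^ n = q at *
  obtain ⟨r, rfl⟩ : ∃ r, q = r + 1 := ⟨q - 1, by omega⟩
  rw [Nat.add_sub_cancel] at key
  have c1 : r * (r + 1) ≤ r * (N + M * Q) := Nat.mul_le_mul_left _ hM
  have c2 : r + 1 ≤ (r + 1) * Q := Nat.le_mul_of_pos_right _ hQ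
  nlinarith [Nat.zero_le (M * Q)]

theorem LowerBound.of_count {Qf Kf : MvPolynomial (Fin 4) K}
    (h : ∃ M : ℕ, ∀ᶠ n in divFilter, affCount (Fs p K n) (fun y => eval y Qf = 0) ≤
      p ^ n * affCount (Fs p K n) (fun y => eval y Qf = 0 ∧ eval y Kf = 0) +
        M * ((p ^ n) ^ 2 * p ^ (n / 2))) :
    LowerBound p fun v : Fin 5 → K => v 0 * eval (Fin.tail v) Qf + eval (Fin.tail v) Kf := by
  classical
  obtain ⟨M, h⟩ := h
  refine ⟨M, ?_⟩
  filter_upwards [h, eventually_pos_divFilter, eventually_eval_mem (p := p) Qf,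
    eventually_eval_mem (p := p) Kf] with n h hn hQ hK
  have e1 : affCount (Fs p K n) (fun y => eval y Qf = 0) +
      affCount (Fs p K n) (fun y => ¬ eval y Qf = 0) = (p ^ n) ^ 4 := by
    have := Finset.card_filter_add_card_filter_not (s := Fintype.piFinset fun _ : Fin 4 => Fs p K n)
      (fun y : Fin 4 → K => eval y Qf = 0)
    rw [Fintype.card_piFinset_const, card_Fs hn] at this
    rw [← this]
    unfold affCount
    congr!
  have e2 : affCount (Fs p K n) (fun y => ¬ eval y Qf = 0) ≤
      affCount (Fs p K n) (fun v : Fin 5 → K => ¬ eval (Fin.tail v) Qf = 0 ∧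
        v 0 * eval (Fin.tail v) Qf + eval (Fin.tail v) Kf = 0) := by
    refine Finset.card_le_card_of_injOn
      (fun y => (Fin.cons (- eval y Kf * (eval y Qf)⁻¹) y : Fin 5 → K)) ?_ ?_
    · intro y hy
      simp only [Finset.mem_coe, Finset.mem_filter, Fintype.mem_piFinset] at hy ⊢
      rw [Fin.tail_cons, Fin.cons_zero]
      refine ⟨fun i => ?_, hy.2, ?_⟩
      · refine Fin.cases ?_ (fun j => ?_) i
        · exact Fs_mul_mem hn (Fs_neg_mem hn (hK y hy.1)) (Fs_inv_mem hn (hQ y hy.1))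
        · rw [Fin.cons_succ]; exact hy.1 j
      · rw [inv_mul_cancel_right₀ hy.2, neg_add_cancel]
    · intro y _ y' _ he
      have := congrArg Fin.tail he
      rwa [Fin.tail_cons, Fin.tail_cons] at this
  have e3 : p ^ n * affCount (Fs p K n) (fun y => eval y Qf = 0 ∧ eval y Kf = 0) ≤
      affCount (Fs p K n) (fun v : Fin 5 → K => eval (Fin.tail v) Qf = 0 ∧
        v 0 * eval (Fin.tail v) Qf + eval (Fin.tail v) Kf = 0) := by
    rw [← card_Fs (K := K) hn, affCount, ← Finset.card_product]
    refine Finset.card_le_card_of_injOn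
      (fun u => (Fin.cons u.1 u.2 : Fin 5 → K)) ?_ ?_
    · intro u hu
      simp only [Finset.mem_coe, Finset.mem_filter, Fintype.mem_piFinset,
        Finset.mem_product] at hu ⊢
      rw [Fin.tail_cons, Fin.cons_zero, hu.2.2.1, hu.2.2.2]
      refine ⟨fun i => ?_, rfl, by simp⟩
      refine Fin.cases ?_ (fun j => ?_) i
      · exact hu.1
      · exact hu.2.1 j
    · intro u _ u' _ he
      have h1 := congrArg Fin.tail he
      have h2 := congrFun he 0
      rw [Fin.tail_cons, Fin.tail_cons] at h1
      exact Prod.ext h2 h1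
  have e4 := affCount_add_le (Fs p K n) (P := fun v : Fin 5 → K => ¬ eval (Fin.tail v) Qf = 0 ∧
        v 0 * eval (Fin.tail v) Qf + eval (Fin.tail v) Kf = 0)
      (P' := fun v : Fin 5 → K => eval (Fin.tail v) Qf = 0 ∧
        v 0 * eval (Fin.tail v) Qf + eval (Fin.tail v) Kf = 0)
      (P'' := fun v => v 0 * eval (Fin.tail v) Qf + eval (Fin.tail v) Kf = 0)
      (fun _ h => h.2) (fun _ h => h.2) (fun _ h h' => h.1 h'.1)
  omega

end

section
variable {K : Type} [Field K]

/-- The polynomial of the cubic form of a trilinear form. -/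
noncomputable def cubicPoly {m : ℕ} (T : (Fin m → K) →ₗ[K] (Fin m → K) →ₗ[K] (Fin m → K) →ₗ[K] K) :
    MvPolynomial (Fin m) K :=
  ∑ i, ∑ j, ∑ k, C (T (Pi.single k 1) (Pi.single j 1) (Pi.single i 1)) * (X i * X j * X k)

theorem eval_cubicPoly {m : ℕ} (T : (Fin m → K) →ₗ[K] (Fin m → K) →ₗ[K] (Fin m → K) →ₗ[K] K)
    (x : Fin m → K) : eval x (cubicPoly T) = T x x x := by
  have hx : x = ∑ i, x i • Pi.single i (1 : K) := by
    rw [← pi_eq_sum_univ' x]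
  conv_rhs => rw [hx]
  simp only [cubicPoly, map_sum, map_mul, eval_C, eval_X, LinearMap.sum_apply, map_smul,
    LinearMap.smul_apply, smul_eq_mul]
  refine Finset.sum_congr rfl fun i _ => ?_
  rw [Finset.mul_sum]
  refine Finset.sum_congr rfl fun j _ => ?_
  rw [Finset.mul_sum, Finset.mul_sum]
  refine Finset.sum_congr rfl fun k _ => ?_
  ring

theorem eval_eq_zero_of_curve [Infinite K] {m : ℕ} {R : MvPolynomial (Fin m) K}
    (γ : Fin m → Polynomial K) (P : Polynomial K)
    (h : ∀ s, s ≠ 0 → eval (fun i => (γ i).eval s) R = P.eval s) (h0 : P.eval 0 = 0) :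
    eval (fun i => (γ i).eval 0) R = 0 := by
  have := eval_eq_zero_of_forall_ne (P := aeval γ R - P) (fun s hs => by
    rw [Polynomial.eval_sub, eval_aeval_curve, h s hs, sub_self]) 0
  rwa [Polynomial.eval_sub, eval_aeval_curve, h0, sub_zero] at this

theorem linearIndependent_of_dual {V ι : Type} [AddCommGroup V] [Module K V] [Fintype ι]
    [DecidableEq ι] (φ : ι → Module.Dual K V) (w : ι → V)
    (h : ∀ i j, φ i (w j) = if i = j then 1 else 0) : LinearIndependent K φ := by
  rw [Fintype.linearIndependent_iff]
  intro g hg j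
  have := LinearMap.congr_fun hg (w j)
  simpa [h] using this

theorem IsDoubleCone.of_functionals {c : (Fin 5 → K) → K} (φ : Fin 3 → Module.Dual K (Fin 5 → K))
    (hφ : LinearIndependent K φ) (h : ∀ v v', (∀ i, φ i v = φ i v') → c v = c v') :
    IsDoubleCone c := by
  obtain ⟨e, he⟩ := exists_equiv_of_functionals (show 3 + 2 = 5 from rfl) φ hφ
  refine ⟨e.symm, fun w w' h0 h1 h2 => h _ _ fun i => ?_⟩
  rw [← he, ← he, e.apply_symm_apply, e.apply_symm_apply]
  fin_cases i
  · exact h0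
  · exact h1
  · exact h2

variable {p : ℕ} [hp : Fact p.Prime] [CharP K p]

/-- The set defined by `P` has at least `q ^ 2 + O(q ^ (3/2))` points. -/
def SqBound (p : ℕ) [Fact p.Prime] [CharP K p] {m : ℕ} (P : (Fin m → K) → Prop) : Prop :=
  ∃ M : ℕ, ∀ᶠ n in divFilter, (p ^ n) ^ 2 ≤ affCount (Fs p K n) P + M * (p ^ n * p ^ (n / 2))

variable [IsAlgClosed K]

theorem SqBound.of_injective {m : ℕ} (σ : K × K → Fin m → K) (hσ : Function.Injective σ)
    (hm : ∀ n, 0 < n → ∀ w : K × K, w.1 ∈ Fs p K n → w.2 ∈ Fs p K n →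
      ∀ i, σ w i ∈ Fs p K n) {P : (Fin m → K) → Prop} (h : ∀ w, P (σ w)) : SqBound p P := by
  refine ⟨0, ?_⟩
  filter_upwards [eventually_pos_divFilter] with n hn
  exact (sq_le_affCount hn σ hσ (hm n hn) h).trans (Nat.le_add_right _ _)

variable [LocFin p K]

theorem LowerBound.of_sqBound {Qf Kf : MvPolynomial (Fin 4) K}
    (h1 : ∃ M : ℕ, ∀ n, 0 < n →
      affCount (Fs p K n) (fun y => eval y Qf = 0) ≤ (p ^ n) ^ 3 + M * (p ^ n) ^ 2)
    (h2 : SqBound p fun y => eval y Qf = 0 ∧ eval y Kf = 0) :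
    LowerBound p fun v : Fin 5 → K => v 0 * eval (Fin.tail v) Qf + eval (Fin.tail v) Kf := by
  obtain ⟨M, h1⟩ := h1
  obtain ⟨N, h2⟩ := h2
  refine LowerBound.of_count ⟨M + N, ?_⟩
  filter_upwards [h2, eventually_pos_divFilter] with n h2 hn
  refine (h1 n hn).trans ?_
  have hQ : 0 < p ^ (n / 2) := pow_pos hp.out.pos _
  generalize affCount (Fs p K n) (fun y => eval y Qf = 0 ∧ eval y Kf = 0) = A at *
  generalize p ^ (n / 2) = Q at *
  generalize p ^ n = q at *
  have c1 := Nat.mul_le_mul_left q h2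
  have c2 : M * q ^ 2 ≤ M * q ^ 2 * Q := Nat.le_mul_of_pos_right _ hQ
  nlinarith

theorem SqBound.or_const {m : ℕ} (T : (Fin m → K) →ₗ[K] (Fin m → K) →ₗ[K] (Fin m → K) →ₗ[K] K)
    (Ψ : Fin m → Polynomial (Polynomial K)) {i₀ i₁ i₂ : Fin m} (h0 : Ψ i₀ = 1)
    (h1 : Ψ i₁ = Polynomial.C Polynomial.X) (h2 : Ψ i₂ = Polynomial.X)
    (σ : K → K → Fin m → K) (hσ : ∀ x y i, (Ψ i).evalEval x y = σ x y i)
    {P : (Fin m → K) → Prop} (hP : ∀ (l : K) (x y : K), l ≠ 0 →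
      T (l • σ x y) (l • σ x y) (l • σ x y) = 0 → P (l • σ x y)) :
    SqBound p P ∨ ∃ c : K, c ≠ 0 ∧ ∀ x y, T (σ x y) (σ x y) (σ x y) = c := by
  have := sq_le_affCount_or (p := p) (cubicPoly T) Ψ h0 h1 h2 (P := P)
  simp only [hσ, eval_cubicPoly] at this
  exact this fun l x y hl h => hP l x y hl (by rw [cub_smul, h, mul_zero])

theorem cub_eq_zero_of_curve {m : ℕ}
    (T : (Fin m → K) →ₗ[K] (Fin m → K) →ₗ[K] (Fin m → K) →ₗ[K] K)
    (γ : Fin m → Polynomial K) (σ : K → Fin m → K) (hσ : ∀ s i, (γ i).eval s = σ s i)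
    (P : Polynomial K) (h : ∀ s, s ≠ 0 → T (σ s) (σ s) (σ s) = P.eval s) (h0 : P.eval 0 = 0) :
    T (σ 0) (σ 0) (σ 0) = 0 := by
  have hinf : Infinite K := IsAlgClosed.instInfinite
  have := eval_eq_zero_of_curve (R := cubicPoly T) γ P
  simp only [hσ, eval_cubicPoly] at this
  exact this h h0

theorem cub_eq_zero_of_const_zero {T : (Fin 4 → K) →ₗ[K] (Fin 4 → K) →ₗ[K] (Fin 4 → K) →ₗ[K] K}
    {c : K} (h : ∀ x y, T ![0, 1, x, y] ![0, 1, x, y] ![0, 1, x, y] = c) (a b : K) :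
    T ![0, 0, a, b] ![0, 0, a, b] ![0, 0, a, b] = 0 := by
  refine cub_eq_zero_of_curve T ![0, Polynomial.X, Polynomial.C a, Polynomial.C b]
    (fun s => ![0, s, a, b]) ?_ (Polynomial.C c * Polynomial.X ^ 3) (fun s hs => ?_) (by simp)
  · intro s i
    fin_cases i <;> simp
  · have e : ![0, s, a, b] = s • ![0, 1, a / s, b / s] := by
      ext i
      fin_cases i <;> simp <;> field_simp
    rw [e, cub_smul, h]
    simp
    ring

theorem sqBound_of_forall_zero_zero {P : (Fin 4 → K) → Prop} (h : ∀ a b, P ![0, 0, a, b]) :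
    SqBound p P := by
  refine SqBound.of_injective (fun w => ![0, 0, w.1, w.2]) ?_ ?_ fun w => h _ _
  · intro w w' h
    exact Prod.ext (congrFun h 2) (congrFun h 3)
  · intro n hn w h1 h2 i
    fin_cases i
    · exact Fs_zero_mem hn
    · exact Fs_zero_mem hn
    · exact h1
    · exact h2

theorem lowerBound_sq (T : (Fin 4 → K) →ₗ[K] (Fin 4 → K) →ₗ[K] (Fin 4 → K) →ₗ[K] K) :
    LowerBound p fun v : Fin 5 → K => v 0 * (Fin.tail v 0) ^ 2 +
      T (Fin.tail v) (Fin.tail v) (Fin.tail v) := by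
  have := LowerBound.of_sqBound (p := p) (Qf := X 0 ^ 2) (Kf := cubicPoly T) ?_ ?_
  · simpa only [map_pow, eval_X, eval_cubicPoly] using this
  · refine ⟨0, fun n hn => ?_⟩
    rw [zero_mul, add_zero]
    refine affCount_le_of_injOn hn ![1, 2, 3] ?_
    intro x y hx hy h
    have hx : x 0 = 0 := by simpa using hx
    have hy : y 0 = 0 := by simpa using hy
    funext i
    fin_cases i
    · exact hx.trans hy.symm
    · exact h 0
    · exact h 1
    · exact h 2
  · simp only [map_pow, eval_X, eval_cubicPoly]
    rcases SqBound.or_const (p := p) T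
      ![0, 1, Polynomial.C Polynomial.X, Polynomial.X] (i₀ := 1) (i₁ := 2) (i₂ := 3) rfl rfl rfl
      (fun x y => ![0, 1, x, y]) (fun x y i => by fin_cases i <;> simp [Polynomial.evalEval_C])
      (P := fun y => y 0 ^ 2 = 0 ∧ T y y y = 0)
      (fun l x y hl h => ⟨by simp, h⟩) with h | ⟨c, hc, h⟩
    · exact h
    · exact sqBound_of_forall_zero_zero fun a b => ⟨by simp, cub_eq_zero_of_const_zero h a b⟩

theorem lowerBound_mul_add_sq (T : (Fin 4 → K) →ₗ[K] (Fin 4 → K) →ₗ[K] (Fin 4 → K) →ₗ[K] K) :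
    LowerBound p fun v : Fin 5 → K => v 0 * (Fin.tail v 0 * Fin.tail v 1 + Fin.tail v 2 ^ 2) +
      T (Fin.tail v) (Fin.tail v) (Fin.tail v) := by
  have := LowerBound.of_sqBound (p := p) (Qf := X 0 * X 1 + X 2 ^ 2) (Kf := cubicPoly T) ?_ ?_
  · simpa only [map_pow, map_mul, map_add, eval_X, eval_cubicPoly] using this
  · refine ⟨1, fun n hn => ?_⟩
    simp only [map_pow, map_mul, map_add, eval_X]
    refine (affCount_le_add (P := fun x => x 1 ≠ 0 ∧ x 0 * x 1 + x 2 ^ 2 = 0)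
      (P' := fun x => x 1 = 0 ∧ x 2 = 0) _ ?_).trans (Nat.add_le_add ?_ ?_)
    · intro x hx
      by_cases h1 : x 1 = 0
      · rw [h1, mul_zero, zero_add] at hx
        exact Or.inr ⟨h1, pow_eq_zero_iff (by norm_num) |>.1 hx⟩
      · exact Or.inl ⟨h1, hx⟩
    · refine affCount_le_of_injOn hn ![1, 2, 3] ?_
      intro x y hx hy h
      have e1 : x 1 = y 1 := h 0
      have e2 : x 2 = y 2 := h 1
      funext i
      fin_cases i
      · refine mul_right_cancel₀ hx.1 ?_
        have := hx.2.trans hy.2.symm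
        rw [← e1, ← e2] at this
        exact add_right_cancel this
      · exact h 0
      · exact h 1
      · exact h 2
    · rw [one_mul]
      refine affCount_le_of_injOn hn ![0, 3] ?_
      intro x y hx hy h
      funext i
      fin_cases i
      · exact h 0
      · exact hx.1.trans hy.1.symm
      · exact hx.2.trans hy.2.symm
      · exact h 1
  · simp only [map_pow, map_mul, map_add, eval_X, eval_cubicPoly]
    rcases SqBound.or_const (p := p) T
      ![- Polynomial.C Polynomial.X ^ 2, 1, Polynomial.C Polynomial.X, Polynomial.X]
      (i₀ := 1) (i₁ := 2) (i₂ := 3) rfl rfl rfl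
      (fun x y => ![-x ^ 2, 1, x, y]) (fun x y i => by fin_cases i <;> simp [Polynomial.evalEval_C])
      (P := fun y => y 0 * y 1 + y 2 ^ 2 = 0 ∧ T y y y = 0)
      (fun l x y hl h => ⟨by simp; ring, h⟩) with h | ⟨c, hc, h⟩
    · exact h
    · refine SqBound.of_injective (fun w => ![w.1, 0, 0, w.2]) ?_ ?_ ?_
      · intro w w' h
        exact Prod.ext (congrFun h 0) (congrFun h 3)
      · intro n hn w h1 h2 i
        fin_cases i
        · exact h1
        · exact Fs_zero_mem hn
        · exact Fs_zero_mem hn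
        · exact h2
      · rintro ⟨u, b⟩
        refine ⟨by simp, ?_⟩
        obtain ⟨r, hr⟩ := IsAlgClosed.exists_pow_nat_eq (-u) (show 0 < 2 by norm_num)
        have := cub_eq_zero_of_curve T
          ![Polynomial.C u, Polynomial.X ^ 2, Polynomial.C r * Polynomial.X, Polynomial.C b]
          (fun s => ![u, s ^ 2, r * s, b]) ?_ (Polynomial.C c * Polynomial.X ^ 6) (fun s hs => ?_)
          (by simp)
        · simpa using this
        · intro s i
          fin_cases i <;> simp
        · have e : ![u, s ^ 2, r * s, b] = s ^ 2 • ![- (r / s) ^ 2, 1, r / s, b / s ^ 2] := by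
            ext i
            fin_cases i
            · simp [div_pow, hr]; field_simp
            · simp
            · simp; field_simp
            · simp; field_simp
          rw [e, cub_smul, h]
          simp
          ring

theorem lowerBound_mul_add_mul (T : (Fin 4 → K) →ₗ[K] (Fin 4 → K) →ₗ[K] (Fin 4 → K) →ₗ[K] K) :
    LowerBound p fun v : Fin 5 → K => v 0 * (Fin.tail v 0 * Fin.tail v 1 +
      Fin.tail v 2 * Fin.tail v 3) + T (Fin.tail v) (Fin.tail v) (Fin.tail v) := by
  have := LowerBound.of_sqBound (p := p) (Qf := X 0 * X 1 + X 2 * X 3) (Kf := cubicPoly T) ?_ ?_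
  · simpa only [map_mul, map_add, eval_X, eval_cubicPoly] using this
  · refine ⟨2, fun n hn => ?_⟩
    simp only [map_mul, map_add, eval_X]
    refine (affCount_le_add (P := fun x => x 1 ≠ 0 ∧ x 0 * x 1 + x 2 * x 3 = 0)
      (P' := fun x => x 1 = 0 ∧ (x 2 = 0 ∨ x 3 = 0)) _ ?_).trans (Nat.add_le_add ?_ ?_)
    · intro x hx
      by_cases h1 : x 1 = 0
      · rw [h1, mul_zero, zero_add] at hx
        exact Or.inr ⟨h1, mul_eq_zero.1 hx⟩
      · exact Or.inl ⟨h1, hx⟩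
    · refine affCount_le_of_injOn hn ![1, 2, 3] ?_
      intro x y hx hy h
      have e1 : x 1 = y 1 := h 0
      have e2 : x 2 = y 2 := h 1
      have e3 : x 3 = y 3 := h 2
      funext i
      fin_cases i
      · refine mul_right_cancel₀ hx.1 ?_
        have := hx.2.trans hy.2.symm
        rw [← e1, ← e2, ← e3] at this
        exact add_right_cancel this
      · exact h 0
      · exact h 1
      · exact h 2
    · rw [two_mul]
      refine (affCount_le_add (P := fun x => x 1 = 0 ∧ x 2 = 0)
        (P' := fun x => x 1 = 0 ∧ x 3 = 0) _ ?_).trans (Nat.add_le_add ?_ ?_)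
      · rintro x ⟨h1, h2 | h2⟩
        · exact Or.inl ⟨h1, h2⟩
        · exact Or.inr ⟨h1, h2⟩
      · refine affCount_le_of_injOn hn ![0, 3] ?_
        intro x y hx hy h
        funext i
        fin_cases i
        · exact h 0
        · exact hx.1.trans hy.1.symm
        · exact hx.2.trans hy.2.symm
        · exact h 1
      · refine affCount_le_of_injOn hn ![0, 2] ?_
        intro x y hx hy h
        funext i
        fin_cases i
        · exact h 0
        · exact hx.1.trans hy.1.symm
        · exact h 1
        · exact hx.2.trans hy.2.symm
  · simp only [map_mul, map_add, eval_X, eval_cubicPoly]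
    rcases SqBound.or_const (p := p) T
      ![- (Polynomial.C Polynomial.X * Polynomial.X), 1, Polynomial.C Polynomial.X, Polynomial.X]
      (i₀ := 1) (i₁ := 2) (i₂ := 3) rfl rfl rfl
      (fun x y => ![- (x * y), 1, x, y]) (fun x y i => by fin_cases i <;> simp [Polynomial.evalEval_C])
      (P := fun y => y 0 * y 1 + y 2 * y 3 = 0 ∧ T y y y = 0)
      (fun l x y hl h => ⟨by simp; ring, h⟩) with h | ⟨c, hc, h⟩
    · exact h
    · refine SqBound.of_injective (fun w => ![w.1, 0, 0, w.2]) ?_ ?_ ?_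
      · intro w w' h
        exact Prod.ext (congrFun h 0) (congrFun h 3)
      · intro n hn w h1 h2 i
        fin_cases i
        · exact h1
        · exact Fs_zero_mem hn
        · exact Fs_zero_mem hn
        · exact h2
      · rintro ⟨u, b⟩
        refine ⟨by simp, ?_⟩
        have key : ∀ b, b ≠ 0 → T ![u, 0, 0, b] ![u, 0, 0, b] ![u, 0, 0, b] = 0 := by
          intro b hb
          have := cub_eq_zero_of_curve T
            ![Polynomial.C u, Polynomial.X, Polynomial.C (-u / b) * Polynomial.X, Polynomial.C b]
            (fun s => ![u, s, -u / b * s, b]) ?_ (Polynomial.C c * Polynomial.X ^ 3)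
            (fun s hs => ?_) (by simp)
          · simpa using this
          · intro s i
            fin_cases i <;> simp
          · have e : ![u, s, -u / b * s, b] = s • ![- (-u / b * (b / s)), 1, -u / b, b / s] := by
              ext i
              fin_cases i <;> simp <;> field_simp
            rw [e, cub_smul, h]
            simp
            ring
        rcases eq_or_ne b 0 with rfl | hb
        · exact cub_eq_zero_of_curve T ![Polynomial.C u, 0, 0, Polynomial.X]
            (fun s => ![u, 0, 0, s]) (fun s i => by fin_cases i <;> simp) 0
            (fun s hs => by rw [key s hs, Polynomial.eval_zero]) (by simp)
        · exact key b hb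

end

section
variable {K : Type} [Field K] {p : ℕ} [hp : Fact p.Prime] [CharP K p] [IsAlgClosed K]

theorem cub_of_const {T : (Fin 4 → K) →ₗ[K] (Fin 4 → K) →ₗ[K] (Fin 4 → K) →ₗ[K] K}
    {c : K} (h : ∀ x y, T ![0, 1, x, y] ![0, 1, x, y] ![0, 1, x, y] = c) (s a b : K) :
    T ![0, s, a, b] ![0, s, a, b] ![0, s, a, b] = c * s ^ 3 := by
  rcases eq_or_ne s 0 with rfl | hs
  · rw [cub_eq_zero_of_const_zero h]; ring
  · have e : ![0, s, a, b] = s • ![0, 1, a / s, b / s] := by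
      ext i
      fin_cases i <;> simp <;> field_simp
    rw [e, cub_smul, h, mul_comm]

theorem cub_of_const' {T : (Fin 4 → K) →ₗ[K] (Fin 4 → K) →ₗ[K] (Fin 4 → K) →ₗ[K] K}
    {c : K} (h : ∀ x y, T ![1, 0, x, y] ![1, 0, x, y] ![1, 0, x, y] = c) (s a b : K) :
    T ![s, 0, a, b] ![s, 0, a, b] ![s, 0, a, b] = c * s ^ 3 := by
  have key : ∀ s a b, s ≠ 0 → T ![s, 0, a, b] ![s, 0, a, b] ![s, 0, a, b] = c * s ^ 3 := by
    intro s a b hs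
    have e : ![s, 0, a, b] = s • ![1, 0, a / s, b / s] := by
      ext i
      fin_cases i <;> simp <;> field_simp
    rw [e, cub_smul, h, mul_comm]
  rcases eq_or_ne s 0 with rfl | hs
  · have := cub_eq_zero_of_curve T ![Polynomial.X, 0, Polynomial.C a, Polynomial.C b]
      (fun s => ![s, 0, a, b]) (fun s i => by fin_cases i <;> simp)
      (Polynomial.C c * Polynomial.X ^ 3) (fun s hs => by rw [key s a b hs]; simp) (by simp)
    rw [this]; ring
  · exact key s a b hs

theorem isDoubleCone_of_const {T : (Fin 4 → K) →ₗ[K] (Fin 4 → K) →ₗ[K] (Fin 4 → K) →ₗ[K] K}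
    {c c' : K} (h : ∀ x y, T ![0, 1, x, y] ![0, 1, x, y] ![0, 1, x, y] = c)
    (h' : ∀ x y, T ![1, 0, x, y] ![1, 0, x, y] ![1, 0, x, y] = c') :
    IsDoubleCone fun v : Fin 5 → K => v 0 * (Fin.tail v 0 * Fin.tail v 1) +
      T (Fin.tail v) (Fin.tail v) (Fin.tail v) := by
  set α := cubPolar T ![1, 0, 0, 0] ![0, 1, 0, 0] ![0, 0, 1, 0] with hα
  set β := cubPolar T ![1, 0, 0, 0] ![0, 1, 0, 0] ![0, 0, 0, 1] with hβ
  have key : ∀ v : Fin 5 → K, v 0 * (Fin.tail v 0 * Fin.tail v 1) +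
      T (Fin.tail v) (Fin.tail v) (Fin.tail v) = v 1 * v 2 * (v 0 + α * v 3 + β * v 4) +
      T ![v 1, v 2, 0, 0] ![v 1, v 2, 0, 0] ![v 1, v 2, 0, 0] := by
    intro v
    have e : Fin.tail v = (![v 1, 0, 0, 0] + ![0, v 2, 0, 0]) + ![0, 0, v 3, v 4] := by
      ext i
      fin_cases i <;> simp [Fin.tail]
    have e' : ![v 1, v 2, 0, 0] = ![v 1, 0, 0, 0] + ![0, v 2, 0, 0] := by
      ext i
      fin_cases i <;> simp
    have a1 : T (![v 1, 0, 0, 0] + ![0, 0, v 3, v 4]) (![v 1, 0, 0, 0] + ![0, 0, v 3, v 4])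
        (![v 1, 0, 0, 0] + ![0, 0, v 3, v 4]) = c' * v 1 ^ 3 := by
      rw [← cub_of_const' h' (v 1) (v 3) (v 4)]
      simp
    have a2 : T (![0, v 2, 0, 0] + ![0, 0, v 3, v 4]) (![0, v 2, 0, 0] + ![0, 0, v 3, v 4])
        (![0, v 2, 0, 0] + ![0, 0, v 3, v 4]) = c * v 2 ^ 3 := by
      rw [← cub_of_const h (v 2) (v 3) (v 4)]
      simp
    have a3 := cub_of_const' h' (v 1) 0 0
    have a4 := cub_of_const h (v 2) 0 0
    have a5 := cub_of_const h 0 (v 3) (v 4)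
    have a6 : cubPolar T ![v 1, 0, 0, 0] ![0, v 2, 0, 0] ![0, 0, v 3, v 4] =
        v 1 * v 2 * (α * v 3 + β * v 4) := by
      have e1 : ![v 1, 0, 0, 0] = v 1 • ![1, 0, 0, 0] := by simp
      have e2 : ![0, v 2, 0, 0] = v 2 • ![0, 1, 0, 0] := by simp
      have e3 : ![0, 0, v 3, v 4] = v 3 • ![0, 0, 1, 0] + v 4 • ![0, 0, 0, 1] := by simp
      rw [e1, e2, e3, hα, hβ]
      simp only [cubPolar, map_add, map_smul, LinearMap.add_apply, LinearMap.smul_apply,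
        smul_eq_mul]
      ring
    rw [cub_add] at a1 a2
    rw [e, cub_add, cubDer_add_left, cubDer_add_right, a6, ← e']
    simp only [Pi.add_apply, Matrix.cons_val]
    linear_combination a1 + a2 - a3 - a4 - a5
  refine IsDoubleCone.of_functionals ![LinearMap.proj 0 + α • LinearMap.proj 3 +
    β • LinearMap.proj 4, LinearMap.proj 1, LinearMap.proj 2] ?_ ?_
  · refine linearIndependent_of_dual _ ![Pi.single 0 1, Pi.single 1 1, Pi.single 2 1] ?_
    intro i j
    fin_cases i <;> fin_cases j <;> simp
  · intro v v' h
    have h0 : v 0 + α * v 3 + β * v 4 = v' 0 + α * v' 3 + β * v' 4 := by simpa using h 0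
    have h1 : v 1 = v' 1 := h 1
    have h2 : v 2 = v' 2 := h 2
    rw [key, key, h0, h1, h2]

variable [LocFin p K]

theorem lowerBound_mul (T : (Fin 4 → K) →ₗ[K] (Fin 4 → K) →ₗ[K] (Fin 4 → K) →ₗ[K] K)
    (hT : ¬ IsDoubleCone fun v : Fin 5 → K => v 0 * (Fin.tail v 0 * Fin.tail v 1) +
      T (Fin.tail v) (Fin.tail v) (Fin.tail v)) :
    LowerBound p fun v : Fin 5 → K => v 0 * (Fin.tail v 0 * Fin.tail v 1) +
      T (Fin.tail v) (Fin.tail v) (Fin.tail v) := by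
  have main : (∃ P P' : (Fin 4 → K) → Prop, SqBound p P ∧ SqBound p P' ∧
      (∀ x, P x → x 0 * x 1 = 0 ∧ T x x x = 0) ∧ (∀ x, P' x → x 0 * x 1 = 0 ∧ T x x x = 0) ∧
      ∀ x, P x → ¬ P' x) := by
    have h3 : (∀ a b, T ![0, 0, a, b] ![0, 0, a, b] ![0, 0, a, b] = 0) →
        SqBound p fun x => x 0 = 0 ∧ x 1 = 0 ∧ T x x x = 0 :=
      fun h => sqBound_of_forall_zero_zero fun a b => ⟨by simp, by simp, h a b⟩
    rcases SqBound.or_const (p := p) T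
      ![0, 1, Polynomial.C Polynomial.X, Polynomial.X] (i₀ := 1) (i₁ := 2) (i₂ := 3) rfl rfl rfl
      (fun x y => ![0, 1, x, y]) (fun x y i => by fin_cases i <;> simp [Polynomial.evalEval_C])
      (P := fun y => y 0 = 0 ∧ y 1 ≠ 0 ∧ T y y y = 0)
      (fun l x y hl h => ⟨by simp, by simpa using hl, h⟩) with h1 | ⟨c, hc, h1⟩ <;>
    rcases SqBound.or_const (p := p) T
      ![1, 0, Polynomial.C Polynomial.X, Polynomial.X] (i₀ := 0) (i₁ := 2) (i₂ := 3) rfl rfl rfl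
      (fun x y => ![1, 0, x, y]) (fun x y i => by fin_cases i <;> simp [Polynomial.evalEval_C])
      (P := fun y => y 1 = 0 ∧ y 0 ≠ 0 ∧ T y y y = 0)
      (fun l x y hl h => ⟨by simp, by simpa using hl, h⟩) with h2 | ⟨c', hc', h2⟩
    · exact ⟨_, _, h1, h2, fun x hx => ⟨by rw [hx.1, zero_mul], hx.2.2⟩,
        fun x hx => ⟨by rw [hx.1, mul_zero], hx.2.2⟩, fun x h h' => h'.2.1 h.1⟩
    · exact ⟨_, _, h1, h3 fun a b => by rw [cub_of_const' h2]; ring,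
        fun x hx => ⟨by rw [hx.1, zero_mul], hx.2.2⟩,
        fun x hx => ⟨by rw [hx.1, zero_mul], hx.2.2⟩, fun x h h' => h.2.1 h'.2.1⟩
    · exact ⟨_, _, h2, h3 fun a b => by rw [cub_of_const h1]; ring,
        fun x hx => ⟨by rw [hx.1, mul_zero], hx.2.2⟩,
        fun x hx => ⟨by rw [hx.1, zero_mul], hx.2.2⟩, fun x h h' => h.2.1 h'.1⟩
    · exact absurd (isDoubleCone_of_const h1 h2) hT
  obtain ⟨P, P', ⟨M, hP⟩, ⟨N, hP'⟩, h1, h2, h3⟩ := main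
  have := LowerBound.of_count (p := p) (Qf := X 0 * X 1) (Kf := cubicPoly T) ⟨M + N, ?_⟩
  · simpa only [map_mul, eval_X, eval_cubicPoly] using this
  simp only [map_mul, eval_X, eval_cubicPoly]
  filter_upwards [hP, hP', eventually_pos_divFilter] with n hP hP' hn
  have c1 := affCount_add_le (Fs p K n) h1 h2 h3
  have c2 : affCount (Fs p K n) (fun y : Fin 4 → K => y 0 * y 1 = 0) ≤
      (p ^ n) ^ 3 + (p ^ n) ^ 3 := by
    refine (affCount_le_add (P := fun x => x 0 = 0) (P' := fun x => x 1 = 0) _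
      fun x => mul_eq_zero.1).trans (Nat.add_le_add ?_ ?_)
    · refine affCount_le_of_injOn hn ![1, 2, 3] ?_
      intro x y hx hy h
      funext i
      fin_cases i
      · exact hx.trans hy.symm
      · exact h 0
      · exact h 1
      · exact h 2
    · refine affCount_le_of_injOn hn ![0, 2, 3] ?_
      intro x y hx hy h
      funext i
      fin_cases i
      · exact h 0
      · exact hx.trans hy.symm
      · exact h 1
      · exact h 2
  refine c2.trans ?_
  have hQ : 0 < p ^ (n / 2) := pow_pos hp.out.pos _
  generalize affCount (Fs p K n) P = A at *
  generalize affCount (Fs p K n) P' = A' at *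
  generalize affCount (Fs p K n) _ = B at *
  generalize p ^ (n / 2) = Q at *
  generalize p ^ n = q at *
  have := Nat.mul_le_mul_left q hP
  have := Nat.mul_le_mul_left q hP'
  have := Nat.mul_le_mul_left q c1
  nlinarith

end

section
variable {K : Type} [Field K] [IsAlgClosed K] {V : Type} [AddCommGroup V] [Module K V]

theorem bilin_sq_or_hyperbolic [FiniteDimensional K V] (B : V →ₗ[K] V →ₗ[K] K) :
    (∃ l : Module.Dual K V, ∀ y, B y y = l y ^ 2) ∨
    ∃ u v, B u u = 0 ∧ B v v = 0 ∧ B u v + B v u = 1 := by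
  by_contra! hcon
  obtain ⟨h1, h2⟩ := hcon
  have hpol : ∀ n m, B n n = 0 → B m m = 0 → B n m + B m n = 0 := by
    intro n m hn hm
    by_contra hne
    refine h2 n ((B n m + B m n)⁻¹ • m) hn ?_ ?_
    · simp [hm]
    · simp only [map_smul, LinearMap.smul_apply, smul_eq_mul]
      rw [← mul_add, inv_mul_cancel₀ hne]
  obtain ⟨w₀, hw₀⟩ := h1 0
  have hw₀ : B w₀ w₀ ≠ 0 := by simpa using hw₀
  obtain ⟨r, hr⟩ := IsAlgClosed.exists_pow_nat_eq (B w₀ w₀)⁻¹ (show 0 < 2 by norm_num)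
  obtain ⟨w, hw⟩ : ∃ w, B w w = 1 := ⟨r • w₀, by
    simp only [map_smul, LinearMap.smul_apply, smul_eq_mul]
    rw [← mul_assoc, ← pow_two, hr, inv_mul_cancel₀ hw₀]⟩
  have hnw : ∀ n, B n n = 0 → B n w + B w n = 0 := by
    intro n hn
    have := hpol n (n - (B n w + B w n) • w) hn ?_
    · simp only [map_sub, map_smul, LinearMap.sub_apply, LinearMap.smul_apply, smul_eq_mul, hn]
        at this
      refine pow_eq_zero_iff (n := 2) (by norm_num) |>.1 ?_
      linear_combination -this
    · simp only [map_sub, map_smul, LinearMap.sub_apply, LinearMap.smul_apply, smul_eq_mul, hn, hw]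
      ring
  let N : Submodule K V :=
    { carrier := {n | B n n = 0}
      add_mem' := fun {a b} ha hb => by
        have ha : B a a = 0 := ha
        have hb : B b b = 0 := hb
        change B (a + b) (a + b) = 0
        simp only [map_add, LinearMap.add_apply]
        linear_combination ha + hb + hpol a b ha hb
      zero_mem' := by simp
      smul_mem' := fun c a ha => by
        change B (c • a) (c • a) = 0
        have ha : B a a = 0 := ha
        simp [ha] }
  have hwN : w ∉ N := fun h => one_ne_zero (hw.symm.trans h)
  obtain ⟨f, hf, hN⟩ := Submodule.exists_le_ker_of_notMem hwN
  obtain ⟨y, hy⟩ := h1 ((f w)⁻¹ • f)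
  apply hy
  obtain ⟨s, hs⟩ : ∃ s : K, B (y - s • w) (y - s • w) = 0 := by
    obtain ⟨s, hs⟩ := IsAlgClosed.exists_root (Polynomial.X ^ 2 -
      Polynomial.C (B y w + B w y) * Polynomial.X + Polynomial.C (B y y))
      (by
        have : (Polynomial.X ^ 2 - Polynomial.C (B y w + B w y) * Polynomial.X +
          Polynomial.C (B y y)).degree = 2 := by compute_degree!
        rw [this]; norm_num)
    refine ⟨s, ?_⟩
    simp only [map_sub, map_smul, LinearMap.sub_apply, LinearMap.smul_apply, smul_eq_mul, hw]
    simp at hs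
    linear_combination hs
  have hfy : f y = s * f w := by
    have := hN (show y - s • w ∈ N from hs)
    rw [LinearMap.mem_ker, map_sub, map_smul, smul_eq_mul] at this
    exact sub_eq_zero.1 this
  have e : B y y = s ^ 2 := by
    have h3 := hnw _ hs
    have e : y = (y - s • w) + s • w := by simp
    rw [e]
    simp only [map_add, map_smul, LinearMap.add_apply, LinearMap.smul_apply, smul_eq_mul, hw, hs]
    linear_combination s * h3
  rw [e, LinearMap.smul_apply, smul_eq_mul, hfy]
  field_simp

theorem exists_equiv_forall_of_functionals {m k d : ℕ} (hd : m + k = d)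
    (φ : Fin m → Module.Dual K (Fin d → K)) (hφ : LinearIndependent K φ) :
    ∃ e : (Fin d → K) ≃ₗ[K] (Fin d → K), ∀ x (i : Fin m),
      φ i (e x) = x (Fin.castLE (by omega) i) := by
  obtain ⟨e, he⟩ := exists_equiv_of_functionals hd φ hφ
  exact ⟨e.symm, fun x i => by rw [← he, e.apply_symm_apply]⟩

theorem bilin_normal_form (B : (Fin 4 → K) →ₗ[K] (Fin 4 → K) →ₗ[K] K) (hB : ∃ y, B y y ≠ 0) :
    ∃ e : (Fin 4 → K) ≃ₗ[K] (Fin 4 → K), (∀ y, B (e y) (e y) = y 0 ^ 2) ∨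
      (∀ y, B (e y) (e y) = y 0 * y 1) ∨ (∀ y, B (e y) (e y) = y 0 * y 1 + y 2 ^ 2) ∨
      (∀ y, B (e y) (e y) = y 0 * y 1 + y 2 * y 3) := by
  obtain ⟨y₀, hy₀⟩ := hB
  rcases bilin_sq_or_hyperbolic B with ⟨l, hl⟩ | ⟨u, v, hu, hv, huv⟩
  · have hl0 : l y₀ ≠ 0 := fun h => hy₀ (by rw [hl, h]; ring)
    obtain ⟨e, he⟩ := exists_equiv_forall_of_functionals (show 1 + 3 = 4 from rfl) ![l]
      (linearIndependent_of_dual _ ![(l y₀)⁻¹ • y₀] (by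
        intro i j
        fin_cases i; fin_cases j
        simp [hl0]))
    exact ⟨e, Or.inl fun y => by rw [hl]; exact congrArg (· ^ 2) (he y 0)⟩
  set φ : Module.Dual K (Fin 4 → K) := B.flip v + B v with hφ
  set ψ : Module.Dual K (Fin 4 → K) := B.flip u + B u with hψ
  have aφ : ∀ y, φ y = B y v + B v y := fun y => rfl
  have aψ : ∀ y, ψ y = B y u + B u y := fun y => rfl
  have φu : φ u = 1 := huv
  have φv : φ v = 0 := by rw [aφ, hv, add_zero]
  have ψu : ψ u = 0 := by rw [aψ, hu, add_zero]
  have ψv : ψ v = 1 := by rw [aψ, add_comm, huv]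
  clear_value φ ψ
  let π : (Fin 4 → K) →ₗ[K] (Fin 4 → K) := LinearMap.id - φ.smulRight u - ψ.smulRight v
  have aπ : ∀ y, π y = y - φ y • u - ψ y • v := fun y => rfl
  clear_value π
  have φπ : ∀ y, φ (π y) = 0 := fun y => by simp [aπ, φu, φv]
  have ψπ : ∀ y, ψ (π y) = 0 := fun y => by simp [aπ, ψu, ψv]
  have πu : π u = 0 := by simp [aπ, φu, ψu]
  have πv : π v = 0 := by simp [aπ, φv, ψv]
  have key : ∀ y, B y y = φ y * ψ y + B (π y) (π y) := by
    intro y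
    have e : y = π y + (φ y • u + ψ y • v) := by rw [aπ]; abel
    have h1 := φπ y
    have h2 := ψπ y
    rw [aφ] at h1
    rw [aψ] at h2
    conv_lhs => rw [e]
    simp only [map_add, map_smul, LinearMap.add_apply, LinearMap.smul_apply, smul_eq_mul, hu, hv]
    linear_combination φ y * h2 + ψ y * h1 + φ y * ψ y * huv
  rcases bilin_sq_or_hyperbolic (B.compl₁₂ π π) with ⟨l, hl⟩ | ⟨u', v', hu', hv', huv'⟩
  · have hl : ∀ y, B (π y) (π y) = l y ^ 2 := hl
    have lu : l u = 0 := by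
      have := hl u
      rw [πu, map_zero] at this
      exact pow_eq_zero_iff (n := 2) (by norm_num) |>.1 this.symm
    have lv : l v = 0 := by
      have := hl v
      rw [πv, map_zero] at this
      exact pow_eq_zero_iff (n := 2) (by norm_num) |>.1 this.symm
    by_cases hl0 : l = 0
    · obtain ⟨e, he⟩ := exists_equiv_forall_of_functionals (show 2 + 2 = 4 from rfl) ![φ, ψ]
        (linearIndependent_of_dual _ ![u, v] (by
          intro i j
          fin_cases i <;> fin_cases j <;> simp [φu, φv, ψu, ψv]))
      have h0 : ∀ x, φ (e x) = x 0 := fun x => he x 0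
      have h1 : ∀ x, ψ (e x) = x 1 := fun x => he x 1
      exact ⟨e, Or.inr (Or.inl fun y => by rw [key, hl, h0, h1, hl0]; simp)⟩
    · obtain ⟨w, hw⟩ : ∃ w, l w ≠ 0 := by
        by_contra! h
        exact hl0 (LinearMap.ext h)
      have lπ : l (π w) = l w := by simp [aπ, lu, lv]
      obtain ⟨e, he⟩ := exists_equiv_forall_of_functionals (show 3 + 1 = 4 from rfl) ![φ, ψ, l]
        (linearIndependent_of_dual _ ![u, v, (l w)⁻¹ • π w] (by
          intro i j
          fin_cases i <;> fin_cases j <;> simp [φu, φv, ψu, ψv, lu, lv, φπ, ψπ, lπ, hw]))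
      have h0 : ∀ x, φ (e x) = x 0 := fun x => he x 0
      have h1 : ∀ x, ψ (e x) = x 1 := fun x => he x 1
      have h2 : ∀ x, l (e x) = x 2 := fun x => he x 2
      exact ⟨e, Or.inr (Or.inr (Or.inl fun y => by rw [key, hl, h0, h1, h2]))⟩
  · obtain ⟨s, hs, φs, ψs⟩ : ∃ s, s = π u' ∧ φ s = 0 ∧ ψ s = 0 := ⟨_, rfl, φπ _, ψπ _⟩
    obtain ⟨t, ht, φt, ψt⟩ : ∃ t, t = π v' ∧ φ t = 0 ∧ ψ t = 0 := ⟨_, rfl, φπ _, ψπ _⟩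
    have hss : B s s = 0 := by rw [hs]; exact hu'
    have htt : B t t = 0 := by rw [ht]; exact hv'
    have hst : B s t + B t s = 1 := by rw [hs, ht]; exact huv'
    have a1 := φs
    have a2 := ψs
    have a3 := φt
    have a4 := ψt
    rw [aφ] at a1 a3
    rw [aψ] at a2 a4
    set φ' : Module.Dual K (Fin 4 → K) := B.flip t + B t with hφ'
    set ψ' : Module.Dual K (Fin 4 → K) := B.flip s + B s with hψ'
    have aφ' : ∀ y, φ' y = B y t + B t y := fun y => rfl
    have aψ' : ∀ y, ψ' y = B y s + B s y := fun y => rfl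
    clear_value φ' ψ'
    have b1 : φ' s = 1 := by rw [aφ', hst]
    have b2 : φ' t = 0 := by rw [aφ', htt, add_zero]
    have b3 : ψ' s = 0 := by rw [aψ', hss, add_zero]
    have b4 : ψ' t = 1 := by rw [aψ', add_comm, hst]
    have b5 : φ' u = 0 := by rw [aφ', add_comm, a4]
    have b6 : φ' v = 0 := by rw [aφ', add_comm, a3]
    have b7 : ψ' u = 0 := by rw [aψ', add_comm, a2]
    have b8 : ψ' v = 0 := by rw [aψ', add_comm, a1]
    obtain ⟨e, he⟩ := exists_equiv_forall_of_functionals (show 4 + 0 = 4 from rfl) ![φ, ψ, φ', ψ']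
      (linearIndependent_of_dual _ ![u, v, s, t] (by
        intro i j
        fin_cases i <;> fin_cases j <;>
          simp [φu, φv, ψu, ψv, φs, ψs, φt, ψt, b1, b2, b3, b4, b5, b6, b7, b8]))
    have h0 : ∀ x, φ (e x) = x 0 := fun x => he x 0
    have h1 : ∀ x, ψ (e x) = x 1 := fun x => he x 1
    have h2 : ∀ x, φ' (e x) = x 2 := fun x => he x 2
    have h3 : ∀ x, ψ' (e x) = x 3 := fun x => he x 3
    have hy : ∀ y, e y = y 0 • u + y 1 • v + y 2 • s + y 3 • t := by
      intro y
      rw [← e.apply_symm_apply (y 0 • u + y 1 • v + y 2 • s + y 3 • t)]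
      congr 1
      funext i
      fin_cases i
      · change _ = e.symm _ 0
        rw [← h0 (e.symm _), e.apply_symm_apply]
        simp [φu, φv, φs, φt]
      · change _ = e.symm _ 1
        rw [← h1 (e.symm _), e.apply_symm_apply]
        simp [ψu, ψv, ψs, ψt]
      · change _ = e.symm _ 2
        rw [← h2 (e.symm _), e.apply_symm_apply]
        simp [b1, b2, b5, b6]
      · change _ = e.symm _ 3
        rw [← h3 (e.symm _), e.apply_symm_apply]
        simp [b3, b4, b7, b8]
    refine ⟨e, Or.inr (Or.inr (Or.inr fun y => ?_))⟩
    rw [hy]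
    simp only [map_add, map_smul, LinearMap.add_apply, LinearMap.smul_apply, smul_eq_mul, hu, hv,
      hss, htt]
    linear_combination y 0 * y 1 * huv + y 2 * y 3 * hst + y 0 * y 2 * a2 + y 0 * y 3 * a4 +
      y 1 * y 2 * a1 + y 1 * y 3 * a3

end

section
variable {K : Type} [Field K]

/-- Precomposition of a trilinear form with a linear map. -/
def triComp {V V' : Type} [AddCommGroup V] [Module K V] [AddCommGroup V'] [Module K V']
    (T : V →ₗ[K] V →ₗ[K] V →ₗ[K] K) (f : V' →ₗ[K] V) : V' →ₗ[K] V' →ₗ[K] V' →ₗ[K] K :=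
  (T.compl₁₂ f f).compr₂ (LinearMap.lcomp K K f)

@[simp]
theorem triComp_apply {V V' : Type} [AddCommGroup V] [Module K V] [AddCommGroup V'] [Module K V']
    (T : V →ₗ[K] V →ₗ[K] V →ₗ[K] K) (f : V' →ₗ[K] V) (x y z : V') :
    triComp T f x y z = T (f x) (f y) (f z) := rfl

theorem exists_bilin_cubDer {V V' : Type} [AddCommGroup V] [Module K V] [AddCommGroup V']
    [Module K V'] (T : V →ₗ[K] V →ₗ[K] V →ₗ[K] K) (f : V' →ₗ[K] V) (v : V) :
    ∃ B : V' →ₗ[K] V' →ₗ[K] K, ∀ y, B y y = cubDer T (f y) v :=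
  ⟨LinearMap.mk₂ K (fun x y => T (f x) (f y) v + T (f x) v (f y) + T v (f x) (f y))
    (fun x x' y => by simp only [map_add, LinearMap.add_apply]; ring)
    (fun a x y => by simp only [map_smul, LinearMap.smul_apply, smul_eq_mul]; ring)
    (fun x y y' => by simp only [map_add, LinearMap.add_apply]; ring)
    (fun a x y => by simp only [map_smul, LinearMap.smul_apply, smul_eq_mul]; ring),
    fun y => rfl⟩

/-- The extension of a coordinate change fixing the first coordinate. -/
def consEquiv {m : ℕ} (e : (Fin m → K) ≃ₗ[K] (Fin m → K)) :
    (Fin (m + 1) → K) ≃ₗ[K] (Fin (m + 1) → K) :=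
  (Fin.consLinearEquiv K fun _ : Fin (m + 1) => K).symm ≪≫ₗ
    ((LinearEquiv.refl K K).prodCongr e) ≪≫ₗ Fin.consLinearEquiv K fun _ : Fin (m + 1) => K

theorem consEquiv_apply {m : ℕ} (e : (Fin m → K) ≃ₗ[K] (Fin m → K)) (v : Fin (m + 1) → K) :
    consEquiv e v = Fin.cons (v 0) (e (Fin.tail v)) := rfl

variable {p : ℕ} [hp : Fact p.Prime] [CharP K p] [IsAlgClosed K] [LocFin p K]

theorem lowerBound_of_singular_not_vertex
    (T : (Fin 5 → K) →ₗ[K] (Fin 5 → K) →ₗ[K] (Fin 5 → K) →ₗ[K] K)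
    (hT : ¬ IsDoubleCone fun v => T v v v) {v₀ : Fin 5 → K} (h0 : T v₀ v₀ v₀ = 0)
    (hder : ∀ w, cubDer T v₀ w = 0) {y₀ : Fin 5 → K} (hy₀ : cubDer T y₀ v₀ ≠ 0) :
    LowerBound p fun v => T v v v := by
  have hv₀ : v₀ ≠ 0 := by
    rintro rfl
    exact hy₀ (by simp [cubDer])
  obtain ⟨e, he⟩ := exists_equiv_of_vectors (show 1 + 4 = 5 from rfl) ![v₀]
    (linearIndependent_unique_iff.2 hv₀)
  have he : e (Pi.single 0 1) = v₀ := he 0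
  let ι : (Fin 4 → K) →ₗ[K] (Fin 5 → K) := e.toLinearMap ∘ₗ
    (Fin.consLinearEquiv K fun _ : Fin 5 => K).toLinearMap ∘ₗ LinearMap.inr K K (Fin 4 → K)
  have hι : ∀ y, ι y = e (Fin.cons 0 y) := fun y => rfl
  have hsplit : ∀ v : Fin 5 → K, e v = v 0 • v₀ + ι (Fin.tail v) := by
    intro v
    rw [hι, ← he, ← map_smul, ← map_add]
    congr 1
    funext i
    refine Fin.cases ?_ (fun j => ?_) i
    · simp
    · simp [Fin.tail]
  clear_value ι
  obtain ⟨B, hB⟩ := exists_bilin_cubDer T ι v₀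
  have hc : ∀ v : Fin 5 → K, T (e v) (e v) (e v) = v 0 * B (Fin.tail v) (Fin.tail v) +
      triComp T ι (Fin.tail v) (Fin.tail v) (Fin.tail v) := by
    intro v
    rw [hsplit, cub_add, cub_smul, cubDer_smul_left, cubDer_smul_right, hder, h0, hB]
    simp only [triComp_apply]
    ring
  have hBne : ∃ y, B y y ≠ 0 := by
    refine ⟨Fin.tail (e.symm y₀), ?_⟩
    rw [hB]
    have := hsplit (e.symm y₀)
    rw [e.apply_symm_apply] at this
    rw [this, cubDer_add_left, cubDer_smul_left, hder, cubPolar_smul_left, cubPolar_comm',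
      cubPolar_self, hder] at hy₀
    simpa using hy₀
  obtain ⟨e', he'⟩ := bilin_normal_form B hBne
  have hT' : ¬ IsDoubleCone fun v : Fin 5 → K => v 0 * B (e' (Fin.tail v)) (e' (Fin.tail v)) +
      triComp (triComp T ι) e'.toLinearMap (Fin.tail v) (Fin.tail v) (Fin.tail v) := by
    intro h
    refine hT (IsDoubleCone.of_comp e (IsDoubleCone.of_comp (consEquiv e') ?_))
    simpa only [hc, consEquiv_apply, Fin.tail_cons, Fin.cons_zero, triComp_apply,
      LinearEquiv.coe_coe] using h
  refine LowerBound.of_comp e (LowerBound.of_comp (consEquiv e') ?_)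
  suffices h : LowerBound p fun v : Fin 5 → K => v 0 * B (e' (Fin.tail v)) (e' (Fin.tail v)) +
      triComp (triComp T ι) e'.toLinearMap (Fin.tail v) (Fin.tail v) (Fin.tail v) by
    simpa only [hc, consEquiv_apply, Fin.tail_cons, Fin.cons_zero, triComp_apply,
      LinearEquiv.coe_coe] using h
  rcases he' with h | h | h | h
  · simp only [h]
    exact lowerBound_sq _
  · simp only [h] at hT' ⊢
    exact lowerBound_mul _ hT'
  · simp only [h]
    exact lowerBound_mul_add_sq _
  · simp only [h]
    exact lowerBound_mul_add_mul _

end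

section
variable {K : Type} [Field K]

theorem aeval_sub_mem {R A : Type} [CommRing R] [CommRing A] [Algebra R A] {m : ℕ}
    (P : MvPolynomial (Fin m) R) (I : Ideal A) {a b : Fin m → A} (h : ∀ i, a i - b i ∈ I) :
    aeval a P - aeval b P ∈ I := by
  rw [← Ideal.Quotient.mk_eq_mk_iff_sub_mem]
  have h' : (fun i => Ideal.Quotient.mk I (a i)) = fun i => Ideal.Quotient.mk I (b i) :=
    funext fun i => (Ideal.Quotient.mk_eq_mk_iff_sub_mem _ _).2 (h i)
  have := fun c : Fin m → A => MvPolynomial.map_aeval c (Ideal.Quotient.mk I) P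
  rw [this, this, h']

theorem exists_powerSeries_fixed {m : ℕ} (G : Fin m → MvPolynomial (Fin m) K) :
    ∃ w : Fin m → PowerSeries K, ∀ i, w i = PowerSeries.X * aeval w (G i) := by
  let W : ℕ → Fin m → PowerSeries K := fun n =>
    Nat.rec (fun _ => 0) (fun _ w i => PowerSeries.X * aeval w (G i)) n
  have hW : ∀ n i, W (n + 1) i = PowerSeries.X * aeval (W n) (G i) := fun n i => rfl
  clear_value W
  have step : ∀ n i, PowerSeries.X ^ n ∣ W (n + 1) i - W n i := by
    intro n
    induction n with
    | zero => intro i; rw [pow_zero]; exact one_dvd _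
    | succ n ih =>
      intro i
      rw [hW, hW n, ← mul_sub, pow_succ']
      refine mul_dvd_mul_left _ ?_
      rw [← Ideal.mem_span_singleton]
      exact aeval_sub_mem _ _ fun i => Ideal.mem_span_singleton.2 (ih i)
  have step' : ∀ n k i, PowerSeries.X ^ n ∣ W (n + k) i - W n i := by
    intro n k i
    induction k with
    | zero => rw [add_zero, sub_self]; exact dvd_zero _
    | succ k ih =>
      have h := (pow_dvd_pow PowerSeries.X (Nat.le_add_right n k)).trans (step (n + k) i)
      have := dvd_add h ih
      rwa [sub_add_sub_cancel] at this
  let w : Fin m → PowerSeries K := fun i => PowerSeries.mk fun n => PowerSeries.coeff n (W (n + 1) i)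
  have hw : ∀ n i, PowerSeries.X ^ n ∣ w i - W n i := by
    intro n i
    rw [PowerSeries.X_pow_dvd_iff]
    intro k hk
    rw [map_sub, PowerSeries.coeff_mk]
    obtain ⟨j, rfl⟩ := Nat.exists_eq_add_of_le (show k + 1 ≤ n from hk)
    have := PowerSeries.X_pow_dvd_iff.1 (step' (k + 1) j i) k (Nat.lt_succ_self k)
    rw [map_sub] at this
    rw [← neg_sub, this, neg_zero]
  refine ⟨w, fun i => ?_⟩
  rw [← sub_eq_zero]
  ext n
  rw [map_zero]
  refine (PowerSeries.X_pow_dvd_iff (n := n + 1)).1 ?_ n (Nat.lt_succ_self n)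
  have e : w i - PowerSeries.X * aeval w (G i) = (w i - W (n + 1) i) -
      PowerSeries.X * (aeval w (G i) - aeval (W n) (G i)) := by
    rw [hW]; ring
  rw [e]
  refine dvd_sub (hw _ _) ?_
  rw [pow_succ']
  refine mul_dvd_mul_left _ ?_
  rw [← Ideal.mem_span_singleton]
  exact aeval_sub_mem _ _ fun i => Ideal.mem_span_singleton.2 (hw n i)

theorem exists_transcendental_fixed {m : ℕ} (G : Fin m → MvPolynomial (Fin m) K) :
    ∃ (L : Type) (_ : Field L) (_ : Algebra K L) (s : L) (w : Fin m → L), Transcendental K s ∧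
      ∀ i, w i = s * aeval w (G i) := by
  obtain ⟨w, hw⟩ := exists_powerSeries_fixed G
  refine ⟨FractionRing (PowerSeries K), inferInstance, inferInstance,
    algebraMap (PowerSeries K) _ PowerSeries.X, fun i => algebraMap (PowerSeries K) _ (w i), ?_, ?_⟩
  · rw [transcendental_algebraMap_iff (IsFractionRing.injective _ _)]
    rw [transcendental_iff]
    intro P hP
    have : (P : PowerSeries K) = Polynomial.aeval PowerSeries.X P := by
      have := Polynomial.aeval_algHom_apply (Polynomial.coeToPowerSeries.algHom (R := K) K)
        Polynomial.X P
      simpa using this.symm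
    rw [hP] at this
    exact_mod_cast this
  · intro i
    have h := MvPolynomial.aeval_algebraMap_apply (FractionRing (PowerSeries K)) w (G i)
    change algebraMap (PowerSeries K) (FractionRing (PowerSeries K)) (w i) =
      _ * aeval (algebraMap (PowerSeries K) (FractionRing (PowerSeries K)) ∘ w) (G i)
    rw [h, ← map_mul, ← hw i]

theorem exists_valuationSubring {L : Type} [Field L] [Algebra K L] {s : L}
    (hs : Transcendental K s) : ∃ B : ValuationSubring L, (∀ a, algebraMap K L a ∈ B) ∧
      s⁻¹ ∈ B.nonunits := by
  let A := (Algebra.adjoin K {s⁻¹}).toSubring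
  have hsA : s⁻¹ ∈ A := Algebra.subset_adjoin rfl
  have hA : Ideal.span {(⟨s⁻¹, hsA⟩ : A)} ≠ ⊤ := by
    intro h
    rw [Ideal.eq_top_iff_one, Ideal.mem_span_singleton'] at h
    obtain ⟨⟨a, ha⟩, h⟩ := h
    replace h : a * s⁻¹ = 1 := congrArg Subtype.val h
    change a ∈ Algebra.adjoin K {s⁻¹} at ha
    rw [Algebra.adjoin_singleton_eq_range_aeval] at ha
    obtain ⟨P, rfl⟩ := ha
    have h' : Polynomial.aeval s⁻¹ P * s⁻¹ = 1 := h
    have halg : IsAlgebraic K s⁻¹ := by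
      refine ⟨P * Polynomial.X - 1, fun h0 => ?_, ?_⟩
      · have := congrArg (Polynomial.eval 0) h0
        simp at this
      · rw [map_sub, map_mul, Polynomial.aeval_X, map_one]
        exact sub_eq_zero.2 h'
    exact hs (by simpa using halg.inv)
  obtain ⟨B, hB, hI⟩ := Ideal.image_subset_nonunits_valuationSubring _ hA
  exact ⟨B, fun a => hB (Subalgebra.algebraMap_mem _ a),
    hI ⟨⟨s⁻¹, hsA⟩, Ideal.subset_span rfl, rfl⟩⟩

theorem exists_zero_of_residual [IsAlgClosed K] {σ : Type} [Finite σ] {κ : Type} [CommRing κ]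
    [Nontrivial κ] [Algebra K κ] (x : σ → κ) :
    ∃ x' : σ → K, ∀ P : MvPolynomial σ K, aeval x P = 0 → aeval x' P = 0 := by
  let I := RingHom.ker (aeval (R := K) x)
  have hI : I ≠ ⊤ := RingHom.ker_ne_top _
  have : (zeroLocus K I).Nonempty := by
    by_contra h
    rw [Set.not_nonempty_iff_eq_empty] at h
    have := vanishingIdeal_zeroLocus_eq_radical (K := K) I
    rw [h, vanishingIdeal_empty] at this
    exact hI (Ideal.radical_eq_top.1 this.symm)
  obtain ⟨x', hx'⟩ := this
  exact ⟨x', fun P hP => hx' P hP⟩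

/-- Two independent vectors over the fraction field of a valuation ring span the same space as
two integral vectors with independent reductions. -/
theorem exists_primitive_pair {L : Type} [Field L] (B : ValuationSubring L) {m : ℕ}
    {u v : Fin m → L} (h : ∀ a b : L, a • u + b • v = 0 → a = 0 ∧ b = 0) :
    ∃ (a b c d : L) (i j : Fin m), (∀ k, (a • u + b • v) k ∈ B) ∧ (∀ k, (c • u + d • v) k ∈ B) ∧
      (a • u + b • v) i = 1 ∧ (c • u + d • v) i = 0 ∧ (c • u + d • v) j = 1 := by
  have prim : ∀ x : Fin m → L, x ≠ 0 → ∃ i, x i ≠ 0 ∧ ∀ k, (x i)⁻¹ * x k ∈ B := by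
    intro x hx
    obtain ⟨i₀, hi₀⟩ := Function.ne_iff.1 hx
    obtain ⟨i, _, hi⟩ := Finset.exists_max_image Finset.univ (fun k => B.valuation (x k))
      ⟨i₀, Finset.mem_univ _⟩
    have hxi : x i ≠ 0 := by
      intro h0
      have := hi i₀ (Finset.mem_univ _)
      rw [h0, map_zero, le_zero_iff, map_eq_zero] at this
      exact hi₀ this
    refine ⟨i, hxi, fun k => ?_⟩
    obtain ⟨b, hb⟩ := (B.valuation_le_iff _ _).1 (hi k (Finset.mem_univ _))
    rw [← hb, mul_comm, mul_inv_cancel_right₀ hxi]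
    exact b.2
  obtain ⟨i, hi, hu⟩ := prim u (fun h0 => one_ne_zero (h 1 0 (by rw [h0]; simp)).1)
  obtain ⟨j, hj, hv⟩ := prim (v - (v i * (u i)⁻¹) • u) (fun h0 => by
    have := (h (-(v i * (u i)⁻¹)) 1 (by rw [← h0]; module)).2
    exact one_ne_zero this)
  set r := ((v - (v i * (u i)⁻¹) • u) j)⁻¹ with hr
  have e : -(r * (v i * (u i)⁻¹)) • u + r • v = r • (v - (v i * (u i)⁻¹) • u) := by module
  refine ⟨(u i)⁻¹, 0, -(r * (v i * (u i)⁻¹)), r, i, j, ?_, ?_, ?_, ?_, ?_⟩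
  · intro k
    simpa using hu k
  · intro k
    rw [e]
    exact hv k
  · simp [hi]
  · rw [e]
    simp [hi]
  · rw [e]
    exact inv_mul_cancel₀ hj

/-- The trilinear form `T` evaluated on vectors over a ring under `K`. -/
noncomputable def triEval {n : ℕ} (T : (Fin n → K) →ₗ[K] (Fin n → K) →ₗ[K] (Fin n → K) →ₗ[K] K)
    {A : Type} [CommRing A] (f : K →+* A) (p q r : Fin n → A) : A :=
  ∑ i, ∑ j, ∑ k, f (T (Pi.single k 1) (Pi.single j 1) (Pi.single i 1)) * (p i * q j * r k)

theorem eval_cubicPoly_eq_triEval {n : ℕ}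
    (T : (Fin n → K) →ₗ[K] (Fin n → K) →ₗ[K] (Fin n → K) →ₗ[K] K) (x : Fin n → K) :
    T x x x = triEval T (RingHom.id K) x x x := by
  rw [← eval_cubicPoly, cubicPoly, triEval]
  simp

theorem map_triEval {n : ℕ} (T : (Fin n → K) →ₗ[K] (Fin n → K) →ₗ[K] (Fin n → K) →ₗ[K] K)
    {A B : Type} [CommRing A] [CommRing B] (f : K →+* A) (φ : A →+* B) (p q r : Fin n → A) :
    φ (triEval T f p q r) =
      triEval T (φ.comp f) (fun i => φ (p i)) (fun i => φ (q i)) (fun i => φ (r i)) := by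
  simp only [triEval, map_sum, map_mul, RingHom.comp_apply]

theorem triEval_line {n : ℕ} (T : (Fin n → K) →ₗ[K] (Fin n → K) →ₗ[K] (Fin n → K) →ₗ[K] K)
    {A : Type} [CommRing A] (f : K →+* A) (u v : Fin n → A) (y z : A) :
    triEval T f (y • u + z • v) (y • u + z • v) (y • u + z • v) =
      y ^ 3 * triEval T f u u u +
      y ^ 2 * z * (triEval T f u u v + triEval T f u v u + triEval T f v u u) +
      y * z ^ 2 * (triEval T f u v v + triEval T f v u v + triEval T f v v u) +
      z ^ 3 * triEval T f v v v := by
  simp only [triEval, Finset.mul_sum, ← Finset.sum_add_distrib]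
  refine Finset.sum_congr rfl fun i _ => Finset.sum_congr rfl fun j _ =>
    Finset.sum_congr rfl fun k _ => ?_
  simp only [Pi.add_apply, Pi.smul_apply, smul_eq_mul]
  ring

/-- A cubic surface over an algebraically closed field contains a line. -/
theorem exists_line [IsAlgClosed K]
    (T : (Fin 4 → K) →ₗ[K] (Fin 4 → K) →ₗ[K] (Fin 4 → K) →ₗ[K] K) :
    ∃ u v : Fin 4 → K, (∀ a b : K, a • u + b • v = 0 → a = 0 ∧ b = 0) ∧
      ∀ y z : K, T (y • u + z • v) (y • u + z • v) (y • u + z • v) = 0 := by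
  let U : Fin 4 → MvPolynomial (Fin 4) K := ![1, 0, X 0, X 2]
  let V : Fin 4 → MvPolynomial (Fin 4) K := ![0, 1, X 1, X 3]
  let τ := triEval T (C : K →+* MvPolynomial (Fin 4) K)
  obtain ⟨L, _, _, s, w, hs, hw⟩ := exists_transcendental_fixed
    (![-τ U U U, -(τ U U V + τ U V U + τ V U U), -(τ U V V + τ V U V + τ V V U), -τ V V V] :
      Fin 4 → MvPolynomial (Fin 4) K)
  have hs0 : s ≠ 0 := by
    rintro rfl
    exact hs isAlgebraic_zero
  let u : Fin 4 → L := ![1, 0, w 0, w 2]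
  let v : Fin 4 → L := ![0, 1, w 1, w 3]
  let t := triEval T (algebraMap K L)
  have hφ : ((aeval w : MvPolynomial (Fin 4) K →ₐ[K] L) : MvPolynomial (Fin 4) K →+* L).comp C =
      algebraMap K L := by
    ext a
    simp
  have hU : (fun i => (aeval w : MvPolynomial (Fin 4) K →ₐ[K] L) (U i)) = u := by
    funext i
    fin_cases i <;> simp [U, u]
  have hV : (fun i => (aeval w : MvPolynomial (Fin 4) K →ₐ[K] L) (V i)) = v := by
    funext i
    fin_cases i <;> simp [V, v]
  have hτ : ∀ p q r, aeval w (τ p q r) = t (fun i => aeval w (p i)) (fun i => aeval w (q i))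
      (fun i => aeval w (r i)) := by
    intro p q r
    have := map_triEval T C ((aeval w : MvPolynomial (Fin 4) K →ₐ[K] L) :
      MvPolynomial (Fin 4) K →+* L) p q r
    rw [hφ] at this
    exact this
  have w0 := hw 0
  have w1 := hw 1
  have w2 := hw 2
  have w3 := hw 3
  simp only [Matrix.cons_val_zero, Matrix.cons_val_one, Matrix.cons_val, map_neg, map_add, hτ, hU,
    hV] at w0 w1 w2 w3
  have key : ∀ y z : L, t (y • u + z • v) (y • u + z • v) (y • u + z • v) =
      -(s⁻¹ * ((y • u + z • v) 0 ^ 2 * (y • u + z • v) 2 +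
        (y • u + z • v) 1 ^ 2 * (y • u + z • v) 3)) := by
    intro y z
    have e0 : (y • u + z • v) 0 = y := by simp [u, v]
    have e1 : (y • u + z • v) 1 = z := by simp [u, v]
    have e2 : (y • u + z • v) 2 = y * w 0 + z * w 1 := by simp [u, v]
    have e3 : (y • u + z • v) 3 = y * w 2 + z * w 3 := by simp [u, v]
    rw [e0, e1, e2, e3]
    have := triEval_line T (algebraMap K L) u v y z
    change t _ _ _ = _ at this
    rw [this, w0, w1, w2, w3]
    simp only [t]
    field_simp
    ring
  have hind : ∀ a b : L, a • u + b • v = 0 → a = 0 ∧ b = 0 := by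
    intro a b h
    have h0 := congrFun h 0
    have h1 := congrFun h 1
    simp [u, v] at h0 h1
    exact ⟨h0, h1⟩
  obtain ⟨B, hKB, hsB⟩ := exists_valuationSubring hs
  obtain ⟨a, b, c, d, i, j, hu', hv', h1, h2, h3⟩ := exists_primitive_pair B hind
  let f : K →+* B := (algebraMap K L).codRestrict B.toSubring hKB
  let u' : Fin 4 → B := fun k => ⟨_, hu' k⟩
  let v' : Fin 4 → B := fun k => ⟨_, hv' k⟩
  let π := IsLocalRing.residue B
  let I : Algebra K (IsLocalRing.ResidueField B) := (π.comp f).toAlgebra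
  have hf : B.subtype.comp f = algebraMap K L := rfl
  have hzero : ∀ y z : K, π (triEval T f (f y • u' + f z • v') (f y • u' + f z • v')
      (f y • u' + f z • v')) = 0 := by
    intro y z
    rw [IsLocalRing.residue_eq_zero_iff, ← B.coe_mem_nonunits_iff, ← B.subtype_apply,
      map_triEval, hf]
    have e : (fun i => B.subtype ((f y • u' + f z • v') i)) =
        (algebraMap K L y * a + algebraMap K L z * c) • u +
          (algebraMap K L y * b + algebraMap K L z * d) • v := by
      funext i
      change algebraMap K L y * (a * u i + b * v i) + algebraMap K L z * (c * u i + d * v i) =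
        (algebraMap K L y * a + algebraMap K L z * c) * u i +
          (algebraMap K L y * b + algebraMap K L z * d) * v i
      ring
    have e' := key (algebraMap K L y * a + algebraMap K L z * c)
      (algebraMap K L y * b + algebraMap K L z * d)
    rw [← e] at e'
    rw [show triEval T (algebraMap K L) = t from rfl, e', ← mul_neg, ValuationSubring.mem_nonunits_iff,
      map_mul]
    refine mul_lt_one_of_lt_of_le (B.mem_nonunits_iff.1 hsB) ?_
    rw [B.valuation_le_one_iff]
    have hm : ∀ k, (fun i => B.subtype ((f y • u' + f z • v') i)) k ∈ B :=
      fun k => ((f y • u' + f z • v') k).2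
    exact B.neg_mem _ (B.add_mem _ _ (B.mul_mem _ _ (pow_mem (hm 0) 2) (hm 2))
      (B.mul_mem _ _ (pow_mem (hm 1) 2) (hm 3)))
  obtain ⟨x, hx⟩ := exists_zero_of_residual (K := K) (κ := IsLocalRing.ResidueField B)
    (fun k : Fin 2 × Fin 4 => π (![u', v'] k.1 k.2))
  have hC : ∀ (κ : Type) [CommRing κ] [Algebra K κ] (x : Fin 2 × Fin 4 → κ) (y z : K),
      aeval x (triEval T C (fun k => C y * X (0, k) + C z * X (1, k))
        (fun k => C y * X (0, k) + C z * X (1, k)) (fun k => C y * X (0, k) + C z * X (1, k)) :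
        MvPolynomial (Fin 2 × Fin 4) K) =
      triEval T (algebraMap K κ)
        (fun k => algebraMap K κ y * x (0, k) + algebraMap K κ z * x (1, k))
        (fun k => algebraMap K κ y * x (0, k) + algebraMap K κ z * x (1, k))
        (fun k => algebraMap K κ y * x (0, k) + algebraMap K κ z * x (1, k)) := by
    intro κ _ _ x y z
    have := map_triEval T C ((aeval x : MvPolynomial (Fin 2 × Fin 4) K →ₐ[K] κ) :
      MvPolynomial (Fin 2 × Fin 4) K →+* κ) (fun k => C y * X (0, k) + C z * X (1, k))
      (fun k => C y * X (0, k) + C z * X (1, k)) (fun k => C y * X (0, k) + C z * X (1, k))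
    refine this.trans ?_
    have h : ((aeval x : MvPolynomial (Fin 2 × Fin 4) K →ₐ[K] κ) :
        MvPolynomial (Fin 2 × Fin 4) K →+* κ).comp C = algebraMap K κ := by
      ext a
      simp
    rw [h]
    simp
  refine ⟨fun k => x (0, k), fun k => x (1, k), ?_, ?_⟩
  · have k1 := hx (X (0, i) - 1) (by
      rw [map_sub, aeval_X, map_one, sub_eq_zero]
      exact (congrArg π (Subtype.ext h1 : u' i = 1)).trans (map_one π))
    have k2 := hx (X (1, i)) (by
      rw [aeval_X]
      exact (congrArg π (Subtype.ext h2 : v' i = 0)).trans (map_zero π))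
    have k3 := hx (X (1, j) - 1) (by
      rw [map_sub, aeval_X, map_one, sub_eq_zero]
      exact (congrArg π (Subtype.ext h3 : v' j = 1)).trans (map_one π))
    rw [map_sub, aeval_X, map_one, sub_eq_zero] at k1 k3
    rw [aeval_X] at k2
    intro α β h
    have hi := congrFun h i
    have hj := congrFun h j
    simp [k1, k2, k3] at hi hj
    rw [hi] at hj
    simp at hj
    exact ⟨hi, hj⟩
  · intro y z
    have := hx _ ((hC _ _ y z).trans ?_)
    · rw [hC] at this
      rw [eval_cubicPoly_eq_triEval]
      exact this
    · have h := hzero y z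
      rw [map_triEval] at h
      refine Eq.trans ?_ h
      have e : (fun k => algebraMap K (IsLocalRing.ResidueField B) y * π (u' k) +
          algebraMap K (IsLocalRing.ResidueField B) z * π (v' k)) =
          fun k => π ((f y • u' + f z • v') k) := by
        funext k
        rw [Pi.add_apply, map_add, Pi.smul_apply, Pi.smul_apply, smul_eq_mul, smul_eq_mul, map_mul,
          map_mul]
        rfl
      exact congrArg (fun p => triEval T (π.comp f) p p p) e

end

section
variable {K : Type} [Field K] {V : Type} [AddCommGroup V] [Module K V]
  (T : V →ₗ[K] V →ₗ[K] V →ₗ[K] K)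

theorem cub_plane (x u v : V) (t y z : K) :
    T (t • x + y • u + z • v) (t • x + y • u + z • v) (t • x + y • u + z • v) =
      t ^ 3 * T x x x + t ^ 2 * (y * cubDer T x u + z * cubDer T x v) +
      t * (y ^ 2 * cubDer T u x + y * z * cubPolar T x u v + z ^ 2 * cubDer T v x) +
      (y ^ 3 * T u u u + y ^ 2 * z * cubDer T u v + y * z ^ 2 * cubDer T v u +
        z ^ 3 * T v v v) := by
  simp only [cubDer, cubPolar, map_add, map_smul, LinearMap.add_apply, LinearMap.smul_apply,
    smul_eq_mul]
  ring

theorem cubDer_plane (x u v w : V) (t y z : K) :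
    cubDer T (t • x + y • u + z • v) w =
      t ^ 2 * cubDer T x w + y ^ 2 * cubDer T u w + z ^ 2 * cubDer T v w +
      t * y * cubPolar T x u w + t * z * cubPolar T x v w + y * z * cubPolar T u v w := by
  simp only [cubDer, cubPolar, map_add, map_smul, LinearMap.add_apply, LinearMap.smul_apply,
    smul_eq_mul]
  ring

theorem cubDer_add_smul_left (x ξ w : V) (s : K) :
    cubDer T (x + s • ξ) w = cubDer T x w + s * cubPolar T x w ξ + s ^ 2 * cubDer T ξ w := by
  simp only [cubDer, cubPolar, map_add, map_smul, LinearMap.add_apply, LinearMap.smul_apply,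
    smul_eq_mul]
  ring

theorem cub_add_smul (x ξ : V) (s : K) :
    T (x + s • ξ) (x + s • ξ) (x + s • ξ) =
      T x x x + s * cubDer T x ξ + s ^ 2 * cubDer T ξ x + s ^ 3 * T ξ ξ ξ := by
  simp only [cubDer, map_add, map_smul, LinearMap.add_apply, LinearMap.smul_apply, smul_eq_mul]
  ring

/-- The discriminant of the residual conic in the plane spanned by a line and a point. -/
def lineDisc (u v x : V) : K :=
  conicDisc (cubDer T u x) (cubPolar T x u v) (cubDer T v x) (cubDer T x u) (cubDer T x v) (T x x x)

theorem deriv_lineDisc [Infinite K] {u v : V} (h : ∀ x, lineDisc T u v x = 0) (x ξ : V) :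
    4 * cubDer T u ξ * cubDer T v x * T x x x + 4 * cubDer T u x * cubDer T v ξ * T x x x +
      4 * cubDer T u x * cubDer T v x * cubDer T x ξ +
      cubPolar T ξ u v * cubDer T x u * cubDer T x v +
      cubPolar T x u v * cubPolar T x u ξ * cubDer T x v +
      cubPolar T x u v * cubDer T x u * cubPolar T x v ξ -
      cubDer T u ξ * cubDer T x v ^ 2 - 2 * cubDer T u x * cubDer T x v * cubPolar T x v ξ -
      cubDer T v ξ * cubDer T x u ^ 2 - 2 * cubDer T v x * cubDer T x u * cubPolar T x u ξ -
      cubDer T x ξ * cubPolar T x u v ^ 2 - 2 * T x x x * cubPolar T x u v * cubPolar T ξ u v =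
      0 := by
  let P : Polynomial K := conicDisc
    (Polynomial.C (cubDer T u x) + Polynomial.X * Polynomial.C (cubDer T u ξ))
    (Polynomial.C (cubPolar T x u v) + Polynomial.X * Polynomial.C (cubPolar T ξ u v))
    (Polynomial.C (cubDer T v x) + Polynomial.X * Polynomial.C (cubDer T v ξ))
    (Polynomial.C (cubDer T x u) + Polynomial.X * Polynomial.C (cubPolar T x u ξ) +
      Polynomial.X ^ 2 * Polynomial.C (cubDer T ξ u))
    (Polynomial.C (cubDer T x v) + Polynomial.X * Polynomial.C (cubPolar T x v ξ) +
      Polynomial.X ^ 2 * Polynomial.C (cubDer T ξ v))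
    (Polynomial.C (T x x x) + Polynomial.X * Polynomial.C (cubDer T x ξ) +
      Polynomial.X ^ 2 * Polynomial.C (cubDer T ξ x) + Polynomial.X ^ 3 * Polynomial.C (T ξ ξ ξ))
  have hP : P = 0 := by
    refine Polynomial.funext fun s => ?_
    have := h (x + s • ξ)
    simp only [lineDisc, cubDer_add_right, cubDer_smul_right, cubPolar_add_left,
      cubPolar_smul_left, cubDer_add_smul_left, cub_add_smul] at this
    rw [Polynomial.eval_zero, ← this]
    simp [P, conicDisc]
    ring
  have h' := congrArg (fun Q : Polynomial K => Q.derivative.eval 0) hP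
  simp [P, conicDisc, Polynomial.derivative_pow] at h'
  linear_combination h'

variable {T}

theorem cub_line_eq_zero [Infinite K] {u v : V}
    (h : ∀ y z : K, T (y • u + z • v) (y • u + z • v) (y • u + z • v) = 0) :
    T u u u = 0 ∧ cubDer T u v = 0 ∧ cubDer T v u = 0 ∧ T v v v = 0 := by
  refine coeff_eq_zero_of_forall fun s => ?_
  have := h 1 s
  rw [one_smul, cub_add_smul] at this
  linear_combination this

/-- If all residual conics of a line are singular, their vertices are singular points. -/
theorem singular_of_lineDisc [Infinite K] {u v : V}
    (hL : ∀ y z : K, T (y • u + z • v) (y • u + z • v) (y • u + z • v) = 0)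
    (h : ∀ x, lineDisc T u v x = 0) (x : V) :
    ∃ t α β : K, t = 4 * cubDer T u x * cubDer T v x - cubPolar T x u v ^ 2 ∧
      T (t • x + α • u + β • v) (t • x + α • u + β • v) (t • x + α • u + β • v) = 0 ∧
      ∀ ξ, cubDer T (t • x + α • u + β • v) ξ = 0 := by
  obtain ⟨h1, h2, h3, h4⟩ := cub_line_eq_zero hL
  have h0 := h x
  rw [lineDisc, conicDisc] at h0
  refine ⟨_, cubPolar T x u v * cubDer T x v - 2 * cubDer T v x * cubDer T x u,
    cubPolar T x u v * cubDer T x u - 2 * cubDer T u x * cubDer T x v, rfl, ?_, fun ξ => ?_⟩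
  · rw [cub_plane, h1, h2, h3, h4]
    linear_combination (4 * cubDer T u x * cubDer T v x - cubPolar T x u v ^ 2) ^ 2 * h0
  · rw [cubDer_plane]
    have hd := deriv_lineDisc T h x ξ
    have hc : cubPolar T u v ξ = cubPolar T ξ u v := by
      simp only [cubPolar]
      ring
    rw [hc]
    linear_combination (4 * cubDer T u x * cubDer T v x - cubPolar T x u v ^ 2) * hd +
      (-4 * cubDer T v x * cubDer T u ξ - 4 * cubDer T u x * cubDer T v ξ +
        2 * cubPolar T x u v * cubPolar T ξ u v) * h0

end

section
variable {K : Type} [Field K]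

/-- The derivative of a cubic form at a point as a linear form. -/
def cubDerLin {V : Type} [AddCommGroup V] [Module K V] (T : V →ₗ[K] V →ₗ[K] V →ₗ[K] K) (x : V) :
    V →ₗ[K] K where
  toFun := cubDer T x
  map_add' := cubDer_add_right T x
  map_smul' a w := cubDer_smul_right T a x w

@[simp]
theorem cubDerLin_apply {V : Type} [AddCommGroup V] [Module K V]
    (T : V →ₗ[K] V →ₗ[K] V →ₗ[K] K) (x w : V) : cubDerLin T x w = cubDer T x w := rfl

variable [IsAlgClosed K]

theorem exists_binary_zero (a b d : K) :
    ∃ y z : K, (y ≠ 0 ∨ z ≠ 0) ∧ y ^ 2 * a + z ^ 2 * d + y * z * b = 0 := by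
  by_cases ha : a = 0
  · exact ⟨1, 0, Or.inl one_ne_zero, by rw [ha]; ring⟩
  · obtain ⟨y, hy⟩ := IsAlgClosed.exists_root (Polynomial.C a * Polynomial.X ^ 2 +
      Polynomial.C b * Polynomial.X + Polynomial.C d) (by
        rw [Polynomial.degree_quadratic ha]; decide)
    refine ⟨y, 1, Or.inr one_ne_zero, ?_⟩
    simp [Polynomial.IsRoot.def] at hy
    linear_combination hy

theorem eq_zero_of_forall_line {V : Type} [AddCommGroup V] [Module K V]
    (T : V →ₗ[K] V →ₗ[K] V →ₗ[K] K) {v₀ u v : V}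
    (hind : ∀ a b l : K, l • v₀ + a • u + b • v = 0 → l = 0 ∧ a = 0 ∧ b = 0)
    (hL : ∀ y z : K, T (y • u + z • v) (y • u + z • v) (y • u + z • v) = 0)
    (hsing : ∀ x, T x x x = 0 → (∀ w, cubDer T x w = 0) → ∃ l : K, x = l • v₀) {y z : K}
    (hyz : ∀ x, y ^ 2 * cubDer T u x + z ^ 2 * cubDer T v x + y * z * cubPolar T x u v = 0) :
    y = 0 ∧ z = 0 := by
  obtain ⟨l, hl⟩ := hsing _ (hL y z) (fun w => by
    have := cubDer_plane T 0 u v w 0 y z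
    rw [zero_smul, zero_add] at this
    have hp : cubPolar T u v w = cubPolar T w u v := by
      simp only [cubPolar]
      ring
    rw [this, hp]
    linear_combination hyz w)
  exact (hind y z (-l) (by rw [add_assoc, hl, neg_smul, neg_add_cancel])).2

theorem exists_lineDisc_ne_zero (T : (Fin 5 → K) →ₗ[K] (Fin 5 → K) →ₗ[K] (Fin 5 → K) →ₗ[K] K)
    {v₀ u v : Fin 5 → K}
    (hind : ∀ a b l : K, l • v₀ + a • u + b • v = 0 → l = 0 ∧ a = 0 ∧ b = 0)
    (hL : ∀ y z : K, T (y • u + z • v) (y • u + z • v) (y • u + z • v) = 0)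
    (hsing : ∀ x, T x x x = 0 → (∀ w, cubDer T x w = 0) → ∃ l : K, x = l • v₀) :
    ∃ x, lineDisc T u v x ≠ 0 := by
  by_contra! h
  obtain ⟨h1, h2, h3, h4⟩ := cub_line_eq_zero hL
  obtain ⟨e, he⟩ := exists_equiv_of_vectors (show 3 + 2 = 5 from rfl) ![v₀, u, v] (by
    rw [Fintype.linearIndependent_iff]
    intro g hg
    rw [Fin.sum_univ_three] at hg
    obtain ⟨g0, g1, g2⟩ := hind _ _ _ hg
    intro i
    fin_cases i
    exacts [g0, g1, g2])
  have coord : ∀ (i : Fin 5), 3 ≤ i → e.symm v₀ i = 0 ∧ e.symm u i = 0 ∧ e.symm v i = 0 := by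
    intro i hi
    have h0 := (he 0).symm
    have h1 := (he 1).symm
    have h2 := (he 2).symm
    simp only [Matrix.cons_val_zero, Matrix.cons_val_one, Matrix.cons_val] at h0 h1 h2
    rw [h0, h1, h2]
    simp only [LinearEquiv.symm_apply_apply]
    refine ⟨Pi.single_eq_of_ne ?_ _, Pi.single_eq_of_ne ?_ _, Pi.single_eq_of_ne ?_ _⟩
    all_goals
      rintro rfl
      revert hi
      decide
  have vanish : ∀ (t α β l : K) x, t • x + α • u + β • v = l • v₀ → ∀ i : Fin 5, 3 ≤ i →
      t * e.symm x i = 0 := by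
    intro t α β l x hx i hi
    have := congrFun (congrArg e.symm hx) i
    obtain ⟨c0, c1, c2⟩ := coord i hi
    simpa [c0, c1, c2] using this
  have ht : ∀ x, 4 * cubDer T u x * cubDer T v x - cubPolar T x u v ^ 2 = 0 := by
    have key : ∀ x, e.symm x 3 ≠ 0 →
        4 * cubDer T u x * cubDer T v x - cubPolar T x u v ^ 2 = 0 := by
      intro x hx
      obtain ⟨t, α, β, rfl, hc, hd⟩ := singular_of_lineDisc hL h x
      obtain ⟨l, hl⟩ := hsing _ hc hd
      exact (mul_eq_zero.1 (vanish _ _ _ _ _ hl 3 le_rfl)).resolve_right hx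
    intro x
    by_cases hx : e.symm x 3 = 0
    · have hs : ∀ s : K, s * (4 * cubDer T u (x + s • e (Pi.single 3 1)) *
          cubDer T v (x + s • e (Pi.single 3 1)) -
          cubPolar T (x + s • e (Pi.single 3 1)) u v ^ 2) = 0 := by
        intro s
        by_cases hs : s = 0
        · rw [hs, zero_mul]
        · rw [key, mul_zero]
          simpa [hx] using hs
      simp only [cubDer_add_right, cubDer_smul_right, cubPolar_add_left, cubPolar_smul_left] at hs
      generalize e (Pi.single 3 1) = ξ at hs
      refine (coeff_eq_zero_of_forall (a := 0)
        (c := 4 * cubDer T u ξ * cubDer T v x + 4 * cubDer T u x * cubDer T v ξ -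
          2 * cubPolar T x u v * cubPolar T ξ u v)
        (d := 4 * cubDer T u ξ * cubDer T v ξ - cubPolar T ξ u v ^ 2) fun s => ?_).2.1
      linear_combination hs s
    · exact key x hx
  have hns := fun y z => eq_zero_of_forall_line T hind hL hsing (y := y) (z := z)
  by_cases two : (2 : K) = 0
  · have hB : ∀ x, cubPolar T x u v = 0 := by
      intro x
      have := ht x
      refine pow_eq_zero_iff two_ne_zero |>.1 ?_
      linear_combination (-1 : K) * this + 2 * cubDer T u x * cubDer T v x * two
    have hB' : ∀ x, cubPolar T u v x = 0 := by
      intro x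
      rw [← hB x]
      simp only [cubPolar]
      ring
    have hAD : LinearIndependent K ![cubDerLin T u, cubDerLin T v] := by
      rw [LinearIndependent.pair_iff]
      intro s t hst
      obtain ⟨y, rfl⟩ := IsAlgClosed.exists_pow_nat_eq s two_pos
      obtain ⟨z, rfl⟩ := IsAlgClosed.exists_pow_nat_eq t two_pos
      obtain ⟨rfl, rfl⟩ := hns y z fun x => by
        have := LinearMap.congr_fun hst x
        rw [hB, mul_zero, add_zero]
        exact this
      simp
    obtain ⟨e₂, he₂⟩ := exists_equiv_forall_of_functionals (show 2 + 3 = 5 from rfl) _ hAD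
    have hA : ∀ x, cubDer T u (e₂ x) = x 0 := fun x => he₂ x 0
    have hD : ∀ x, cubDer T v (e₂ x) = x 1 := fun x => he₂ x 1
    have hA0 := hA (Pi.single 0 1)
    have hA1 := hA (Pi.single 1 1)
    have hD0 := hD (Pi.single 0 1)
    have hD1 := hD (Pi.single 1 1)
    simp at hA0 hA1 hD0 hD1
    generalize e₂ (Pi.single 0 1) = e0 at hA0 hD0
    generalize e₂ (Pi.single 1 1) = e1 at hA1 hD1
    clear hA hD he₂
    have hAu : cubDer T u u = 0 := by rw [cubDer_self, h1, mul_zero]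
    have hDv : cubDer T v v = 0 := by rw [cubDer_self, h4, mul_zero]
    have hG : ∀ x, cubDer T x v = 0 := by
      intro x
      have hd := deriv_lineDisc T h x e0
      rw [hB, hB, hA0, hD0] at hd
      refine pow_eq_zero_iff two_ne_zero |>.1 ?_
      linear_combination (-1 : K) * hd + (2 * cubDer T v x * T x x x +
        2 * cubDer T u x * cubDer T v x * cubDer T x e0 -
        cubDer T u x * cubDer T x v * cubPolar T x v e0 -
        cubDer T v x * cubDer T x u * cubPolar T x u e0) * two
    have hF : ∀ x, cubDer T x u = 0 := by
      intro x
      have hd := deriv_lineDisc T h x e1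
      rw [hB, hB, hA1, hD1] at hd
      refine pow_eq_zero_iff two_ne_zero |>.1 ?_
      linear_combination (-1 : K) * hd + (2 * cubDer T u x * T x x x +
        2 * cubDer T u x * cubDer T v x * cubDer T x e1 -
        cubDer T u x * cubDer T x v * cubPolar T x v e1 -
        cubDer T v x * cubDer T x u * cubPolar T x u e1) * two
    have hF' : ∀ x ξ, cubPolar T x u ξ = 0 := by
      intro x ξ
      have := cubDer_add_left T x ξ u
      rw [hF, hF, hF, cubPolar_comm'] at this
      linear_combination -this
    have hG' : ∀ x ξ, cubPolar T x v ξ = 0 := by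
      intro x ξ
      have := cubDer_add_left T x ξ v
      rw [hG, hG, hG, cubPolar_comm'] at this
      linear_combination -this
    obtain ⟨e₃, he₃⟩ := exists_equiv_of_vectors (show 4 + 1 = 5 from rfl) ![e0, e1, u, v] (by
      rw [Fintype.linearIndependent_iff]
      intro g hg
      rw [Fin.sum_univ_four] at hg
      simp only [Matrix.cons_val_zero, Matrix.cons_val_one, Matrix.cons_val] at hg
      have g0 := congrArg (cubDer T u) hg
      have g1 := congrArg (cubDer T v) hg
      have z : ∀ w, cubDer T w 0 = 0 := fun w => map_zero (cubDerLin T w)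
      simp only [cubDer_add_right, cubDer_smul_right, hA0, hA1, hD0, hD1, hAu, hDv, h2, h3, z,
        mul_zero, mul_one, add_zero, zero_add] at g0 g1
      rw [g0, g1] at hg
      obtain ⟨-, g2, g3⟩ := hind (g 2) (g 3) 0 (by
        rw [← hg]; simp)
      intro i
      fin_cases i
      exacts [g0, g1, g2, g3])
    let r := e₃ (Pi.single 4 1) - cubDer T u (e₃ (Pi.single 4 1)) • e0 -
      cubDer T v (e₃ (Pi.single 4 1)) • e1
    have hspan : ∀ x, cubDer T x r = 0 → ∀ w, cubDer T x w =
        cubDer T u w * cubDer T x e0 + cubDer T v w * cubDer T x e1 := by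
      intro x hx
      have e0' : e₃ (Pi.single 0 1) = e0 := he₃ 0
      have e1' : e₃ (Pi.single 1 1) = e1 := he₃ 1
      have e2' : e₃ (Pi.single 2 1) = u := he₃ 2
      have e3' : e₃ (Pi.single 3 1) = v := he₃ 3
      have hr : cubDer T x (e₃ (Pi.single 4 1)) =
          cubDer T u (e₃ (Pi.single 4 1)) * cubDer T x e0 +
          cubDer T v (e₃ (Pi.single 4 1)) * cubDer T x e1 := by
        have : cubDerLin T x r = 0 := hx
        simp only [r, map_sub, map_smul, cubDerLin_apply, smul_eq_mul] at this
        linear_combination this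
      have : (cubDerLin T x).comp e₃.toLinearMap = (cubDer T x e0 • cubDerLin T u +
          cubDer T x e1 • cubDerLin T v).comp e₃.toLinearMap := by
        refine LinearMap.pi_ext' fun i => LinearMap.ext_ring ?_
        fin_cases i
        · simp [e0', hA0, hD0]
        · simp [e1', hA1, hD1]
        · simp [e2', hAu, h3, hF]
        · simp [e3', hDv, h2, hG]
        · simp [hr, mul_comm]
      intro w
      have := LinearMap.congr_fun this (e₃.symm w)
      simp at this
      rw [this]
      ring
    obtain ⟨y, z, hyz, hq⟩ := exists_binary_zero (cubDer T (e (Pi.single 3 1)) r)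
      (cubPolar T (e (Pi.single 3 1)) (e (Pi.single 4 1)) r) (cubDer T (e (Pi.single 4 1)) r)
    set x := y • e (Pi.single 3 1) + z • e (Pi.single 4 1) with hx
    have hxr : cubDer T x r = 0 := by
      have := cubDer_plane T 0 (e (Pi.single 3 1)) (e (Pi.single 4 1)) r 0 y z
      rw [zero_smul, zero_add] at this
      rw [hx, this]
      linear_combination hq
    obtain ⟨a, ha⟩ := IsAlgClosed.exists_pow_nat_eq (-cubDer T x e0) two_pos
    obtain ⟨b, hb⟩ := IsAlgClosed.exists_pow_nat_eq (-cubDer T x e1) two_pos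
    have hder : ∀ w, cubDer T ((1 : K) • x + a • u + b • v) w = 0 := by
      intro w
      rw [cubDer_plane, hF', hG', hB', ha, hb, hspan x hxr w]
      ring
    obtain ⟨l, hl⟩ := hsing ((1 : K) • x + a • u + b • v) (by
      have := cubDer_self T ((1 : K) • x + a • u + b • v)
      rw [hder] at this
      linear_combination -this - T ((1 : K) • x + a • u + b • v)
        ((1 : K) • x + a • u + b • v) ((1 : K) • x + a • u + b • v) * two) hder
    have k3 := vanish _ _ _ _ _ hl 3 le_rfl
    have k4 := vanish _ _ _ _ _ hl 4 (by decide)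
    simp [hx] at k3 k4
    exact hyz.elim (fun h => h k3) fun h => h k4
  · have hA : ∃ x, cubDer T u x ≠ 0 := by
      by_contra! hA
      exact one_ne_zero (hns 1 0 fun x => by rw [hA]; ring).1
    obtain ⟨x₁, hx₁⟩ := hA
    refine hx₁ ?_
    have := (hns (-cubPolar T x₁ u v) (2 * cubDer T u x₁) fun x => ?_).2
    · exact (mul_eq_zero.1 this).resolve_left two
    · have t0 := ht x
      have t1 := ht x₁
      have t2 := ht (x + x₁)
      simp only [cubDer_add_right, cubPolar_add_left] at t2
      linear_combination cubDer T u x₁ * (t2 - t0 - t1) - cubDer T u x * t1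

end

section
variable {K : Type} [Field K]

theorem exists_equiv_of_vectors_rev {m k d : ℕ} (hd : m + k = d) (v : Fin m → Fin d → K)
    (hv : LinearIndependent K v) : ∃ e : (Fin d → K) ≃ₗ[K] (Fin d → K),
      ∀ i : Fin m, e (Pi.single (Fin.castLE (by omega) i).rev 1) = v i := by
  obtain ⟨e, he⟩ := exists_equiv_of_vectors hd v hv
  refine ⟨(LinearEquiv.funCongrLeft K K Fin.revPerm).trans e, fun i => ?_⟩
  rw [← he i, LinearEquiv.trans_apply]
  congr 1
  funext j
  simp [LinearEquiv.funCongrLeft_apply, LinearMap.funLeft_apply, Pi.single_apply]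

theorem sum_apply_single_mul {m : ℕ} (φ : (Fin m → K) →ₗ[K] K) (x : Fin m → K) :
    ∑ i, φ (Pi.single i 1) * x i = φ x := by
  conv_rhs => rw [pi_eq_sum_univ' x]
  simp [mul_comm]

/-- The quadratic form of a bilinear form as a polynomial. -/
noncomputable def bilinPoly {m : ℕ} (B : (Fin m → K) →ₗ[K] (Fin m → K) →ₗ[K] K) :
    MvPolynomial (Fin m) K :=
  ∑ i, ∑ j, C (B (Pi.single j 1) (Pi.single i 1)) * (X i * X j)

theorem eval_bilinPoly {m : ℕ} (B : (Fin m → K) →ₗ[K] (Fin m → K) →ₗ[K] K) (x : Fin m → K) :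
    eval x (bilinPoly B) = B x x := by
  have hx : x = ∑ i, x i • Pi.single i (1 : K) := by
    rw [← pi_eq_sum_univ' x]
  conv_rhs => rw [hx]
  simp only [bilinPoly, map_sum, map_mul, eval_C, eval_X, LinearMap.sum_apply, map_smul,
    LinearMap.smul_apply, smul_eq_mul]
  refine Finset.sum_congr rfl fun i _ => ?_
  rw [Finset.mul_sum]
  refine Finset.sum_congr rfl fun j _ => ?_
  ring

/-- The inclusion of the first three coordinates. -/
def inclThree : (Fin 3 → K) →ₗ[K] (Fin 5 → K) where
  toFun x := ![x 0, x 1, x 2, 0, 0]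
  map_add' x y := by
    funext i
    fin_cases i <;> simp
  map_smul' a x := by
    funext i
    fin_cases i <;> simp

/-- The polar form of a cubic form at a pair of points as a linear form. -/
def cubPolarLin {V : Type} [AddCommGroup V] [Module K V] (T : V →ₗ[K] V →ₗ[K] V →ₗ[K] K)
    (u v : V) : V →ₗ[K] K where
  toFun x := cubPolar T x u v
  map_add' x y := cubPolar_add_left T x y u v
  map_smul' a x := cubPolar_smul_left T a x u v

theorem isDoubleCone_of_vertices {c : (Fin 5 → K) → K} {v w : Fin 5 → K}
    (hvw : LinearIndependent K ![v, w]) (hv : ∀ x (l : K), c (x + l • v) = c x)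
    (hw : ∀ x (l : K), c (x + l • w) = c x) : IsDoubleCone c := by
  obtain ⟨e, he⟩ := exists_equiv_of_vectors_rev (show 2 + 3 = 5 from rfl) _ hvw
  have he0 : e (Pi.single 4 1) = v := he 0
  have he1 : e (Pi.single 3 1) = w := he 1
  refine ⟨e, fun x x' h0 h1 h2 => ?_⟩
  have hx : x = x' + (x 4 - x' 4) • Pi.single 4 1 + (x 3 - x' 3) • Pi.single 3 1 := by
    funext i
    fin_cases i <;> simp [h0, h1, h2]
  rw [hx, map_add, map_smul, he1, hw, map_add, map_smul, he0, hv]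

theorem lineDisc_line [Infinite K] {V : Type} [AddCommGroup V] [Module K V]
    {T : V →ₗ[K] V →ₗ[K] V →ₗ[K] K} {u v : V}
    (hL : ∀ y z : K, T (y • u + z • v) (y • u + z • v) (y • u + z • v) = 0) (y z : K) :
    lineDisc T u v (y • u + z • v) = 0 := by
  obtain ⟨h1, h2, h3, h4⟩ := cub_line_eq_zero hL
  have e1 : cubDer T u (y • u + z • v) = 0 := by
    rw [cubDer_add_right, cubDer_smul_right, cubDer_smul_right, cubDer_self, h1, h2]
    ring
  have e2 : cubDer T v (y • u + z • v) = 0 := by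
    rw [cubDer_add_right, cubDer_smul_right, cubDer_smul_right, cubDer_self, h3, h4]
    ring
  have e3 : cubPolar T (y • u + z • v) u v = 0 := by
    rw [cubPolar_add_left, cubPolar_smul_left, cubPolar_smul_left, cubPolar_self, h2,
      cubPolar_comm', cubPolar_self, h3]
    ring
  rw [lineDisc, e1, e2, e3, conicDisc]
  ring

variable {p : ℕ} [hp : Fact p.Prime] [CharP K p] [IsAlgClosed K] [LocFin p K]

theorem lowerBound_of_line_of_singular
    (T : (Fin 5 → K) →ₗ[K] (Fin 5 → K) →ₗ[K] (Fin 5 → K) →ₗ[K] K) {v₀ u v : Fin 5 → K}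
    (hind : ∀ a b l : K, l • v₀ + a • u + b • v = 0 → l = 0 ∧ a = 0 ∧ b = 0)
    (hL : ∀ y z : K, T (y • u + z • v) (y • u + z • v) (y • u + z • v) = 0)
    (hsing : ∀ x, T x x x = 0 → (∀ w, cubDer T x w = 0) → ∃ l : K, x = l • v₀) :
    LowerBound p fun v => T v v v := by
  obtain ⟨x₀, hx₀⟩ := exists_lineDisc_ne_zero T hind hL hsing
  obtain ⟨h1, h2, h3, h4⟩ := cub_line_eq_zero hL
  obtain ⟨e, he⟩ := exists_equiv_of_vectors_rev (show 3 + 2 = 5 from rfl) ![v, u, x₀] (by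
    rw [Fintype.linearIndependent_iff]
    intro g hg
    rw [Fin.sum_univ_three] at hg
    simp only [Matrix.cons_val_zero, Matrix.cons_val_one, Matrix.cons_val] at hg
    have g2 : g 2 = 0 := by
      by_contra g2
      refine hx₀ ?_
      have : x₀ = (-(g 2)⁻¹ * g 1) • u + (-(g 2)⁻¹ * g 0) • v := by
        funext k
        have hk := congrFun hg k
        simp only [Pi.add_apply, Pi.smul_apply, smul_eq_mul, Pi.zero_apply] at hk ⊢
        field_simp
        linear_combination hk
      rw [this]
      exact lineDisc_line hL _ _
    obtain ⟨-, g1, g0⟩ := hind (g 1) (g 0) 0 (by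
      rw [← hg, g2]
      module)
    intro i
    fin_cases i
    exacts [g0, g1, g2])
  have he4 : e (Pi.single 4 1) = v := he 0
  have he3 : e (Pi.single 3 1) = u := he 1
  have he2 : e (Pi.single 2 1) = x₀ := he 2
  let j : (Fin 3 → K) →ₗ[K] (Fin 5 → K) := e.toLinearMap ∘ₗ inclThree
  have hj : ∀ w : Fin 5 → K, e w = (1 : K) • j ![w 0, w 1, w 2] + w 3 • u + w 4 • v := by
    intro w
    have hw : w = inclThree ![w 0, w 1, w 2] + w 3 • Pi.single 3 1 + w 4 • Pi.single 4 1 := by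
      funext i
      simp only [Pi.add_apply, Pi.smul_apply, inclThree, LinearMap.coe_mk, AddHom.coe_mk]
      fin_cases i <;> simp
    conv_lhs => rw [hw, map_add, map_add, map_smul, map_smul, he3, he4]
    rw [one_smul]
    rfl
  have hjx : j ![0, 0, 1] = x₀ := by
    rw [← he2]
    change e (inclThree _) = _
    congr 1
    funext i
    fin_cases i <;> simp [inclThree]
  obtain ⟨F, hF⟩ := exists_bilin_cubDer T j u
  obtain ⟨G, hG⟩ := exists_bilin_cubDer T j v
  have hα : ∀ x, ∑ i, cubDer T u (j (Pi.single i 1)) * x i = cubDer T u (j x) :=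
    sum_apply_single_mul ((cubDerLin T u).comp j)
  have hγ : ∀ x, ∑ i, cubDer T v (j (Pi.single i 1)) * x i = cubDer T v (j x) :=
    sum_apply_single_mul ((cubDerLin T v).comp j)
  have hβ : ∀ x, ∑ i, cubPolar T (j (Pi.single i 1)) u v * x i = cubPolar T (j x) u v :=
    sum_apply_single_mul ((cubPolarLin T u v).comp j)
  have hh : ∀ x, eval x (cubicPoly (triComp T j)) = T (j x) (j x) (j x) := fun x =>
    eval_cubicPoly _ _
  have hf : ∀ x, eval x (bilinPoly F) = cubDer T (j x) u := fun x => (eval_bilinPoly _ _).trans (hF x)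
  have hg : ∀ x, eval x (bilinPoly G) = cubDer T (j x) v := fun x => (eval_bilinPoly _ _).trans (hG x)
  refine LowerBound.of_comp e ?_
  refine lowerBound_of_line (x₀ := ![0, 0, 1]) (f := bilinPoly F) (g := bilinPoly G)
    (h := cubicPoly (triComp T j)) (α := fun i => cubDer T u (j (Pi.single i 1)))
    (β := fun i => cubPolar T (j (Pi.single i 1)) u v)
    (γ := fun i => cubDer T v (j (Pi.single i 1))) ?_ ?_ ?_ ?_ rfl ?_ ?_
  · intro l x
    rw [hf, hf, map_smul, cubDer_smul_left]
  · intro l x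
    rw [hg, hg, map_smul, cubDer_smul_left]
  · intro l x
    rw [hh, hh, map_smul, cub_smul]
  · intro y z hyz
    by_contra! h0
    have hz : ∀ x, y ^ 2 * cubDer T u x + z ^ 2 * cubDer T v x + y * z * cubPolar T x u v = 0 := by
      intro x
      obtain ⟨w, rfl⟩ := e.surjective x
      rw [hj w, one_smul, add_assoc (j _), cubDer_add_right, cubDer_add_right T v, cubPolar_add_left,
        ← hα, ← hβ, ← hγ]
      have e1 : cubDer T u (w 3 • u + w 4 • v) = 0 := by
        rw [cubDer_add_right, cubDer_smul_right, cubDer_smul_right, cubDer_self, h1, h2]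
        ring
      have e2 : cubDer T v (w 3 • u + w 4 • v) = 0 := by
        rw [cubDer_add_right, cubDer_smul_right, cubDer_smul_right, cubDer_self, h3, h4]
        ring
      have e3 : cubPolar T (w 3 • u + w 4 • v) u v = 0 := by
        rw [cubPolar_add_left, cubPolar_smul_left, cubPolar_smul_left, cubPolar_self, h2,
          cubPolar_comm', cubPolar_self, h3]
        ring
      rw [e1, e2, e3, add_zero, add_zero, add_zero, Finset.mul_sum, Finset.mul_sum, Finset.mul_sum,
        ← Finset.sum_add_distrib, ← Finset.sum_add_distrib]
      refine Finset.sum_eq_zero fun i _ => ?_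
      linear_combination ![w 0, w 1, w 2] i * h0 i
    obtain ⟨hy, hz⟩ := eq_zero_of_forall_line T hind hL hsing hz
    exact hyz.elim (fun h => h hy) fun h => h hz
  · rw [hα, hβ, hγ, hf, hg, hh, hjx]
    exact hx₀
  · intro w
    rw [hα, hβ, hγ, hf, hg, hh, hj w, cub_plane, h1, h2, h3, h4]
    ring

theorem lowerBound_of_not_isDoubleCone
    (T : (Fin 5 → K) →ₗ[K] (Fin 5 → K) →ₗ[K] (Fin 5 → K) →ₗ[K] K)
    (hT : ¬ IsDoubleCone fun v => T v v v) : LowerBound p fun v => T v v v := by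
  by_cases hI : ∃ v₀ y₀, T v₀ v₀ v₀ = 0 ∧ (∀ w, cubDer T v₀ w = 0) ∧ cubDer T y₀ v₀ ≠ 0
  · obtain ⟨v₀, y₀, h0, hder, hy₀⟩ := hI
    exact lowerBound_of_singular_not_vertex T hT h0 hder hy₀
  push Not at hI
  have hvert : ∀ v, T v v v = 0 → (∀ w, cubDer T v w = 0) → ∀ x (l : K),
      T (x + l • v) (x + l • v) (x + l • v) = T x x x := by
    intro v h0 hd x l
    rw [cub_add_smul, h0, hd, hI v x h0 hd]
    ring
  have hv₀ : ∃ v₀ : Fin 5 → K, v₀ ≠ 0 ∧ ∀ x, T x x x = 0 → (∀ w, cubDer T x w = 0) →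
      ∃ l : K, x = l • v₀ := by
    by_cases h : ∃ v₀ : Fin 5 → K, v₀ ≠ 0 ∧ T v₀ v₀ v₀ = 0 ∧ ∀ w, cubDer T v₀ w = 0
    · obtain ⟨v₀, hv₀, h0, hd⟩ := h
      refine ⟨v₀, hv₀, fun x hx hxd => ?_⟩
      by_contra! hl
      exact hT (isDoubleCone_of_vertices
        ((LinearIndependent.pair_iff' hv₀).2 fun a ha => hl a ha.symm)
        (hvert v₀ h0 hd) (hvert x hx hxd))
    · push Not at h
      refine ⟨Pi.single 0 1, by simp, fun x hx hxd => ⟨0, ?_⟩⟩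
      rw [zero_smul]
      by_contra hx0
      obtain ⟨w, hw⟩ := h x hx0 hx
      exact hw (hxd w)
  obtain ⟨v₀, hv₀, hsing⟩ := hv₀
  obtain ⟨e, he⟩ := exists_equiv_of_vectors (show 1 + 4 = 5 from rfl) ![v₀]
    (linearIndependent_unique_iff.2 hv₀)
  have he : e (Pi.single 0 1) = v₀ := he 0
  let ι : (Fin 4 → K) →ₗ[K] (Fin 5 → K) := e.toLinearMap ∘ₗ
    (Fin.consLinearEquiv K fun _ : Fin 5 => K).toLinearMap ∘ₗ LinearMap.inr K K (Fin 4 → K)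
  have hι : ∀ y, e.symm (ι y) = Fin.cons 0 y := fun y => e.symm_apply_apply _
  obtain ⟨u, v, huv, hL⟩ := exists_line (triComp T ι)
  refine lowerBound_of_line_of_singular T (v₀ := v₀) (u := ι u) (v := ι v) ?_ ?_ hsing
  · intro a b l h
    have h := congrArg e.symm h
    rw [map_add, map_add, map_smul, map_smul, map_smul, hι, hι, ← he, e.symm_apply_apply,
      map_zero] at h
    refine ⟨by simpa using congrFun h 0, huv a b ?_⟩
    funext i
    simpa using congrFun h i.succ
  · intro y z
    have := hL y z
    rw [triComp_apply, map_add, map_smul, map_smul] at this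
    exact this

end

section
variable {K : Type} [Field K]

theorem vars_subset_of_eval_eq [Infinite K] {m : ℕ} {s : Finset (Fin m)} {Q : MvPolynomial (Fin m) K}
    (h : ∀ w w' : Fin m → K, (∀ i ∈ s, w i = w' i) → eval w Q = eval w' Q) : Q.vars ⊆ s := by
  have hQ : Q = bind₁ (fun i => if i ∈ s then X i else 0) Q := by
    refine MvPolynomial.funext fun w => ?_
    rw [← coe_aeval_eq_eval, RingHom.coe_coe, aeval_bind₁]
    have := h w (fun i => aeval w (if i ∈ s then X i else 0 : MvPolynomial (Fin m) K))
      fun i hi => by simp [hi]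
    rwa [← coe_aeval_eq_eval, ← coe_aeval_eq_eval] at this
  rw [hQ]
  refine (vars_bind₁ _ _).trans (Finset.biUnion_subset.2 fun i _ => ?_)
  split_ifs with hi
  · rw [vars_X]
    exact Finset.singleton_subset_iff.2 hi
  · simp

/-- The trilinear form `x i * y j * z l`. -/
def triMonomial (i j l : Fin 5) : (Fin 5 → K) →ₗ[K] (Fin 5 → K) →ₗ[K] (Fin 5 → K) →ₗ[K] K :=
  ((LinearMap.mul K K).compl₁₂ (LinearMap.proj i) (LinearMap.proj j)).compr₂
    (LinearMap.toSpanSingleton K _ (LinearMap.proj l))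

theorem exists_trilinear_of_isHomogeneous {Q : MvPolynomial (Fin 5) K} (hQ : Q.IsHomogeneous 3) :
    ∃ T : (Fin 5 → K) →ₗ[K] (Fin 5 → K) →ₗ[K] (Fin 5 → K) →ₗ[K] K, ∀ v, T v v v = eval v Q := by
  have h : ∀ d : Fin 5 →₀ ℕ, ∃ T : (Fin 5 → K) →ₗ[K] (Fin 5 → K) →ₗ[K] (Fin 5 → K) →ₗ[K] K,
      ∀ v, T v v v = eval v (monomial d (Q.coeff d)) := by
    intro d
    by_cases h0 : Q.coeff d = 0
    · exact ⟨0, fun v => by simp [h0]⟩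
    have hd : (Finsupp.toMultiset d).card = 3 := by
      rw [Finsupp.card_toMultiset, ← hQ h0]
      exact DFunLike.congr_fun (Finsupp.degree_eq_weight_one (σ := Fin 5) (R := ℕ)) d
    obtain ⟨i, j, l, hd⟩ := Multiset.card_eq_three.1 hd
    have hd : d = Finsupp.single i 1 + Finsupp.single j 1 + Finsupp.single l 1 := by
      apply Multiset.toFinsupp.symm.injective
      change Finsupp.toMultiset d = Finsupp.toMultiset _
      rw [hd]
      simp [← Multiset.singleton_add, add_assoc]
    refine ⟨Q.coeff d • triMonomial i j l, fun v => ?_⟩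
    rw [eval_monomial]
    generalize Q.coeff d = a
    rw [hd, Finsupp.prod_add_index' (by simp) (by intros; rw [pow_add]),
      Finsupp.prod_add_index' (by simp) (by intros; rw [pow_add])]
    simp [triMonomial]
  choose T hT using h
  refine ⟨∑ d ∈ Q.support, T d, fun v => ?_⟩
  conv_rhs => rw [Q.as_sum, map_sum]
  simp only [LinearMap.sum_apply, hT]

theorem not_isDoubleCone_of_vars [Infinite K] {Q : MvPolynomial (Fin 5) K}
    (hnc : ¬ ∃ M : Matrix (Fin 5) (Fin 5) K, IsUnit M.det ∧
      (aeval (fun i => ∑ j, C (M i j) * X j) Q).vars ⊆ ({0, 1, 2} : Finset (Fin 5))) :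
    ¬ IsDoubleCone fun v => eval v Q := by
  rintro ⟨e, he⟩
  let M : Matrix (Fin 5) (Fin 5) K := LinearMap.toMatrix' e.toLinearMap
  refine hnc ⟨M, ?_, vars_subset_of_eval_eq fun w w' h => ?_⟩
  · rw [LinearMap.det_toMatrix']
    exact e.isUnit_det'
  · have key : ∀ w, eval w (aeval (fun i => ∑ j, C (M i j) * X j) Q) = eval (e w) Q := by
      intro w
      have hw : e w = fun i => aeval w (∑ j, C (M i j) * X j) := by
        rw [← LinearEquiv.coe_coe, ← LinearMap.toMatrix'_mulVec e.toLinearMap w]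
        funext i
        simp [Matrix.mulVec, dotProduct, M]
      rw [hw, ← coe_aeval_eq_eval, ← coe_aeval_eq_eval]
      exact aeval_bind₁ _ _ _
    rw [key, key]
    exact he w w' (h 0 (by simp)) (h 1 (by simp)) (h 2 (by simp))

theorem locFin_of_isAlgebraic {k : Type} [Field k] [Finite k] [Algebra k K]
    [Algebra.IsAlgebraic k K] (p : ℕ) [CharP K p] : LocFin p K where
  exists_pow x := by
    have : FiniteDimensional k (IntermediateField.adjoin k {x}) :=
      IntermediateField.adjoin.finiteDimensional (Algebra.IsIntegral.isIntegral x)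
    have : Finite (IntermediateField.adjoin k {x}) := Module.finite_of_finite k
    have := Fintype.ofFinite (IntermediateField.adjoin k {x})
    have : CharP (IntermediateField.adjoin k {x}) p :=
      (algebraMap (IntermediateField.adjoin k {x}) K).charP (RingHom.injective _) p
    obtain ⟨n, -, hn⟩ := FiniteField.card (IntermediateField.adjoin k {x}) p
    refine ⟨n, n.pos, ?_⟩
    have := FiniteField.pow_card (⟨x, IntermediateField.mem_adjoin_simple_self k x⟩ :
      IntermediateField.adjoin k {x})
    rw [hn] at this
    simpa using congrArg Subtype.val this

theorem card_affine_zeros {F : Type} [Field F] [Finite F] {p : ℕ} [Fact p.Prime] [CharP K p]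
    [IsAlgClosed K] (φ : F →+* K) {n : ℕ} (hn : 0 < n) (hF : Nat.card F = p ^ n)
    (Q : MvPolynomial (Fin 5) F) :
    Nat.card {x : Fin 5 → F // eval x Q = 0} =
      affCount (Fs p K n) fun v => eval v (map φ Q) = 0 := by
  classical
  have := Fintype.ofFinite F
  have hmem : ∀ x, φ x ∈ Fs p K n := by
    intro x
    rw [mem_Fs hn, ← map_pow, ← hF, Nat.card_eq_fintype_card, FiniteField.pow_card]
  have himg : Finset.univ.image φ = Fs p K n := by
    refine Finset.eq_of_subset_of_card_le (fun y hy => ?_) ?_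
    · obtain ⟨x, -, rfl⟩ := Finset.mem_image.1 hy
      exact hmem x
    · rw [card_Fs hn, Finset.card_image_of_injective _ φ.injective, Finset.card_univ,
        ← Nat.card_eq_fintype_card, hF]
  have hev : ∀ x : Fin 5 → F, eval (fun i => φ (x i)) (map φ Q) = φ (eval x Q) := by
    intro x
    rw [eval_map, ← eval₂_id (g := x), eval₂_comp_left]
    rfl
  rw [affCount, ← Nat.card_eq_finsetCard]
  refine Nat.card_congr (Equiv.ofBijective (fun x => ⟨fun i => φ (x.1 i), ?_⟩) ⟨?_, ?_⟩)
  · simp only [Finset.mem_filter, Fintype.mem_piFinset]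
    exact ⟨fun i => hmem _, by rw [hev, x.2, map_zero]⟩
  · intro x y h
    apply Subtype.ext
    funext i
    exact φ.injective (congrFun (congrArg Subtype.val h) i)
  · rintro ⟨y, hy⟩
    simp only [Finset.mem_filter, Fintype.mem_piFinset, ← himg, Finset.mem_image,
      Finset.mem_univ, true_and] at hy
    obtain ⟨hy, hy0⟩ := hy
    choose x hx using hy
    obtain rfl : (fun i => φ (x i)) = y := funext hx
    rw [hev] at hy0
    exact ⟨⟨x, φ.injective (hy0.trans (map_zero φ).symm)⟩, rfl⟩

theorem card_nonzero_zeros {F : Type} [Field F] [Finite F] {Q : MvPolynomial (Fin 5) F}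
    (h0 : eval 0 Q = 0) :
    Nat.card {x : Fin 5 → F // x ≠ 0 ∧ eval x Q = 0} + 1 =
      Nat.card {x : Fin 5 → F // eval x Q = 0} := by
  classical
  have := Fintype.ofFinite F
  rw [Nat.card_eq_fintype_card, Nat.card_eq_fintype_card, Fintype.card_subtype,
    Fintype.card_subtype]
  have : (Finset.univ.filter fun x : Fin 5 → F => x ≠ 0 ∧ eval x Q = 0) =
      (Finset.univ.filter fun x : Fin 5 → F => eval x Q = 0).erase 0 := by
    ext x
    simp
  rw [this, Finset.card_erase_add_one]
  simpa using h0

end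

theorem projCard_three (q : ℕ) : projCard q 3 = 1 + q + q ^ 2 + q ^ 3 := by
  simp [projCard, Finset.sum_range_succ]

/-- A lower bound on the number of affine zeros bounds `Ecubic` from below. -/
theorem neg_le_Ecubic {F : Type} [Field F] [Finite F] {Q : MvPolynomial (Fin 5) F}
    (h0 : eval 0 Q = 0) {M s : ℕ} (hs : Nat.card F = s ^ 2)
    (hb : Nat.card F ^ 4 ≤ Nat.card {x : Fin 5 → F // eval x Q = 0} + M * (Nat.card F ^ 2 * s)) :
    -((2 * M + 1 : ℝ) * (Nat.card F : ℝ) ^ ((3 : ℝ) / 2)) ≤ (Ecubic F Q : ℝ) := by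
  have hq : 2 ≤ Nat.card F := Finite.one_lt_card
  have hpow : (Nat.card F : ℝ) ^ ((3 : ℝ) / 2) = Nat.card F * s := by
    rw [hs]
    push_cast
    rw [← Real.rpow_natCast_mul (by positivity), show ((2 : ℕ) : ℝ) * (3 / 2) = (3 : ℕ) by norm_num,
      Real.rpow_natCast]
    ring
  rw [hpow]
  have hcard := card_nonzero_zeros h0
  generalize hN : Nat.card {x : Fin 5 → F // eval x Q = 0} = N at *
  generalize hN' : Nat.card {x : Fin 5 → F // x ≠ 0 ∧ eval x Q = 0} = N' at *
  have hE : Ecubic F Q = ((N' / (Nat.card F - 1) : ℕ) : ℤ) - (projCard (Nat.card F) 3 : ℤ) := by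
    rw [← hN']
    rfl
  rw [hE, projCard_three]
  generalize Nat.card F = q at *
  obtain ⟨r, rfl⟩ : ∃ r, q = r + 1 := ⟨q - 1, by omega⟩
  have hr : 1 ≤ r := by omega
  have hs1 : 1 ≤ s := by
    rcases Nat.eq_zero_or_pos s with rfl | h
    · simp at hs
    · exact h
  rw [Nat.add_sub_cancel]
  have hlt : N' < (N' / r + 1) * r := by
    rw [mul_comm]
    exact Nat.lt_mul_div_succ _ hr
  generalize N' / r = c at *
  have h1 : (N' : ℝ) < (c + 1) * r := by exact_mod_cast hlt
  have h2 : (N' : ℝ) + 1 = N := by exact_mod_cast hcard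
  have h3 : ((r : ℝ) + 1) ^ 4 ≤ N + M * ((r + 1) ^ 2 * s) := by exact_mod_cast hb
  have hr' : (1 : ℝ) ≤ r := by exact_mod_cast hr
  have hs' : (1 : ℝ) ≤ s := by exact_mod_cast hs1
  push_cast
  have hM : (0 : ℝ) ≤ M := Nat.cast_nonneg M
  have h4 : (r : ℝ) * (1 + (r + 1) + (r + 1) ^ 2 + (r + 1) ^ 3 - c - 1) ≤
      r * (2 * M * ((r + 1) * s)) := by
    have : (M : ℝ) * ((r + 1) ^ 2 * s) ≤ r * (2 * M * ((r + 1) * s)) := by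
      have : 0 ≤ (M : ℝ) * ((r + 1) * s) * (r - 1) :=
        mul_nonneg (by positivity) (by linarith)
      linarith
    nlinarith
  have h5 := le_of_mul_le_mul_left h4 (by linarith)
  have h6 : (1 : ℝ) ≤ (r + 1) * s := by nlinarith
  linarith

theorem exists_dvd_neg_le_Ecubic (k : Type) [Field k] [Finite k] {p : ℕ} [Fact p.Prime] [CharP k p]
    (Cf : MvPolynomial (Fin 5) k) (hC : Cf.IsHomogeneous 3)
    (hnc : ¬ ∃ M : Matrix (Fin 5) (Fin 5) (AlgebraicClosure k), IsUnit M.det ∧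
      (MvPolynomial.aeval (fun i => ∑ j, MvPolynomial.C (M i j) * X j)
        (map (algebraMap k (AlgebraicClosure k)) Cf)).vars ⊆ ({0, 1, 2} : Finset (Fin 5))) :
    ∃ (a M : ℕ), 0 < a ∧ ∀ (F : Type) [Field F] [Finite F] (ψ : k →+* F) (n : ℕ), 0 < n → a ∣ n →
      Nat.card F = p ^ n →
      -((2 * M + 1 : ℝ) * (Nat.card F : ℝ) ^ ((3 : ℝ) / 2)) ≤ (Ecubic F (map ψ Cf) : ℝ) := by
  have : CharP (AlgebraicClosure k) p :=
    charP_of_injective_ringHom (algebraMap k (AlgebraicClosure k)).injective p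
  have := locFin_of_isAlgebraic (k := k) (K := AlgebraicClosure k) p
  have : Infinite (AlgebraicClosure k) := IsAlgClosed.instInfinite
  obtain ⟨T, hT⟩ := exists_trilinear_of_isHomogeneous
    (hC.map (algebraMap k (AlgebraicClosure k)))
  have hcone := not_isDoubleCone_of_vars hnc
  simp only [← hT] at hcone
  obtain ⟨M, hM⟩ := lowerBound_of_not_isDoubleCone (p := p) T hcone
  obtain ⟨a, ha, H⟩ := eventually_divFilter.1 (hM.and eventually_pow_eq_sq)
  refine ⟨a, M, ha, fun F _ _ ψ n hn han hF => ?_⟩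
  obtain ⟨h1, h2⟩ := H n hn han
  let := ψ.toAlgebra
  have : Module.Finite k F := Module.Finite.of_finite
  let φ : F →ₐ[k] AlgebraicClosure k := IsAlgClosed.lift
  have hφ : map (φ : F →+* AlgebraicClosure k) (map ψ Cf) =
      map (algebraMap k (AlgebraicClosure k)) Cf := by
    rw [map_map]
    exact congrArg (fun f => map f Cf) φ.comp_algebraMap
  refine neg_le_Ecubic (s := p ^ (n / 2)) ?_ (hF.trans h2) ?_
  · rw [eval_zero, constantCoeff_eq]
    exact (hC.map ψ).coeff_eq_zero (by simp)
  · rw [card_affine_zeros (p := p) (φ : F →+* AlgebraicClosure k) hn hF, hφ, hF]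
    simpa only [hT] using h1

/-- Theorem 5.4 (cubic threefolds), equivalence (1) ⟺ (2): if `X_{k̄}` is not a
cone over a cone, then `X` is stably `E`-bad iff it is stably `|E|`-bad. -/
theorem stmt13 (k : Type) [Field k] [Fintype k]
    (Cf : MvPolynomial (Fin 5) k) (hC0 : Cf ≠ 0) (hC : Cf.IsHomogeneous 3)
    (hnc : ¬ ∃ M : Matrix (Fin 5) (Fin 5) (AlgebraicClosure k), IsUnit M.det ∧
      (MvPolynomial.aeval (fun i => ∑ j, MvPolynomial.C (M i j) * X j)
        (map (algebraMap k (AlgebraicClosure k)) Cf)).vars ⊆ ({0, 1, 2} : Finset (Fin 5))) :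
    ((∀ (k' : Type) [Field k'] [Fintype k'] [Algebra k k'],
        ¬ ∃ C₀ : ℝ, 0 < C₀ ∧ ∀ (k'' : Type) [Field k''] [Fintype k''] [Algebra k' k''],
          (Ecubic k'' (map (algebraMap k' k'') (map (algebraMap k k') Cf)) : ℝ) ≤
            C₀ * (Nat.card k'' : ℝ) ^ ((3 : ℝ) / 2)) ↔
      (∀ (k' : Type) [Field k'] [Fintype k'] [Algebra k k'],
        ¬ ∃ C₀ : ℝ, 0 < C₀ ∧ ∀ (k'' : Type) [Field k''] [Fintype k''] [Algebra k' k''],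
          |(Ecubic k'' (map (algebraMap k' k'') (map (algebraMap k k') Cf)) : ℝ)| ≤
            C₀ * (Nat.card k'' : ℝ) ^ ((3 : ℝ) / 2))) := by
  refine ⟨fun h k' _ _ _ ⟨C₀, hC₀, hk⟩ => h k' ⟨C₀, hC₀, fun k'' _ _ _ =>
    (le_abs_self _).trans (hk k'')⟩, fun h k' _ _ _ ⟨C₀, hC₀, hk⟩ => ?_⟩
  obtain ⟨p, hchar, -⟩ := FiniteField.card' k
  have : Fact p.Prime := ⟨CharP.char_is_prime k p⟩
  obtain ⟨a, M, ha, H⟩ := exists_dvd_neg_le_Ecubic k Cf hC hnc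
  have : NeZero a := ⟨ha.ne'⟩
  have : CharP k' p := charP_of_injective_ringHom (algebraMap k k').injective p
  let L := FiniteField.Extension k' p a
  let ψ : k' →+* L := algebraMap k' L
  let := Fintype.ofFinite L
  let : Algebra k L := (ψ.comp (algebraMap k k')).toAlgebra
  refine h L ⟨max C₀ (2 * M + 1), lt_max_of_lt_left hC₀, fun F _ _ _ => ?_⟩
  have hpos : (0 : ℝ) ≤ (Nat.card F : ℝ) ^ ((3 : ℝ) / 2) := by positivity
  have hmap : map (algebraMap L F) (map (algebraMap k L) Cf) =
      map ((algebraMap L F).comp (ψ.comp (algebraMap k k'))) Cf := map_map _ _ _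
  obtain ⟨m, -, hm⟩ := FiniteField.card k' p
  have : Module.Finite L F := Module.Finite.of_finite
  have hcard : Nat.card F = p ^ (m * a * Module.finrank L F) := by
    rw [Module.natCard_eq_pow_finrank (K := L), FiniteField.natCard_extension,
      Nat.card_eq_fintype_card, hm, pow_mul, pow_mul]
  rw [hmap, abs_le]
  constructor
  · refine le_trans ?_ (H F _ _ (Nat.mul_pos (Nat.mul_pos m.pos ha) Module.finrank_pos)
      (dvd_mul_of_dvd_left (dvd_mul_left _ _) _) hcard)
    exact neg_le_neg (mul_le_mul_of_nonneg_right (le_max_right _ _) hpos)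
  · let : Algebra k' F := ((algebraMap L F).comp ψ).toAlgebra
    refine le_trans (le_of_eq ?_) ((hk F).trans
      (mul_le_mul_of_nonneg_right (le_max_left _ _) hpos))
    rw [map_map]
    rfl
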